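/- There exists an integer N₀ such that every integer n ≥ N₀ can be written as the sum of at most 7 primes, i.e., there exist an integer s with 1 ≤ s ≤ 7 and primes p₁, …, p_s with p₁ + … + p_s = n. -/

import Mathlib

namespace SevenPrimes

section
open MeasureTheory Filter Topology Set

/-- The dilated Fejér kernel. -/
noncomputable def fejer (l x : ℝ) : ℝ := l * Real.sinc (l * x / 2) ^ 2

lemma continuous_fejer (l : ℝ) : Continuous (fejer l) := by
  unfold fejer
  exact continuous_const.mul ((Real.continuous_sinc.comp (by fun_prop)).pow 2)

lemma fejer_nonneg {l : ℝ} (hl : 0 < l) (x : ℝ) : 0 ≤ fejer l x := by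
  unfold fejer; positivity

lemma sq_mul_sinc_sq_le (y : ℝ) : y ^ 2 * Real.sinc y ^ 2 ≤ 1 := by
  rcases eq_or_ne y 0 with rfl | hy
  · simp
  · rw [Real.sinc_of_ne_zero hy, ← mul_pow, mul_div_cancel₀ _ hy]
    exact Real.sin_sq_le_one y

lemma sinc_sq_le_one (y : ℝ) : Real.sinc y ^ 2 ≤ 1 := by
  rw [sq_le_one_iff_abs_le_one, abs_le]
  exact ⟨Real.neg_one_le_sinc y, Real.sinc_le_one y⟩

lemma fejer_le_far {l d x : ℝ} (hl : 0 < l) (hd : 0 < d) (hx : d ≤ |x|) :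
    fejer l x ≤ 4 * (1 + (d ^ 2)⁻¹) / l * (1 + x ^ 2)⁻¹ := by
  have hx2 : d ^ 2 ≤ x ^ 2 := by rw [← sq_abs x]; gcongr
  have h1 := sq_mul_sinc_sq_le (l * x / 2)
  have hxp : 0 < x ^ 2 := lt_of_lt_of_le (by positivity) hx2
  have h2 : fejer l x ≤ 4 / l * (x ^ 2)⁻¹ := by
    unfold fejer
    rw [div_mul_eq_mul_div, le_div_iff₀ hl, ← div_eq_mul_inv, le_div_iff₀ hxp]
    nlinarith
  refine h2.trans ?_
  have h3 : (x ^ 2)⁻¹ ≤ (1 + (d ^ 2)⁻¹) * (1 + x ^ 2)⁻¹ := by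
    rw [← div_eq_mul_inv, le_div_iff₀ (by positivity)]
    have : (x ^ 2)⁻¹ ≤ (d ^ 2)⁻¹ := by gcongr
    have h4 : (x ^ 2)⁻¹ * x ^ 2 = 1 := inv_mul_cancel₀ hxp.ne'
    nlinarith
  calc 4 / l * (x ^ 2)⁻¹ ≤ 4 / l * ((1 + (d ^ 2)⁻¹) * (1 + x ^ 2)⁻¹) := by gcongr
    _ = _ := by ring

lemma fejer_le {l : ℝ} (hl : 0 < l) (x : ℝ) :
    fejer l x ≤ (2 * l + 8 / l) * (1 + x ^ 2)⁻¹ := by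
  rcases le_total 1 |x| with h | h
  · refine (fejer_le_far hl one_pos h).trans ?_
    have : 4 * (1 + ((1:ℝ) ^ 2)⁻¹) / l ≤ 2 * l + 8 / l := by
      norm_num; linarith
    gcongr
  · have h1 : fejer l x ≤ l := by
      unfold fejer
      have := sinc_sq_le_one (l * x / 2)
      nlinarith
    have hx2 : x ^ 2 ≤ 1 := by rwa [sq_le_one_iff_abs_le_one]
    have h3 : (1 / 2 : ℝ) ≤ (1 + x ^ 2)⁻¹ := by
      rw [← one_div]; gcongr; linarith
    have h4 : 0 < 8 / l := by positivity
    nlinarith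

lemma fejer_ge {l x : ℝ} (hl : 0 < l) (hx : |x| ≤ l⁻¹) : l / 4 ≤ fejer l x := by
  unfold fejer
  have key : ∀ y : ℝ, 0 < y → y ≤ 1 / 2 → 1 / 2 ≤ Real.sinc y := by
    intro y hy0 hy
    rw [Real.sinc_of_ne_zero hy0.ne', le_div_iff₀ hy0]
    have := Real.sin_gt_sub_cube hy0
    nlinarith [mul_pos hy0 hy0]
  have h1 : |l * x / 2| ≤ 1 / 2 := by
    rw [abs_div, abs_mul, abs_of_pos hl]
    have : l * |x| ≤ l * l⁻¹ := by gcongr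
    rw [mul_inv_cancel₀ hl.ne'] at this
    norm_num; linarith
  have h2 : 1 / 2 ≤ Real.sinc (l * x / 2) := by
    rcases lt_trichotomy (l * x / 2) 0 with h | h | h
    · rw [← Real.sinc_neg]
      exact key _ (by linarith) (by rw [abs_of_neg h] at h1; exact h1)
    · rw [h, Real.sinc_zero]; norm_num
    · exact key _ h (by rwa [abs_of_pos h] at h1)
  have h3 : 1 / 4 ≤ Real.sinc (l * x / 2) ^ 2 := by nlinarith
  nlinarith

lemma integrable_fejer {l : ℝ} (hl : 0 < l) : Integrable (fejer l) := by
  refine (integrable_inv_one_add_sq.const_mul (2 * l + 8 / l)).mono'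
    (continuous_fejer l).aestronglyMeasurable (Eventually.of_forall fun x => ?_)
  rw [Real.norm_of_nonneg (fejer_nonneg hl x)]
  exact fejer_le hl x

lemma integral_half_triangle {l : ℝ} (hl : 0 < l) {x : ℝ} (hx : x ≠ 0) :
    ∫ t in (0 : ℝ)..l, ((1 - t / l : ℝ) : ℂ) * Complex.exp (t * x * Complex.I) =
      Complex.exp (l * x * Complex.I) / (l * (x * Complex.I) ^ 2) - 1 / (x * Complex.I) -
        1 / (l * (x * Complex.I) ^ 2) := by
  have hxI : (x : ℂ) * Complex.I ≠ 0 := by simp [hx]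
  have hlc : (l : ℂ) ≠ 0 := by exact_mod_cast hl.ne'
  have hderiv : ∀ t ∈ uIcc (0 : ℝ) l, HasDerivAt
      (fun t : ℝ => (1 - (t : ℂ) / l) * Complex.exp (t * x * Complex.I) / (x * Complex.I) +
        Complex.exp (t * x * Complex.I) / (l * (x * Complex.I) ^ 2))
      (((1 - t / l : ℝ) : ℂ) * Complex.exp (t * x * Complex.I)) t := by
    intro t _
    have hid : HasDerivAt (fun t : ℝ => (t : ℂ)) 1 t := Complex.ofRealCLM.hasDerivAt
    have he : HasDerivAt (fun t : ℝ => Complex.exp (t * x * Complex.I))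
        (Complex.exp (t * x * Complex.I) * (1 * x * Complex.I)) t :=
      ((hid.mul_const (x : ℂ)).mul_const Complex.I).cexp
    have h1 := (((hasDerivAt_const t (1 : ℂ)).sub (hid.div_const (l : ℂ))).mul he).div_const
      (x * Complex.I)
    have h2 := he.div_const (l * (x * Complex.I) ^ 2)
    refine (h1.add h2).congr_deriv ?_
    have hI : Complex.I ≠ 0 := Complex.I_ne_zero
    have hx' : (x : ℂ) ≠ 0 := by exact_mod_cast hx
    simp only [Pi.sub_apply]
    push_cast
    field_simp
    ring
  rw [intervalIntegral.integral_eq_sub_of_hasDerivAt hderiv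
    (Continuous.intervalIntegrable (by fun_prop) _ _)]
  simp only [Complex.ofReal_zero, zero_div, zero_mul, Complex.exp_zero, div_self hlc]
  ring

lemma integral_triangle {l : ℝ} (hl : 0 < l) (x : ℝ) :
    ∫ t in (-l)..l, ((1 - |t| / l : ℝ) : ℂ) * Complex.exp (t * x * Complex.I) = fejer l x := by
  have hcont : Continuous fun t : ℝ =>
      ((1 - |t| / l : ℝ) : ℂ) * Complex.exp (t * x * Complex.I) := by fun_prop
  rw [← intervalIntegral.integral_add_adjacent_intervals (b := 0)
    (hcont.intervalIntegrable _ _) (hcont.intervalIntegrable _ _)]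
  have hr : ∫ t in (0 : ℝ)..l, ((1 - |t| / l : ℝ) : ℂ) * Complex.exp (t * x * Complex.I) =
      ∫ t in (0 : ℝ)..l, ((1 - t / l : ℝ) : ℂ) * Complex.exp (t * x * Complex.I) := by
    refine intervalIntegral.integral_congr fun t ht => ?_
    rw [uIcc_of_le hl.le] at ht
    simp only [abs_of_nonneg ht.1]
  have hn : ∫ t in (-l)..0, ((1 - |t| / l : ℝ) : ℂ) * Complex.exp (t * x * Complex.I) =
      ∫ t in (0 : ℝ)..l, ((1 - t / l : ℝ) : ℂ) * Complex.exp (t * (-x : ℝ) * Complex.I) := by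
    have := intervalIntegral.integral_comp_neg (a := 0) (b := l)
      (fun t : ℝ => ((1 - |t| / l : ℝ) : ℂ) * Complex.exp (t * x * Complex.I))
    rw [neg_zero] at this
    rw [← this]
    refine intervalIntegral.integral_congr fun t ht => ?_
    rw [uIcc_of_le hl.le] at ht
    simp only [abs_neg, abs_of_nonneg ht.1]
    push_cast
    ring_nf
  rw [hr, hn]
  rcases eq_or_ne x 0 with rfl | hx
  · have h1 : ∫ t in (0 : ℝ)..l, ((1 - t / l : ℝ) : ℂ) = ((l / 2 : ℝ) : ℂ) := by
      rw [intervalIntegral.integral_ofReal, intervalIntegral.integral_sub (by simp)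
        (Continuous.intervalIntegrable (by fun_prop) _ _), intervalIntegral.integral_div]
      simp only [intervalIntegral.integral_const, integral_id]
      congr 1
      simp
      field_simp
      ring
    simp only [neg_zero, Complex.ofReal_zero, mul_zero, zero_mul, Complex.exp_zero, mul_one, h1]
    simp [fejer]
  · rw [integral_half_triangle hl hx, integral_half_triangle hl (neg_ne_zero.mpr hx)]
    have hcos : Complex.exp (l * x * Complex.I) + Complex.exp (-(l * x * Complex.I)) =
        ((2 - 4 * Real.sin (l * x / 2) ^ 2 : ℝ) : ℂ) := by
      have h := Real.cos_two_mul' (l * x / 2)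
      have h' := Real.sin_sq_add_cos_sq (l * x / 2)
      have h2 : 2 - 4 * Real.sin (l * x / 2) ^ 2 = 2 * Real.cos (l * x) := by
        rw [mul_div_cancel₀ _ (two_ne_zero)] at h; linarith
      rw [h2]
      push_cast
      rw [Complex.cos]
      ring_nf
    have hx' : (x : ℂ) ≠ 0 := by exact_mod_cast hx
    have hlc : (l : ℂ) ≠ 0 := by exact_mod_cast hl.ne'
    have hlx : l * x / 2 ≠ 0 := by positivity
    rw [fejer, Real.sinc_of_ne_zero hlx]
    have e1 : (l : ℂ) * ((-x : ℝ) : ℂ) * Complex.I = -(l * x * Complex.I) := by push_cast; ring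
    rw [e1]
    have e2 : Complex.exp (l * x * Complex.I) = ((2 - 4 * Real.sin (l * x / 2) ^ 2 : ℝ) : ℂ) -
      Complex.exp (-(l * x * Complex.I)) := by rw [← hcos]; ring
    rw [e2, mul_pow, mul_pow, Complex.I_sq]
    push_cast
    have hI : Complex.I ≠ 0 := Complex.I_ne_zero
    field_simp
    ring

lemma integrable_mul_exp_neg {b : ℝ → ℝ} {K : ℝ} (hbm : Measurable b) (hK : ∀ u, |b u| ≤ K)
    (hneg : ∀ u ≤ 0, b u = 0) {d : ℝ} (hd : 0 < d) :
    Integrable fun u => b u * Real.exp (-(d * u)) := by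
  have h1 : IntegrableOn (fun u : ℝ => K * Real.exp (-d * u)) (Ioi 0) :=
    (integrableOn_exp_mul_Ioi (by linarith) 0).const_mul K
  have h2 : IntegrableOn (fun u => b u * Real.exp (-(d * u))) (Ioi 0) := by
    refine h1.mono' (by fun_prop) (Eventually.of_forall fun u => ?_)
    rw [norm_mul, Real.norm_eq_abs, Real.norm_eq_abs, Real.abs_exp, neg_mul]
    gcongr
    exact hK u
  refine (integrableOn_iff_integrable_of_support_subset fun u hu => ?_).mp h2
  by_contra h
  simp [hneg u (not_lt.mp h)] at hu

lemma integral_mul_fejer_damped {b : ℝ → ℝ} {K : ℝ} (hbm : Measurable b) (hK : ∀ u, |b u| ≤ K)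
    (hneg : ∀ u ≤ 0, b u = 0) {h : ℂ → ℂ}
    (hh : ∀ s : ℂ, 0 < s.re → ∫ u : ℝ, (b u : ℂ) * Complex.exp (-(s * u)) = h s)
    {l d : ℝ} (hl : 0 < l) (hd : 0 < d) (v : ℝ) :
    ∫ u : ℝ, ((b u * Real.exp (-(d * u)) * fejer l (v - u) : ℝ) : ℂ) =
      ∫ t in (-l)..l, ((1 - |t| / l : ℝ) : ℂ) * Complex.exp (t * v * Complex.I) *
        h (d + t * Complex.I) := by
  have hfi := integrable_mul_exp_neg hbm hK hneg hd
  have hswap := intervalIntegral_integral_swap (μ := volume) (a := -l) (b := l)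
    (f := fun (t : ℝ) (u : ℝ) => ((1 - |t| / l : ℝ) : ℂ) *
      Complex.exp (t * (v - u : ℝ) * Complex.I) * ((b u * Real.exp (-(d * u)) : ℝ) : ℂ)) ?_
  · have hL : ∀ u : ℝ, ((b u * Real.exp (-(d * u)) * fejer l (v - u) : ℝ) : ℂ) =
        ∫ t in (-l)..l, ((1 - |t| / l : ℝ) : ℂ) *
      Complex.exp (t * (v - u : ℝ) * Complex.I) * ((b u * Real.exp (-(d * u)) : ℝ) : ℂ) := by
      intro u
      rw [intervalIntegral.integral_mul_const, integral_triangle hl]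
      push_cast; ring
    simp_rw [hL]
    rw [← hswap]
    refine intervalIntegral.integral_congr fun t _ => ?_
    rw [← hh _ (by simpa using hd), ← integral_const_mul]
    congr 1
    ext u
    push_cast
    have : Complex.exp (t * (v - u) * Complex.I) * Complex.exp (-(d * u)) =
        Complex.exp (t * v * Complex.I) * Complex.exp (-((d + t * Complex.I) * u)) := by
      rw [← Complex.exp_add, ← Complex.exp_add]
      ring_nf
    linear_combination ((1 - |t| / l : ℂ) * b u) * this
  · have h1 : Integrable (fun p : ℝ × ℝ => (1 : ℂ) * ((b p.2 * Real.exp (-(d * p.2)) : ℝ) : ℂ))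
        ((volume.restrict (Set.uIoc (-l) l)).prod volume) := by
      have : IsFiniteMeasure (volume.restrict (Set.uIoc (-l) l)) := by
        rw [uIoc]; infer_instance
      exact (integrable_const (1 : ℂ)).mul_prod hfi.ofReal
    refine h1.mono (by unfold Function.uncurry; fun_prop) ?_
    have h2 : ∀ᵐ p : ℝ × ℝ ∂((volume.restrict (Set.uIoc (-l) l)).prod volume),
        p.1 ∈ Set.uIoc (-l) l := by
      exact Measure.quasiMeasurePreserving_fst.ae (ae_restrict_mem measurableSet_uIoc)
    filter_upwards [h2] with p hp
    rw [uIoc_of_le (by linarith)] at hp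
    simp only [Function.uncurry, norm_mul, one_mul]
    rw [← Complex.ofReal_mul, Complex.norm_exp_ofReal_mul_I, mul_one]
    refine mul_le_of_le_one_left (by positivity) ?_
    rw [Complex.norm_real, Real.norm_eq_abs, abs_le]
    have h3 : |p.1| / l ≤ 1 := by
      rw [div_le_one hl, abs_le]; exact ⟨hp.1.le, hp.2⟩
    have h4 : 0 ≤ |p.1| / l := by positivity
    constructor <;> linarith

lemma integral_mul_fejer {b : ℝ → ℝ} {K : ℝ} (hbm : Measurable b) (hK : ∀ u, |b u| ≤ K)
    (hneg : ∀ u ≤ 0, b u = 0) {h : ℂ → ℂ} (hc : ContinuousOn h {s | 0 ≤ s.re})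
    (hh : ∀ s : ℂ, 0 < s.re → ∫ u : ℝ, (b u : ℂ) * Complex.exp (-(s * u)) = h s)
    {l : ℝ} (hl : 0 < l) (v : ℝ) :
    ((∫ u : ℝ, b u * fejer l (v - u) : ℝ) : ℂ) =
      ∫ t in (-l)..l, ((1 - |t| / l : ℝ) : ℂ) * Complex.exp (t * v * Complex.I) *
        h (t * Complex.I) := by
  have hfi : Integrable fun u => fejer l (v - u) := (integrable_fejer hl).comp_sub_left v
  have hcf : Measurable fun u => fejer l (v - u) :=
    ((continuous_fejer l).comp (by fun_prop)).measurable
  have hKn : 0 ≤ K := (abs_nonneg _).trans (hK 0)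
  have hL : Tendsto (fun d : ℝ => ∫ u : ℝ, ((b u * Real.exp (-(d * u)) * fejer l (v - u) : ℝ) : ℂ))
      (𝓝[>] 0) (𝓝 (∫ u : ℝ, ((b u * fejer l (v - u) : ℝ) : ℂ))) := by
    refine tendsto_integral_filter_of_dominated_convergence (fun u => K * fejer l (v - u))
      (Eventually.of_forall fun d => ?_) ?_ (hfi.const_mul K) (Eventually.of_forall fun u => ?_)
    · exact Measurable.aestronglyMeasurable (by fun_prop)
    · filter_upwards [self_mem_nhdsWithin] with d (hd : 0 < d)
      refine Eventually.of_forall fun u => ?_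
      have hf := fejer_nonneg hl (v - u)
      rw [Complex.norm_real, norm_mul, norm_mul, Real.norm_of_nonneg hf, Real.norm_eq_abs,
        Real.norm_eq_abs, Real.abs_exp]
      rcases le_or_gt u 0 with hu | hu
      · rw [hneg u hu]; simp; positivity
      · have : Real.exp (-(d * u)) ≤ 1 := by
          rw [Real.exp_le_one_iff]; have := mul_pos hd hu; linarith
        have h2 := hK u
        have h3 : |b u| * Real.exp (-(d * u)) ≤ K := by
          calc _ ≤ K * 1 := by gcongr
            _ = K := mul_one K
        gcongr
    · have : Continuous fun d : ℝ => ((b u * Real.exp (-(d * u)) * fejer l (v - u) : ℝ) : ℂ) := by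
        fun_prop
      have := this.tendsto 0
      simp only [zero_mul, neg_zero, Real.exp_zero, mul_one] at this
      exact this.mono_left nhdsWithin_le_nhds
  have hcpt : IsCompact ((fun p : ℝ × ℝ => (p.1 + p.2 * Complex.I : ℂ)) ''
      (Icc 0 1 ×ˢ Icc (-l) l)) :=
    (isCompact_Icc.prod isCompact_Icc).image (by fun_prop)
  have hsub : (fun p : ℝ × ℝ => (p.1 + p.2 * Complex.I : ℂ)) '' (Icc 0 1 ×ˢ Icc (-l) l) ⊆
      {s | 0 ≤ s.re} := by
    rintro _ ⟨p, hp, rfl⟩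
    simpa using hp.1.1
  obtain ⟨B, hB⟩ := hcpt.exists_bound_of_continuousOn (hc.mono hsub)
  have hcR : ∀ d : ℝ, 0 ≤ d → Continuous fun t : ℝ => h (d + t * Complex.I) := by
    intro d hd
    refine hc.comp_continuous (by fun_prop) fun t => by simpa using hd
  have hR : Tendsto (fun d : ℝ => ∫ t in (-l)..l, ((1 - |t| / l : ℝ) : ℂ) *
      Complex.exp (t * v * Complex.I) * h (d + t * Complex.I))
      (𝓝[>] 0) (𝓝 (∫ t in (-l)..l, ((1 - |t| / l : ℝ) : ℂ) *
      Complex.exp (t * v * Complex.I) * h (t * Complex.I))) := by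
    refine intervalIntegral.tendsto_integral_filter_of_dominated_convergence
      (fun t => ‖((1 - |t| / l : ℝ) : ℂ) * Complex.exp (t * v * Complex.I)‖ * B) ?_ ?_ ?_ ?_
    · filter_upwards [self_mem_nhdsWithin] with d (hd : 0 < d)
      have := hcR d hd.le
      exact Continuous.aestronglyMeasurable (Continuous.mul (by fun_prop) this)
    · have : Ioc (0 : ℝ) 1 ∈ 𝓝[>] (0 : ℝ) := Ioc_mem_nhdsGT one_pos
      filter_upwards [this] with d hd
      refine Eventually.of_forall fun t ht => ?_
      rw [uIoc_of_le (by linarith)] at ht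
      rw [norm_mul]
      gcongr
      exact hB _ ⟨(d, t), ⟨⟨hd.1.le, hd.2⟩, ⟨ht.1.le, ht.2⟩⟩, rfl⟩
    · exact Continuous.intervalIntegrable (by fun_prop) _ _
    · refine Eventually.of_forall fun t _ => ?_
      refine Tendsto.const_mul _ ?_
      have h1 : ContinuousWithinAt h {s | 0 ≤ s.re} (t * Complex.I) := hc _ (by simp)
      refine h1.tendsto.comp (tendsto_nhdsWithin_iff.mpr ⟨?_, ?_⟩)
      · have : Continuous fun d : ℝ => (d + t * Complex.I : ℂ) := by fun_prop
        have := this.tendsto 0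
        simp only [Complex.ofReal_zero, zero_add] at this
        exact this.mono_left nhdsWithin_le_nhds
      · filter_upwards [self_mem_nhdsWithin] with d (hd : 0 < d)
        simpa using hd.le
  rw [← integral_complex_ofReal]
  refine tendsto_nhds_unique hL (hR.congr' ?_)
  filter_upwards [self_mem_nhdsWithin] with d (hd : 0 < d)
  exact (integral_mul_fejer_damped hbm hK hneg hh hl hd v).symm

lemma tendsto_integral_mul_fejer {b : ℝ → ℝ} {K : ℝ} (hbm : Measurable b) (hK : ∀ u, |b u| ≤ K)
    (hneg : ∀ u ≤ 0, b u = 0) {h : ℂ → ℂ} (hc : ContinuousOn h {s | 0 ≤ s.re})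
    (hh : ∀ s : ℂ, 0 < s.re → ∫ u : ℝ, (b u : ℂ) * Complex.exp (-(s * u)) = h s)
    {l : ℝ} (hl : 0 < l) :
    Tendsto (fun v => ∫ u : ℝ, b u * fejer l (v - u)) atTop (𝓝 0) := by
  have h1 := Real.tendsto_integral_exp_smul_cocompact (fun t : ℝ => (Ioc (-l) l).indicator
    (fun t : ℝ => ((1 - |t| / l : ℝ) : ℂ) * h (t * Complex.I)) t)
  have h2 : Tendsto (fun v : ℝ => -(v / (2 * Real.pi))) atTop (cocompact ℝ) := by
    refine Tendsto.mono_right ?_ atBot_le_cocompact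
    exact tendsto_neg_atTop_atBot.comp (tendsto_id.atTop_div_const (by positivity))
  have h3 := h1.comp h2
  have h4 : Tendsto (fun v => ((∫ u : ℝ, b u * fejer l (v - u) : ℝ) : ℂ)) atTop (𝓝 0) := by
    refine h3.congr fun v => ?_
    rw [integral_mul_fejer hbm hK hneg hc hh hl v, intervalIntegral.integral_of_le (by linarith),
      ← integral_indicator measurableSet_Ioc]
    simp only [Function.comp_apply]
    congr 1
    ext t
    simp only [indicator_apply]
    split_ifs
    · rw [Circle.smul_def, Real.fourierChar_apply, smul_eq_mul]
      have : ((2 * Real.pi * -(t * -(v / (2 * Real.pi))) : ℝ) : ℂ) * Complex.I =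
          t * v * Complex.I := by
        have : (Real.pi : ℂ) ≠ 0 := by exact_mod_cast Real.pi_ne_zero
        push_cast
        field_simp
      rw [this]
      ring
    · simp
  have := Complex.continuous_re.tendsto (0 : ℂ) |>.comp h4
  simpa [Function.comp_def] using this

/-- A bounded function whose Fejér means vanish at infinity, and which stays above half its value
on a nearby interval whenever it is at least `e`, is eventually below `e`. -/
lemma eventually_lt_of_tendsto_fejer {g : ℝ → ℝ} {K e d : ℝ} (hgm : Measurable g)
    (hK : ∀ u, |g u| ≤ K)
    (hg : ∀ l > 0, Tendsto (fun v => ∫ u : ℝ, g u * fejer l (v - u)) atTop (𝓝 0))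
    (he : 0 < e) (hd : 0 < d)
    (hwin : ∀ u ≥ 1, e ≤ g u → ∃ v ≥ u - 1, ∀ x, |v - x| ≤ d → e / 2 ≤ g x) :
    ∀ᶠ u in atTop, g u < e := by
  have hKn : 0 ≤ K := (abs_nonneg _).trans (hK 0)
  set B := K * (4 * (1 + (d ^ 2)⁻¹)) * Real.pi with hB
  have hBn : 0 ≤ B := by positivity
  obtain ⟨l, hl1, hl2, hl⟩ : ∃ l : ℝ, l⁻¹ ≤ d ∧ B / l ≤ e / 16 ∧ 0 < l := by
    refine ⟨max d⁻¹ (16 * (B + 1) / e), ?_, ?_, lt_max_of_lt_left (by positivity)⟩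
    · rw [inv_le_comm₀ (lt_max_of_lt_left (by positivity)) hd]
      exact le_max_left _ _
    · rw [div_le_iff₀ (lt_max_of_lt_left (by positivity))]
      have : 16 * (B + 1) / e ≤ max d⁻¹ (16 * (B + 1) / e) := le_max_right _ _
      rw [div_le_iff₀ he] at this
      nlinarith
  have hlow : ∀ v, (∀ x, |v - x| ≤ d → e / 2 ≤ g x) →
      e / 4 - B / l ≤ ∫ u : ℝ, g u * fejer l (v - u) := by
    intro v hv
    have hI : Integrable fun u => (Icc (v - l⁻¹) (v + l⁻¹)).indicator (fun _ => e / 2 * (l / 4)) u -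
        K * (4 * (1 + (d ^ 2)⁻¹) / l) * (1 + (v - u) ^ 2)⁻¹ := by
      refine Integrable.sub ?_ ?_
      · exact (integrable_indicator_iff measurableSet_Icc).mpr (integrableOn_const (by simp))
      · exact (integrable_inv_one_add_sq.comp_sub_left v).const_mul _
    have hI' : Integrable fun u => g u * fejer l (v - u) :=
      ((integrable_fejer hl).comp_sub_left v).bdd_mul (c := K) hgm.aestronglyMeasurable
        (Eventually.of_forall hK)
    have hval : ∫ u, ((Icc (v - l⁻¹) (v + l⁻¹)).indicator (fun _ => e / 2 * (l / 4)) u -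
        K * (4 * (1 + (d ^ 2)⁻¹) / l) * (1 + (v - u) ^ 2)⁻¹) = e / 4 - B / l := by
      rw [integral_sub, integral_indicator measurableSet_Icc, setIntegral_const, integral_const_mul,
        integral_sub_left_eq_self (fun u : ℝ => (1 + u ^ 2)⁻¹) volume v,
        integral_univ_inv_one_add_sq, Real.volume_real_Icc_of_le (by linarith [inv_pos.mpr hl])]
      · rw [smul_eq_mul, hB]; field_simp; ring
      · exact (integrable_indicator_iff measurableSet_Icc).mpr (integrableOn_const (by simp))
      · exact (integrable_inv_one_add_sq.comp_sub_left v).const_mul _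
    rw [← hval]
    refine integral_mono hI hI' fun u => ?_
    have hfn := fejer_nonneg hl (v - u)
    have hpos : 0 ≤ K * (4 * (1 + (d ^ 2)⁻¹) / l) * (1 + (v - u) ^ 2)⁻¹ := by positivity
    simp only [indicator_apply, mem_Icc]
    split_ifs with hu
    · have h1 : |v - u| ≤ l⁻¹ := by rw [abs_le]; constructor <;> linarith
      have h2 := hv u (h1.trans hl1)
      have h3 := fejer_ge hl h1
      have : e / 2 * (l / 4) ≤ g u * fejer l (v - u) := by
        have : 0 ≤ g u := by linarith
        gcongr
      linarith
    · rcases le_or_gt |v - u| d with h1 | h1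
      · have := hv u h1
        have : 0 ≤ g u * fejer l (v - u) := mul_nonneg (by linarith) hfn
        linarith
      · have h2 := fejer_le_far hl hd h1.le
        have h3 : -K ≤ g u := (abs_le.mp (hK u)).1
        have h4 : -(K * fejer l (v - u)) ≤ g u * fejer l (v - u) := by nlinarith
        have h5 : K * fejer l (v - u) ≤ K * (4 * (1 + (d ^ 2)⁻¹) / l * (1 + (v - u) ^ 2)⁻¹) := by
          gcongr
        linarith
  have hev := (hg l hl).eventually (gt_mem_nhds (show (0 : ℝ) < e / 8 by positivity))
  obtain ⟨V, hV⟩ := eventually_atTop.mp hev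
  filter_upwards [eventually_ge_atTop (max 1 (V + 1))] with u hu
  by_contra! hge
  obtain ⟨v, hv1, hv2⟩ := hwin u (le_of_max_le_left hu) hge
  have h1 := hV v (by linarith [le_of_max_le_right hu])
  have h2 := hlow v hv2
  linarith

/-- The Tauberian step of the Wiener-Ikehara theorem for bounded slowly decreasing functions. -/
theorem tendsto_zero_of_laplace {b : ℝ → ℝ} {K A : ℝ} (hbm : Measurable b) (hK : ∀ u, |b u| ≤ K)
    (hneg : ∀ u ≤ 0, b u = 0) {h : ℂ → ℂ} (hc : ContinuousOn h {s | 0 ≤ s.re})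
    (hh : ∀ s : ℂ, 0 < s.re → ∫ u : ℝ, (b u : ℂ) * Complex.exp (-(s * u)) = h s)
    (hA : ∀ u > 0, ∀ s ≥ 0, b u - A * s ≤ b (u + s)) :
    Tendsto b atTop (𝓝 0) := by
  have hfej := fun l (hl : (0 : ℝ) < l) => tendsto_integral_mul_fejer hbm hK hneg hc hh hl
  have hfej' : ∀ l > 0, Tendsto (fun v => ∫ u : ℝ, (-b u) * fejer l (v - u)) atTop (𝓝 0) := by
    intro l hl
    have := (hfej l hl).neg
    simpa [integral_neg] using this
  rw [Metric.tendsto_nhds]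
  intro e he
  obtain ⟨d, hd, hd1, hd2⟩ : ∃ d : ℝ, 0 < d ∧ d ≤ 1 / 4 ∧ A * (2 * d) ≤ e / 2 := by
    refine ⟨min (1 / 4) (e / (4 * (|A| + 1))), by positivity, min_le_left _ _, ?_⟩
    have h1 : min (1 / 4) (e / (4 * (|A| + 1))) ≤ e / (4 * (|A| + 1)) := min_le_right _ _
    have h0 : 0 ≤ min (1 / 4) (e / (4 * (|A| + 1))) := by positivity
    rw [le_div_iff₀ (by positivity)] at h1
    have := le_abs_self A
    nlinarith
  have hs : ∀ s, 0 ≤ s → s ≤ 2 * d → A * s ≤ e / 2 := by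
    intro s hs0 hs1
    rcases le_total 0 A with hA0 | hA0
    · exact (mul_le_mul_of_nonneg_left hs1 hA0).trans hd2
    · nlinarith
  have h1 : ∀ᶠ u in atTop, b u < e := by
    refine eventually_lt_of_tendsto_fejer hbm hK hfej he hd fun u hu hge =>
      ⟨u + d, by linarith, fun x hx => ?_⟩
    rw [abs_le] at hx
    have := hs (x - u) (by linarith) (by linarith)
    have := hA u (by linarith) (x - u) (by linarith)
    rw [add_sub_cancel] at this
    linarith
  have h2 : ∀ᶠ u in atTop, -b u < e := by
    refine eventually_lt_of_tendsto_fejer hbm.neg (K := K) (by simpa using hK) hfej' he hd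
      fun u hu hge => ⟨u - d, by linarith, fun x hx => ?_⟩
    rw [abs_le] at hx
    have := hs (u - x) (by linarith) (by linarith)
    have := hA x (by linarith) (u - x) (by linarith)
    rw [add_sub_cancel] at this
    linarith
  filter_upwards [h1, h2] with u hu1 hu2
  rw [Real.dist_eq, sub_zero, abs_lt]
  constructor <;> linarith

open ArithmeticFunction ArithmeticFunction.vonMangoldt

/-- Weighted count of prime powers in a residue class. -/
noncomputable def psiClass {q : ℕ} (a : ZMod q) (x : ℝ) : ℝ :=
  ∑ k ∈ Finset.Icc 1 ⌊x⌋₊, residueClass a k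

lemma psiClass_mono {q : ℕ} (a : ZMod q) : Monotone (psiClass a) := by
  intro x y hxy
  refine Finset.sum_le_sum_of_subset_of_nonneg (Finset.Icc_subset_Icc_right (Nat.floor_mono hxy))
    fun k _ _ => residueClass_nonneg a k

lemma psiClass_nonneg {q : ℕ} (a : ZMod q) (x : ℝ) : 0 ≤ psiClass a x :=
  Finset.sum_nonneg fun k _ => residueClass_nonneg a k

lemma psiClass_le {q : ℕ} (a : ZMod q) {x : ℝ} (hx : 0 ≤ x) :
    psiClass a x ≤ (Real.log 4 + 4) * x := by
  refine le_trans ?_ (Chebyshev.psi_le_const_mul_self hx)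
  rw [Chebyshev.psi_eq_sum_Icc]
  calc psiClass a x ≤ ∑ k ∈ Finset.Icc 1 ⌊x⌋₊, ArithmeticFunction.vonMangoldt k :=
        Finset.sum_le_sum fun k _ => residueClass_le a k
    _ ≤ _ := Finset.sum_le_sum_of_subset_of_nonneg (Finset.Icc_subset_Icc_left zero_le_one)
        fun k _ _ => vonMangoldt_nonneg

theorem tendsto_psiClass_exp {q : ℕ} [NeZero q] {a : ZMod q} (ha : IsUnit a) :
    Tendsto (fun u : ℝ => Real.exp (-u) * psiClass a (Real.exp u)) atTop
      (𝓝 ((q.totient : ℝ)⁻¹)) := by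
  set c : ℝ := (q.totient : ℝ)⁻¹ with hc
  set C : ℝ := Real.log 4 + 4 with hC
  have hCp : 0 < C := by positivity
  have hcn : 0 ≤ c := by positivity
  let b : ℝ → ℝ := (Ioi (0 : ℝ)).indicator fun u => Real.exp (-u) * psiClass a (Real.exp u) - c
  let h : ℂ → ℂ := fun s => (LFunctionResidueClassAux a (s + 1) - c) / (s + 1)
  have hmeas : Measurable fun u : ℝ => Real.exp (-u) * psiClass a (Real.exp u) :=
    (by fun_prop : Measurable fun u : ℝ => Real.exp (-u)).mul
      ((psiClass_mono a).measurable.comp Real.measurable_exp)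
  have hbound : ∀ u : ℝ, Real.exp (-u) * psiClass a (Real.exp u) ≤ C := by
    intro u
    have := psiClass_le a (Real.exp_pos u).le
    calc _ ≤ Real.exp (-u) * (C * Real.exp u) := by gcongr
      _ = C * (Real.exp (-u) * Real.exp u) := by ring
      _ = C := by rw [← Real.exp_add]; simp
  have hpos : ∀ u : ℝ, 0 ≤ Real.exp (-u) * psiClass a (Real.exp u) := fun u =>
    mul_nonneg (Real.exp_pos _).le (psiClass_nonneg _ _)
  have hb : Tendsto b atTop (𝓝 0) := by
    refine tendsto_zero_of_laplace (h := h) (K := C + c) (A := C)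
      ((hmeas.sub_const c).indicator measurableSet_Ioi) (fun u => ?_) (fun u hu => ?_) ?_
      (fun s hs => ?_) (fun u hu s hs => ?_)
    · simp only [b, indicator_apply]
      split_ifs
      · have := hbound u
        have := hpos u
        rw [abs_le]; constructor <;> linarith
      · simp; positivity
    · exact indicator_of_notMem (by simpa using hu) _
    · refine ContinuousOn.div (ContinuousOn.sub ?_ continuousOn_const) (by fun_prop) ?_
      · refine (continuousOn_LFunctionResidueClassAux a).comp (by fun_prop) fun s hs => ?_
        simpa using hs
      · intro s hs h0
        have := congrArg Complex.re h0
        simp only [Complex.add_re, Complex.one_re, Complex.zero_re, mem_ofPred_eq] at this hs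
        linarith
    · have hs1 : (1 : ℝ) < (s + 1).re := by simpa using hs
      have hs0 : s ≠ 0 := fun h0 => by simp [h0] at hs
      have hs10 : s + 1 ≠ 0 := fun h0 => by
        rw [h0] at hs1; simp at hs1; linarith
      have hL := LSeries_eq_mul_integral_of_nonneg (residueClass a) zero_le_one hs1 ?_
        (residueClass_nonneg a)
      · have hAux := eqOn_LFunctionResidueClassAux ha hs1
        have hsub := integral_comp_exp_Ioi
          (fun t : ℝ => (∑ k ∈ Finset.Icc 1 ⌊t⌋₊, (residueClass a k : ℂ)) *
            (t : ℂ) ^ (-(s + 1 + 1))) 0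
        rw [Real.exp_zero] at hsub
        rw [← hsub] at hL
        have hI : ∀ u : ℝ, Real.exp u • ((∑ k ∈ Finset.Icc 1 ⌊Real.exp u⌋₊,
            (residueClass a k : ℂ)) *
            ((Real.exp u : ℝ) : ℂ) ^ (-(s + 1 + 1))) =
            ((Real.exp (-u) * psiClass a (Real.exp u) : ℝ) : ℂ) * Complex.exp (-(s * u)) := by
          intro u
          rw [Complex.cpow_def_of_ne_zero (by simp), ← Complex.ofReal_log (Real.exp_pos u).le,
            Real.log_exp, Complex.real_smul, psiClass]
          push_cast
          have : Complex.exp u * Complex.exp (u * -(s + 1 + 1)) =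
              Complex.exp (-u) * Complex.exp (-(s * u)) := by
            rw [← Complex.exp_add, ← Complex.exp_add]; ring_nf
          linear_combination (∑ k ∈ Finset.Icc 1 ⌊Real.exp u⌋₊,
            (residueClass a k : ℂ)) * this
        simp_rw [hI] at hL
        have hexp : IntegrableOn (fun u : ℝ => Complex.exp (-(s * u))) (Ioi 0) := by
          have := integrableOn_exp_mul_complex_Ioi (a := -s) (by simpa using hs) 0
          simpa only [neg_mul] using this
        have hX : IntegrableOn (fun u : ℝ => ((Real.exp (-u) * psiClass a (Real.exp u) : ℝ) : ℂ) *
            Complex.exp (-(s * u))) (Ioi 0) := by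
          refine hexp.bdd_mul (c := C) hmeas.complex_ofReal.aestronglyMeasurable
            (Eventually.of_forall fun u => ?_)
          rw [Complex.norm_real, Real.norm_of_nonneg (hpos u)]
          exact hbound u
        have hb1 : ∀ u : ℝ, (b u : ℂ) * Complex.exp (-(s * u)) = (Ioi (0 : ℝ)).indicator
            (fun u => ((Real.exp (-u) * psiClass a (Real.exp u) : ℝ) : ℂ) *
            Complex.exp (-(s * u)) - c * Complex.exp (-(s * u))) u := by
          intro u
          simp only [b, indicator_apply]
          split_ifs
          · push_cast; ring
          · simp
        simp_rw [hb1]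
        rw [integral_indicator measurableSet_Ioi, integral_sub hX (hexp.const_mul _),
          integral_const_mul]
        have hE : ∫ u in Ioi (0 : ℝ), Complex.exp (-(s * u)) = 1 / s := by
          have := integral_exp_mul_complex_Ioi (a := -s) (by simpa using hs) 0
          simp only [neg_mul, Complex.ofReal_zero, mul_zero, Complex.exp_zero] at this
          rw [this]; field_simp
        simp only [add_sub_cancel_right] at hAux
        have hL' := eq_div_of_mul_eq hs10 ((mul_comm _ _).trans hL.symm)
        rw [hE, hL']
        simp only [h, hAux, hc]
        push_cast
        field_simp
        ring
      · refine Asymptotics.IsBigO.of_bound C (Eventually.of_forall fun n => ?_)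
        have h1 := psiClass_le a (Nat.cast_nonneg (α := ℝ) n)
        have h2 := psiClass_nonneg a n
        simp only [psiClass, Nat.floor_natCast] at h1 h2
        rw [Real.norm_of_nonneg h2, Real.rpow_one, Real.norm_of_nonneg (Nat.cast_nonneg n)]
        exact h1
    · simp only [b]
      rw [indicator_of_mem (by simpa using hu), indicator_of_mem (by simp; linarith)]
      have h1 : Real.exp (-(u + s)) * psiClass a (Real.exp u) ≤
          Real.exp (-(u + s)) * psiClass a (Real.exp (u + s)) := by
        gcongr
        exact psiClass_mono a (Real.exp_le_exp.mpr (by linarith))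
      rw [neg_add, Real.exp_add] at h1
      have h2 : 1 - s ≤ Real.exp (-s) := by linarith [Real.add_one_le_exp (-s)]
      have h3 := hbound u
      have h4 := hpos u
      rw [neg_add, Real.exp_add]
      nlinarith
  have hb' := hb.add_const c
  rw [zero_add] at hb'
  refine hb'.congr' ?_
  filter_upwards [eventually_gt_atTop 0] with u hu
  simp only [b]
  rw [indicator_of_mem (by simpa using hu)]
  ring

/-- The prime number theorem in arithmetic progressions, for a fixed modulus. -/
theorem tendsto_psiClass_div {q : ℕ} [NeZero q] {a : ZMod q} (ha : IsUnit a) :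
    Tendsto (fun x : ℝ => psiClass a x / x) atTop (𝓝 ((q.totient : ℝ)⁻¹)) := by
  refine ((tendsto_psiClass_exp ha).comp Real.tendsto_log_atTop).congr' ?_
  filter_upwards [eventually_gt_atTop 0] with x hx
  simp only [Function.comp_apply]
  rw [Real.exp_neg, Real.exp_log hx]
  ring

/-- Logarithmically weighted count of the primes below `y` congruent to `b` modulo `q`. -/
noncomputable def thetaClass (q b y : ℕ) : ℝ :=
  ∑ k ∈ Finset.range y, if k.Prime ∧ k ≡ b [MOD q] then Real.log k else 0

lemma abs_psiClass_sub_thetaClass_le {q : ℕ} (b n : ℕ) (hn : 1 ≤ n) :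
    |psiClass (b : ZMod q) n - thetaClass q b (n + 1)| ≤ 2 * √n * Real.log n := by
  refine le_trans ?_ (Chebyshev.psi_sub_theta_le (by exact_mod_cast hn))
  have h1 : thetaClass q b (n + 1) =
      ∑ k ∈ Finset.Icc 1 n, if k.Prime ∧ k ≡ b [MOD q] then Real.log k else 0 := by
    rw [thetaClass]
    refine (Finset.sum_subset (fun k hk => ?_) (fun k hk hk' => ?_)).symm
    · simp at hk ⊢; omega
    · have : k = 0 := by simp at hk hk'; omega
      subst this; simp
  rw [h1, psiClass, Nat.floor_natCast, ← Finset.sum_sub_distrib,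
    Chebyshev.psi_sub_theta_eq_sum_not_prime, Nat.floor_natCast, Finset.sum_filter]
  refine (Finset.abs_sum_le_sum_abs _ _).trans (Finset.sum_le_sum fun k _ => ?_)
  have hv : 0 ≤ ArithmeticFunction.vonMangoldt k := vonMangoldt_nonneg
  have hmod : ((k : ZMod q) = b) ↔ k ≡ b [MOD q] := ZMod.natCast_eq_natCast_iff _ _ _
  by_cases hp : k.Prime
  · by_cases hm : k ≡ b [MOD q]
    · simp [residueClass, hmod, hp, hm, vonMangoldt_apply_prime hp]
    · simp [residueClass, hmod, hp, hm]
  · by_cases hm : k ≡ b [MOD q]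
    · simp [residueClass, hmod, hp, hm, abs_of_nonneg hv]
    · simp [residueClass, hmod, hp, hm, hv]

theorem thetaClass_asymp {q : ℕ} (hq : 0 < q) {b : ℕ} (hb : b.Coprime q) {e : ℝ} (he : 0 < e) :
    ∃ C : ℝ, ∀ y : ℕ, |thetaClass q b y - y / q.totient| ≤ e * y + C := by
  have : NeZero q := ⟨hq.ne'⟩
  have ha : IsUnit (b : ZMod q) := (ZMod.isUnit_iff_coprime b q).mpr hb
  have h1 := (tendsto_psiClass_div ha).comp tendsto_natCast_atTop_atTop
  have h2 : Tendsto (fun n : ℕ => 2 * √(n : ℝ) * Real.log n / n) atTop (𝓝 0) := by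
    have h3 := (isLittleO_log_rpow_atTop (show (0 : ℝ) < 1 / 2 by norm_num)).tendsto_div_nhds_zero
    have h4 := (h3.comp tendsto_natCast_atTop_atTop).const_mul 2
    rw [mul_zero] at h4
    refine h4.congr' ?_
    filter_upwards [eventually_gt_atTop 0] with n hn
    have hn' : (0 : ℝ) < n := by exact_mod_cast hn
    simp only [Function.comp_apply]
    rw [← Real.sqrt_eq_rpow]
    have h5 : √(n : ℝ) * √n = n := Real.mul_self_sqrt hn'.le
    have h6 : √(n : ℝ) ≠ 0 := by positivity
    field_simp
    rw [sq, h5]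
  have e1 := (Metric.tendsto_nhds.mp h1) (e / 2) (by positivity)
  have e2 := (Metric.tendsto_nhds.mp h2) (e / 2) (by positivity)
  obtain ⟨n0, hn0⟩ := eventually_atTop.mp ((e1.and e2).and (eventually_ge_atTop 1))
  have hφ : (1 : ℝ) ≤ q.totient := by exact_mod_cast Nat.totient_pos.mpr hq
  have hbig : ∀ n ≥ n0,
      |thetaClass q b (n + 1) - (n + 1 : ℕ) / q.totient| ≤ e * (n + 1 : ℕ) + 1 := by
    intro n hn
    obtain ⟨⟨h3, h4⟩, h5⟩ := hn0 n hn
    have hn' : (0 : ℝ) < n := by exact_mod_cast h5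
    simp only [Function.comp_apply, Real.dist_eq, sub_zero] at h3 h4
    have h6 := abs_psiClass_sub_thetaClass_le (q := q) b n h5
    have h7 : 2 * √n * Real.log n ≤ e / 2 * n := by
      have := (le_abs_self _).trans h4.le
      rwa [div_le_iff₀ hn'] at this
    have h8 : |psiClass (b : ZMod q) n - n / q.totient| ≤ e / 2 * n := by
      have h9 : psiClass (b : ZMod q) n - n / q.totient =
          (psiClass (b : ZMod q) n / n - (q.totient : ℝ)⁻¹) * n := by
        field_simp
      rw [h9, abs_mul, abs_of_pos hn']
      gcongr
    have h10 : (1 : ℝ) / q.totient ≤ 1 := by rw [div_le_one (by linarith)]; exact hφ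
    have h11 : 0 ≤ (1 : ℝ) / q.totient := by positivity
    rw [abs_le] at h6 h8 ⊢
    push_cast
    rw [add_div]
    constructor <;> linarith
  refine ⟨1 + ∑ y ∈ Finset.range (n0 + 1), |thetaClass q b y - y / q.totient|, fun y => ?_⟩
  have hsn : 0 ≤ ∑ y ∈ Finset.range (n0 + 1), |thetaClass q b y - y / q.totient| :=
    Finset.sum_nonneg fun _ _ => abs_nonneg _
  rcases le_or_gt y n0 with hy | hy
  · have := Finset.single_le_sum (f := fun y : ℕ => |thetaClass q b y - y / q.totient|)
      (fun _ _ => abs_nonneg _) (Finset.mem_range.mpr (Nat.lt_succ_of_le hy))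
    have : 0 ≤ e * y := by positivity
    linarith
  · obtain ⟨n, rfl⟩ : ∃ n, y = n + 1 := ⟨y - 1, by omega⟩
    linarith [hbig n (by omega)]

end

section
open Finset

/-- The normalised weight of the primes `W m + b` exceeding `R`. -/
noncomputable def primeWeight (W b R m : ℕ) : ℝ :=
  if (W * m + b).Prime ∧ R < W * m + b then (W.totient : ℝ) / W * Real.log (W * m + b : ℕ) else 0

lemma primeWeight_nonneg (W b R m : ℕ) : 0 ≤ primeWeight W b R m := by
  unfold primeWeight; split_ifs
  · have := Real.log_natCast_nonneg (W * m + b); positivity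
  · exact le_rfl

lemma prime_of_primeWeight_ne_zero {W b R m : ℕ} (h : primeWeight W b R m ≠ 0) :
    (W * m + b).Prime := by
  unfold primeWeight at h
  by_contra hp
  simp [hp] at h

lemma sum_primeWeight_eq {W b : ℕ} (hW : 0 < W) (hbW : b < W) (R x : ℕ) :
    ∑ m ∈ range x, primeWeight W b R m = (W.totient : ℝ) / W *
      ∑ k ∈ range (W * x), if (k.Prime ∧ k ≡ b [MOD W]) ∧ R < k then Real.log k else 0 := by
  rw [mul_sum]
  refine sum_of_injOn (fun m => W * m + b) ?_ ?_ ?_ ?_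
  · intro m _ m' _ h
    simpa [hW.ne'] using h
  · intro m hm
    simp only [coe_range, Set.mem_Iio] at hm ⊢
    calc W * m + b < W * m + W := by omega
      _ = W * (m + 1) := by ring
      _ ≤ W * x := Nat.mul_le_mul_left _ hm
  · intro k hk hk'
    rw [if_neg, mul_zero]
    rintro ⟨⟨-, hm⟩, -⟩
    refine hk' ⟨k / W, ?_, ?_⟩
    · simp only [coe_range, Set.mem_Iio, mem_range] at hk ⊢
      exact Nat.div_lt_of_lt_mul hk
    · have h1 := Nat.div_add_mod k W
      have h2 : k % W = b := by rw [hm, Nat.mod_eq_of_lt hbW]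
      simp only; omega
  · intro m _
    have : (W * m + b) ≡ b [MOD W] := by simp [Nat.ModEq]
    simp only [primeWeight, this, and_true]
    split_ifs <;> simp

lemma abs_sum_primeWeight_sub_le {W b : ℕ} (hW : 0 < W) (hbW : b < W) (R x : ℕ) :
    |∑ m ∈ range x, primeWeight W b R m - x| ≤
      |thetaClass W b (W * x) - (W * x : ℕ) / W.totient| + Real.log 4 * R := by
  have hφ : (0 : ℝ) < W.totient := by exact_mod_cast Nat.totient_pos.mpr hW
  have hW' : (0 : ℝ) < W := by exact_mod_cast hW
  rw [sum_primeWeight_eq hW hbW]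
  set A := ∑ k ∈ range (W * x), if (k.Prime ∧ k ≡ b [MOD W]) ∧ R < k then Real.log k else 0
  have h1 : A ≤ thetaClass W b (W * x) := by
    refine sum_le_sum fun k _ => ?_
    have := Real.log_natCast_nonneg k
    split_ifs <;> first | exact le_rfl | assumption | tauto
  have h2 : thetaClass W b (W * x) - A ≤ Real.log 4 * R := by
    refine le_trans ?_ (Chebyshev.theta_le_log4_mul_x (Nat.cast_nonneg R))
    rw [thetaClass, ← sum_sub_distrib, Chebyshev.theta_eq_sum_Icc, Nat.floor_natCast, sum_filter]
    rw [← sum_filter_add_sum_filter_not (range (W * x)) (fun k => k ≤ R)]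
    have h3 : ∑ k ∈ range (W * x) with ¬ k ≤ R,
        ((if k.Prime ∧ k ≡ b [MOD W] then Real.log k else 0) -
        (if (k.Prime ∧ k ≡ b [MOD W]) ∧ R < k then Real.log k else 0)) = 0 := by
      refine sum_eq_zero fun k hk => ?_
      have : R < k := by simpa using (mem_filter.mp hk).2
      simp [this]
    rw [h3, add_zero]
    refine (sum_le_sum fun k _ => ?_).trans (sum_le_sum_of_subset_of_nonneg
      (f := fun k : ℕ => if k.Prime then Real.log k else 0) (fun k hk => ?_) fun k _ _ => ?_)
    · have := Real.log_natCast_nonneg k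
      split_ifs <;> simp_all
    · simp at hk ⊢; omega
    · have := Real.log_natCast_nonneg k
      split_ifs <;> simp_all
  have h4 : (W.totient : ℝ) / W * A - x = (W.totient : ℝ) / W * (A - (W * x : ℕ) / W.totient) := by
    push_cast; field_simp
  have h5 : (W.totient : ℝ) / W ≤ 1 := by
    rw [div_le_one hW']; exact_mod_cast Nat.totient_le W
  rw [h4, abs_mul, abs_of_pos (by positivity)]
  refine (mul_le_of_le_one_left (abs_nonneg _) h5).trans ?_
  have h6 : A - (W * x : ℕ) / W.totient =
      (thetaClass W b (W * x) - (W * x : ℕ) / W.totient) - (thetaClass W b (W * x) - A) := by ring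
  rw [h6]
  refine (abs_sub _ _).trans ?_
  rw [abs_of_nonneg (sub_nonneg.mpr h1)]
  gcongr

theorem abs_sum_primeWeight_sub_le_eps {W b : ℕ} (hW : 0 < W) (hbW : b < W) (hb : b.Coprime W)
    {e : ℝ} (he : 0 < e) :
    ∃ N₀ : ℕ, ∀ N ≥ N₀, ∀ R : ℕ, R ^ 2 ≤ N → ∀ x ≤ N,
      |∑ m ∈ range x, primeWeight W b R m - x| ≤ e * N := by
  have hW' : (0 : ℝ) < W := by exact_mod_cast hW
  obtain ⟨C, hC⟩ := thetaClass_asymp hW hb (e := e / (4 * W)) (by positivity)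
  have hCn : 0 ≤ C := by simpa [thetaClass] using hC 0
  refine ⟨⌈max (4 * C / e) ((16 / e) ^ 2)⌉₊, fun N hN R hR x hx => ?_⟩
  have hN' := Nat.ceil_le.mp hN
  have h1 : 4 * C / e ≤ N := (le_max_left _ _).trans hN'
  have h2 : (16 / e) ^ 2 ≤ N := (le_max_right _ _).trans hN'
  rw [div_le_iff₀ he] at h1
  have h3 : (16 / e) * R ≤ N := by
    have hR' : (R : ℝ) ^ 2 ≤ N := by exact_mod_cast hR
    have : ((16 / e) * R) ^ 2 ≤ (N : ℝ) ^ 2 := by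
      rw [mul_pow, sq (N : ℝ)]; gcongr
    exact (pow_le_pow_iff_left₀ (by positivity) (by positivity) two_ne_zero).mp this
  rw [div_mul_eq_mul_div, div_le_iff₀ he] at h3
  have h4 := hC (W * x)
  have h5 := abs_sum_primeWeight_sub_le hW hbW R x
  have h6 : e / (4 * W) * (W * x : ℕ) = e / 4 * x := by push_cast; field_simp
  have h7 : (x : ℝ) ≤ N := by exact_mod_cast hx
  have h8 : Real.log 4 ≤ 2 := by
    have := Real.log_two_lt_d9
    rw [show (4 : ℝ) = 2 ^ 2 by norm_num, Real.log_pow]; push_cast; linarith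
  have h9 : Real.log 4 * R ≤ 2 * R := by gcongr
  have h10 : e / 4 * x ≤ e / 4 * N := by gcongr
  rw [h6] at h4
  linarith

lemma primeWeight_two_mul {W b : ℕ} (hW : 0 < W) (hWe : Even W) (R j : ℕ) :
    primeWeight W b R (2 * j) = primeWeight (2 * W) b R j := by
  have h1 : (2 * W).totient = 2 * W.totient := Nat.totient_two_mul_of_even hWe
  have h2 : W * (2 * j) + b = 2 * W * j + b := by ring
  have hW' : (W : ℝ) ≠ 0 := by exact_mod_cast hW.ne'
  rw [primeWeight, primeWeight, h1, h2]
  congr 2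
  push_cast; field_simp

lemma primeWeight_two_mul_add_one {W b : ℕ} (hW : 0 < W) (hWe : Even W) (R j : ℕ) :
    primeWeight W b R (2 * j + 1) = primeWeight (2 * W) (W + b) R j := by
  have h1 : (2 * W).totient = 2 * W.totient := Nat.totient_two_mul_of_even hWe
  have h2 : W * (2 * j + 1) + b = 2 * W * j + (W + b) := by ring
  have hW' : (W : ℝ) ≠ 0 := by exact_mod_cast hW.ne'
  rw [primeWeight, primeWeight, h1, h2]
  congr 2
  push_cast; field_simp

lemma sum_range_mul_neg_one_pow (f : ℕ → ℝ) (x : ℕ) :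
    ∑ m ∈ range x, f m * (-1) ^ m =
      ∑ j ∈ range ((x + 1) / 2), f (2 * j) - ∑ j ∈ range (x / 2), f (2 * j + 1) := by
  induction x with
  | zero => simp
  | succ n ih =>
    rw [sum_range_succ, ih]
    rcases Nat.even_or_odd' n with ⟨c, rfl | rfl⟩
    · rw [show (2 * c + 1 + 1) / 2 = c + 1 by omega, show (2 * c + 1) / 2 = c by omega,
        show 2 * c / 2 = c by omega, sum_range_succ]
      simp; ring
    · rw [show (2 * c + 1 + 1 + 1) / 2 = c + 1 by omega, show (2 * c + 1) / 2 = c by omega,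
        show (2 * c + 1 + 1) / 2 = c + 1 by omega, sum_range_succ (fun j => f (2 * j + 1))]
      simp [pow_succ]; ring

theorem abs_sum_primeWeight_mul_neg_one_pow_le {W b : ℕ} (hW : 0 < W) (hWe : Even W) (hbW : b < W)
    (hb : b.Coprime W) {e : ℝ} (he : 0 < e) :
    ∃ N₀ : ℕ, ∀ N ≥ N₀, ∀ R : ℕ, R ^ 2 ≤ N → ∀ x ≤ N,
      |∑ m ∈ range x, primeWeight W b R m * (-1) ^ m| ≤ e * N := by
  have hbo : Odd b := by
    rw [← Nat.not_even_iff_odd]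
    intro h
    have := Nat.dvd_gcd h.two_dvd hWe.two_dvd
    rw [hb] at this; omega
  have hWbo : Odd (W + b) := hWe.add_odd hbo
  have c1 : b.Coprime (2 * W) := Nat.Coprime.mul_right (Nat.coprime_two_right.mpr hbo) hb
  have c2 : (W + b).Coprime (2 * W) :=
    Nat.Coprime.mul_right (Nat.coprime_two_right.mpr hWbo) (by simpa using hb)
  obtain ⟨N1, h1⟩ := abs_sum_primeWeight_sub_le_eps (by omega) (by omega : b < 2 * W) c1
    (e := e / 4) (by positivity)
  obtain ⟨N2, h2⟩ := abs_sum_primeWeight_sub_le_eps (by omega) (by omega : W + b < 2 * W) c2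
    (e := e / 4) (by positivity)
  refine ⟨max (max N1 N2) ⌈2 / e⌉₊, fun N hN R hR x hx => ?_⟩
  have hN1 : N1 ≤ N := (le_max_left _ _).trans ((le_max_left _ _).trans hN)
  have hN2 : N2 ≤ N := (le_max_right _ _).trans ((le_max_left _ _).trans hN)
  have hN3 : 2 / e ≤ N := Nat.ceil_le.mp ((le_max_right _ _).trans hN)
  rw [div_le_iff₀ he] at hN3
  rw [sum_range_mul_neg_one_pow]
  simp only [primeWeight_two_mul hW hWe, primeWeight_two_mul_add_one hW hWe]
  rcases Nat.eq_zero_or_pos x with rfl | hx0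
  · simp; positivity
  have h3 := h1 N hN1 R hR ((x + 1) / 2) (by omega)
  have h4 := h2 N hN2 R hR (x / 2) (by omega)
  have h5 : ((x / 2 : ℕ) : ℝ) ≤ ((x + 1) / 2 : ℕ) := by exact_mod_cast by omega
  have h6 : (((x + 1) / 2 : ℕ) : ℝ) ≤ (x / 2 : ℕ) + 1 := by exact_mod_cast by omega
  rw [abs_le] at h3 h4 ⊢
  constructor <;> linarith

open ArithmeticFunction in
/-- The sieve weights attached to the diagonal variables `y`. -/
noncomputable def sieveWeight (R : ℕ) (y : ℕ → ℝ) (d : ℕ) : ℝ :=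
  d * (moebius d : ℝ) * ∑ r ∈ Icc 1 R, if d ∣ r then y r else 0

/-- The divisor sum of the sieve weights attached to `y`. -/
noncomputable def sieveSum (R : ℕ) (y : ℕ → ℝ) (n : ℕ) : ℝ :=
  ∑ d ∈ Icc 1 R, if d ∣ n then sieveWeight R y d else 0

/-- The frequency `1 / q` mean value of the product of two sieve sums. -/
noncomputable def sieveForm (R q : ℕ) (y y' : ℕ → ℝ) : ℝ :=
  ∑ d₁ ∈ Icc 1 R, ∑ d₂ ∈ Icc 1 R, if q ∣ Nat.lcm d₁ d₂ then
    sieveWeight R y d₁ * sieveWeight R y' d₂ / (Nat.lcm d₁ d₂ : ℕ) else 0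

open ArithmeticFunction in
lemma sum_moebius_between {r e : ℕ} (hr : Squarefree r) :
    ∑ d ∈ r.divisors with e ∣ d, moebius d = if r = e then moebius e else 0 := by
  have hr0 := hr.ne_zero
  by_cases her : e ∣ r
  · obtain ⟨k, rfl⟩ := her
    have he0 : e ≠ 0 := left_ne_zero_of_mul hr0
    have hk0 : k ≠ 0 := right_ne_zero_of_mul hr0
    have hcop : e.Coprime k := Nat.coprime_of_squarefree_mul hr
    have h1 : ((e * k).divisors.filter (e ∣ ·)) = k.divisors.image (e * ·) := by
      ext d
      simp only [mem_filter, Nat.mem_divisors, mem_image]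
      constructor
      · rintro ⟨⟨h, -⟩, c, rfl⟩
        exact ⟨c, ⟨Nat.dvd_of_mul_dvd_mul_left (Nat.pos_of_ne_zero he0) h, hk0⟩, rfl⟩
      · rintro ⟨c, ⟨hc, -⟩, rfl⟩
        exact ⟨⟨Nat.mul_dvd_mul_left e hc, hr0⟩, dvd_mul_right _ _⟩
    rw [h1, sum_image (fun a _ b _ h => Nat.eq_of_mul_eq_mul_left (Nat.pos_of_ne_zero he0) h)]
    have h2 : ∀ c ∈ k.divisors, moebius (e * c) = moebius e * moebius c := fun c hc =>
      isMultiplicative_moebius.map_mul_of_coprime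
        (hcop.coprime_dvd_right (Nat.dvd_of_mem_divisors hc))
    rw [sum_congr rfl h2, ← mul_sum, ← coe_mul_zeta_apply, moebius_mul_coe_zeta, one_apply]
    by_cases hk : k = 1
    · simp [hk]
    · have : ¬ (e * k = e) := by
        intro h; exact hk (by simpa [he0] using h)
      simp [hk, this]
  · rw [if_neg (fun h : r = e => her (h ▸ dvd_rfl))]
    refine sum_eq_zero fun d hd => ?_
    simp only [mem_filter, Nat.mem_divisors] at hd
    exact absurd (hd.2.trans hd.1.1) her

open ArithmeticFunction in
lemma sum_sieveWeight_div {R e : ℕ} {y : ℕ → ℝ} (hy : ∀ r, ¬ Squarefree r → y r = 0)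
    (he : e ∈ Icc 1 R) :
    ∑ d ∈ Icc 1 R, (if e ∣ d then sieveWeight R y d / d else 0) = moebius e * y e := by
  have h1 : ∀ d ∈ Icc 1 R, (if e ∣ d then sieveWeight R y d / d else 0) =
      ∑ r ∈ Icc 1 R, if d ∣ r ∧ e ∣ d then (moebius d : ℝ) * y r else 0 := by
    intro d hd
    have hd0 : (d : ℝ) ≠ 0 := by
      have := (mem_Icc.mp hd).1
      positivity
    by_cases hed : e ∣ d
    · simp only [hed, and_true, if_true, sieveWeight]
      rw [mul_assoc, mul_div_cancel_left₀ _ hd0, mul_sum]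
      refine sum_congr rfl fun r _ => ?_
      split_ifs <;> simp
    · simp [hed]
  rw [sum_congr rfl h1, sum_comm]
  have h2 : ∀ r ∈ Icc 1 R, ∑ d ∈ Icc 1 R, (if d ∣ r ∧ e ∣ d then (moebius d : ℝ) * y r else 0) =
      if r = e then moebius e * y e else 0 := by
    intro r hr
    by_cases hsq : Squarefree r
    · have h3 : ∑ d ∈ Icc 1 R, (if d ∣ r ∧ e ∣ d then (moebius d : ℝ) * y r else 0) =
          ((∑ d ∈ r.divisors with e ∣ d, moebius d : ℤ) : ℝ) * y r := by
        rw [Int.cast_sum, sum_mul, ← sum_filter]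
        refine sum_congr ?_ fun _ _ => rfl
        ext d
        simp only [mem_filter, mem_Icc, Nat.mem_divisors] at hr ⊢
        constructor
        · rintro ⟨-, h, h'⟩
          exact ⟨⟨h, by omega⟩, h'⟩
        · rintro ⟨⟨h, h0⟩, h'⟩
          exact ⟨⟨Nat.pos_of_dvd_of_pos h (by omega),
            (Nat.le_of_dvd (by omega) h).trans hr.2⟩, h, h'⟩
      rw [h3, sum_moebius_between hsq]
      split_ifs with h
      · rw [h]
      · simp
    · rw [hy r hsq]
      have : r = e → y e = 0 := fun h => h ▸ hy r hsq
      split_ifs with h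
      · simp [this h]
      · simp
  rw [sum_congr rfl h2, sum_ite_eq_of_mem' _ _ _ he]

open ArithmeticFunction in
/-- Diagonalisation of the Selberg quadratic form. -/
lemma sieveForm_one {R : ℕ} {y y' : ℕ → ℝ} (hy : ∀ r, ¬ Squarefree r → y r = 0)
    (hy' : ∀ r, ¬ Squarefree r → y' r = 0) :
    sieveForm R 1 y y' = ∑ r ∈ Icc 1 R, (r.totient : ℝ) * (y r * y' r) := by
  have h1 : ∀ d₁ ∈ Icc 1 R, ∀ d₂ ∈ Icc 1 R,
      sieveWeight R y d₁ * sieveWeight R y' d₂ / (Nat.lcm d₁ d₂ : ℕ) =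
      ∑ e ∈ Icc 1 R, (e.totient : ℝ) * ((if e ∣ d₁ then sieveWeight R y d₁ / d₁ else 0) *
        (if e ∣ d₂ then sieveWeight R y' d₂ / d₂ else 0)) := by
    intro d₁ h₁ d₂ h₂
    rw [mem_Icc] at h₁ h₂
    have hg : ((Nat.gcd d₁ d₂ : ℕ) : ℝ) = ∑ e ∈ Icc 1 R,
        if e ∣ d₁ ∧ e ∣ d₂ then (e.totient : ℝ) else 0 := by
      rw [← Nat.sum_totient (Nat.gcd d₁ d₂), Nat.cast_sum, ← sum_filter]
      refine sum_congr ?_ fun _ _ => rfl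
      ext e
      simp only [mem_filter, mem_Icc, Nat.mem_divisors, Nat.dvd_gcd_iff]
      constructor
      · rintro ⟨⟨h, h'⟩, -⟩
        exact ⟨⟨Nat.pos_of_dvd_of_pos h (by omega), (Nat.le_of_dvd (by omega) h).trans h₁.2⟩, h, h'⟩
      · rintro ⟨-, h⟩
        exact ⟨h, by have := Nat.gcd_pos_of_pos_left d₂ (show 0 < d₁ by omega); omega⟩
    have hgl : ((Nat.gcd d₁ d₂ : ℕ) : ℝ) * (Nat.lcm d₁ d₂ : ℕ) = d₁ * d₂ := by
      exact_mod_cast Nat.gcd_mul_lcm d₁ d₂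
    have hd1 : (0 : ℝ) < d₁ := by exact_mod_cast h₁.1
    have hd2 : (0 : ℝ) < d₂ := by exact_mod_cast h₂.1
    have hl : (0 : ℝ) < (Nat.lcm d₁ d₂ : ℕ) := by
      exact_mod_cast Nat.lcm_pos h₁.1 h₂.1
    have h3 : sieveWeight R y d₁ * sieveWeight R y' d₂ / (Nat.lcm d₁ d₂ : ℕ) =
        ((Nat.gcd d₁ d₂ : ℕ) : ℝ) * (sieveWeight R y d₁ / d₁ * (sieveWeight R y' d₂ / d₂)) := by
      field_simp
      linear_combination -(sieveWeight R y d₁ * sieveWeight R y' d₂) * hgl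
    rw [h3, hg, sum_mul]
    refine sum_congr rfl fun e _ => ?_
    by_cases a1 : e ∣ d₁ <;> by_cases a2 : e ∣ d₂ <;> simp [a1, a2]
  have h2 : sieveForm R 1 y y' = ∑ d₁ ∈ Icc 1 R, ∑ d₂ ∈ Icc 1 R, ∑ e ∈ Icc 1 R,
      (e.totient : ℝ) * ((if e ∣ d₁ then sieveWeight R y d₁ / d₁ else 0) *
        (if e ∣ d₂ then sieveWeight R y' d₂ / d₂ else 0)) := by
    rw [sieveForm]
    refine sum_congr rfl fun d₁ h₁ => sum_congr rfl fun d₂ h₂ => ?_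
    rw [if_pos (one_dvd _), h1 d₁ h₁ d₂ h₂]
  rw [h2]
  calc _ = ∑ d₁ ∈ Icc 1 R, ∑ e ∈ Icc 1 R, ∑ d₂ ∈ Icc 1 R,
        (e.totient : ℝ) * ((if e ∣ d₁ then sieveWeight R y d₁ / d₁ else 0) *
        (if e ∣ d₂ then sieveWeight R y' d₂ / d₂ else 0)) :=
        sum_congr rfl fun _ _ => sum_comm
    _ = ∑ e ∈ Icc 1 R, ∑ d₁ ∈ Icc 1 R, ∑ d₂ ∈ Icc 1 R,
        (e.totient : ℝ) * ((if e ∣ d₁ then sieveWeight R y d₁ / d₁ else 0) *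
        (if e ∣ d₂ then sieveWeight R y' d₂ / d₂ else 0)) := sum_comm
    _ = _ := by
      refine sum_congr rfl fun e he => ?_
      simp_rw [← mul_sum, ← sum_mul]
      rw [sum_sieveWeight_div hy he, sum_sieveWeight_div hy' he]
      by_cases hsq : Squarefree e
      · have : (moebius e : ℝ) * moebius e = 1 := by
          have := moebius_sq_eq_one_of_squarefree hsq
          rw [sq] at this
          exact_mod_cast this
        linear_combination (e.totient : ℝ) * y e * y' e * this
      · simp [hy e hsq]

/-- `exp (2 π i x)`. -/
noncomputable def e (x : ℝ) : ℂ := Complex.exp (2 * Real.pi * x * Complex.I)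

lemma e_add (x y : ℝ) : e (x + y) = e x * e y := by
  rw [e, e, e, ← Complex.exp_add]; push_cast; ring_nf

lemma e_zero : e 0 = 1 := by simp [e]

lemma e_natCast (n : ℕ) : e n = 1 := by
  rw [e, Complex.exp_eq_one_iff]
  exact ⟨n, by push_cast; ring⟩

lemma e_nat_mul (n : ℕ) (x : ℝ) : e (n * x) = e x ^ n := by
  rw [e, e, ← Complex.exp_nat_mul]; push_cast; ring_nf

lemma norm_e (x : ℝ) : ‖e x‖ = 1 := by
  rw [e, show (2 * Real.pi * x * Complex.I : ℂ) = ((2 * Real.pi * x : ℝ) : ℂ) * Complex.I by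
    push_cast; ring]
  exact Complex.norm_exp_ofReal_mul_I _

lemma e_div_eq_one_iff {m q : ℕ} (hq : 0 < q) : e ((m : ℝ) / q) = 1 ↔ q ∣ m := by
  have hq' : (q : ℂ) ≠ 0 := by exact_mod_cast hq.ne'
  rw [e, Complex.exp_eq_one_iff]
  constructor
  · rintro ⟨n, hn⟩
    have h1 : (m : ℂ) = n * q := by
      have : (2 * Real.pi * Complex.I : ℂ) ≠ 0 := Complex.two_pi_I_ne_zero
      push_cast at hn
      field_simp at hn
      rw [hn, mul_comm]
    have h2 : (m : ℤ) = n * q := by exact_mod_cast h1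
    exact Int.natCast_dvd_natCast.mp ⟨n, by rw [h2]; ring⟩
  · rintro ⟨c, rfl⟩
    refine ⟨c, ?_⟩
    push_cast
    field_simp

lemma sum_e_dvd {q D L : ℕ} (hq : 0 < q) (hD : 0 < D) (hqL : q ∣ L) (hDL : D ∣ L) :
    ∑ n ∈ range L, (if D ∣ n then e ((n : ℝ) / q) else 0) =
      if q ∣ D then (L : ℂ) / D else 0 := by
  obtain ⟨K, rfl⟩ := hDL
  have h1 : ∑ n ∈ range (D * K), (if D ∣ n then e ((n : ℝ) / q) else 0) =
      ∑ j ∈ range K, e ((D : ℝ) / q) ^ j := by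
    symm
    refine sum_of_injOn (fun j => D * j) (fun a _ b _ h => Nat.eq_of_mul_eq_mul_left hD h) ?_ ?_ ?_
    · intro j hj
      simp only [coe_range, Set.mem_Iio] at hj ⊢
      exact Nat.mul_lt_mul_of_pos_left hj hD
    · intro n hn hn'
      rw [if_neg]
      rintro ⟨j, rfl⟩
      refine hn' ⟨j, ?_, rfl⟩
      simp only [coe_range, Set.mem_Iio, mem_range] at hn ⊢
      exact Nat.lt_of_mul_lt_mul_left hn
    · intro j _
      rw [if_pos (dvd_mul_right D j), ← e_nat_mul]
      congr 1; push_cast; ring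
  rw [h1]
  have hD' : (D : ℂ) ≠ 0 := by exact_mod_cast hD.ne'
  split_ifs with h
  · rw [(e_div_eq_one_iff hq).mpr h]
    simp [hD']
  · have hne : e ((D : ℝ) / q) ≠ 1 := fun h' => h ((e_div_eq_one_iff hq).mp h')
    rw [geom_sum_eq hne, ← e_nat_mul]
    have : (K : ℝ) * ((D : ℝ) / q) = ((D * K : ℕ) : ℝ) / q := by push_cast; ring
    rw [this, (e_div_eq_one_iff hq).mpr hqL]
    simp

lemma sum_sieveSum_mul_sieveSum {R q : ℕ} (hq : 0 < q) (y y' : ℕ → ℝ) :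
    ∑ n ∈ range (q * R.factorial), (sieveSum R y n * sieveSum R y' n : ℝ) * e ((n : ℝ) / q) =
      (q * R.factorial : ℕ) * (sieveForm R q y y' : ℂ) := by
  set L := q * R.factorial with hL
  have h1 : ∀ n, ((sieveSum R y n * sieveSum R y' n : ℝ) : ℂ) * e ((n : ℝ) / q) =
      ∑ d₁ ∈ Icc 1 R, ∑ d₂ ∈ Icc 1 R, (sieveWeight R y d₁ * sieveWeight R y' d₂ : ℝ) *
        (if Nat.lcm d₁ d₂ ∣ n then e ((n : ℝ) / q) else 0) := by
    intro n
    rw [sieveSum, sieveSum, sum_mul_sum]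
    push_cast
    simp_rw [sum_mul]
    refine sum_congr rfl fun d₁ _ => sum_congr rfl fun d₂ _ => ?_
    simp only [Nat.lcm_dvd_iff]
    by_cases a1 : d₁ ∣ n <;> by_cases a2 : d₂ ∣ n <;> simp [a1, a2]
  simp_rw [h1]
  rw [sum_comm, sieveForm]
  push_cast
  rw [mul_sum]
  refine sum_congr rfl fun d₁ h₁ => ?_
  rw [sum_comm, mul_sum]
  refine sum_congr rfl fun d₂ h₂ => ?_
  rw [mem_Icc] at h₁ h₂
  have hdvd : Nat.lcm d₁ d₂ ∣ L := Nat.lcm_dvd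
    ((Nat.dvd_factorial h₁.1 h₁.2).mul_left q) ((Nat.dvd_factorial h₂.1 h₂.2).mul_left q)
  rw [← mul_sum, sum_e_dvd hq (Nat.lcm_pos h₁.1 h₂.1) (dvd_mul_right _ _) hdvd]
  split_ifs
  · push_cast [hL]; ring
  · simp

lemma abs_sieveForm_le {R q : ℕ} (hq : 0 < q) (y y' : ℕ → ℝ) :
    sieveForm R q y y' ^ 2 ≤ sieveForm R 1 y y * sieveForm R 1 y' y' := by
  set L := q * R.factorial with hL
  have hLp : (0 : ℝ) < L := by exact_mod_cast Nat.mul_pos hq R.factorial_pos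
  have hone : ∀ y : ℕ → ℝ, ∑ n ∈ range L, sieveSum R y n ^ 2 = L * sieveForm R 1 y y := by
    intro y
    have h : ∀ k : ℕ, ∑ n ∈ range (k * R.factorial), sieveSum R y n ^ 2 =
        k * (R.factorial * sieveForm R 1 y y) := by
      intro k
      have hper : ∀ n j, sieveSum R y (n + j * R.factorial) = sieveSum R y n := by
        intro n j
        refine sum_congr rfl fun d hd => ?_
        rw [mem_Icc] at hd
        have : d ∣ j * R.factorial := (Nat.dvd_factorial hd.1 hd.2).mul_left j
        simp only [Nat.dvd_add_left this]
      induction k with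
      | zero => simp
      | succ k ih =>
        rw [add_mul, one_mul, sum_range_add, ih]
        have h2 := sum_sieveSum_mul_sieveSum (R := R) one_pos y y
        have h3 : ∑ n ∈ range R.factorial, sieveSum R y n ^ 2 =
            R.factorial * sieveForm R 1 y y := by
          have : ∀ n : ℕ, e ((n : ℝ) / (1 : ℕ)) = 1 := fun n => by
            rw [Nat.cast_one, div_one, e_natCast]
          simp_rw [this] at h2
          simp only [one_mul, mul_one, ← sq] at h2
          exact_mod_cast h2
        have h4 : ∑ x ∈ range R.factorial, sieveSum R y (k * R.factorial + x) ^ 2 =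
            ∑ n ∈ range R.factorial, sieveSum R y n ^ 2 :=
          sum_congr rfl fun x _ => by rw [add_comm, hper]
        rw [h4, h3]; push_cast; ring
    rw [hL, h]; push_cast; ring
  have h1 : |(L : ℝ) * sieveForm R q y y'| ≤
      ∑ n ∈ range L, |sieveSum R y n| * |sieveSum R y' n| := by
    have h := sum_sieveSum_mul_sieveSum (R := R) hq y y'
    have h' : ‖((L : ℝ) : ℂ) * (sieveForm R q y y' : ℂ)‖ = |(L : ℝ) * sieveForm R q y y'| := by
      rw [← Complex.ofReal_mul, Complex.norm_real, Real.norm_eq_abs]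
    rw [← h', Complex.ofReal_natCast, ← h]
    refine (norm_sum_le _ _).trans (sum_le_sum fun n _ => ?_)
    rw [norm_mul, norm_e, mul_one, Complex.norm_real, norm_mul, Real.norm_eq_abs, Real.norm_eq_abs]
  have h2 := sum_mul_sq_le_sq_mul_sq (range L) (fun n => |sieveSum R y n|)
    (fun n => |sieveSum R y' n|)
  simp only [sq_abs, hone] at h2
  have h3 : (L : ℝ) ^ 2 * sieveForm R q y y' ^ 2 ≤
      (L : ℝ) ^ 2 * (sieveForm R 1 y y * sieveForm R 1 y' y') := by
    calc (L : ℝ) ^ 2 * sieveForm R q y y' ^ 2 = |(L : ℝ) * sieveForm R q y y'| ^ 2 := by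
          rw [sq_abs]; ring
      _ ≤ (∑ n ∈ range L, |sieveSum R y n| * |sieveSum R y' n|) ^ 2 := by gcongr
      _ ≤ _ := h2
      _ = _ := by ring
  exact le_of_mul_le_mul_left h3 (by positivity)

open Classical in
/-- Selberg's diagonal variables for sifting by the primes larger than `z`. -/
noncomputable def selY (z r : ℕ) : ℝ :=
  if Squarefree r ∧ ∀ p, p.Prime → p ∣ r → z < p then (r.totient : ℝ)⁻¹ else 0

/-- The normalisation of Selberg's sieve weights. -/
noncomputable def selG (z R : ℕ) : ℝ := ∑ r ∈ Icc 1 R, selY z r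

lemma selY_nonneg (z r : ℕ) : 0 ≤ selY z r := by
  unfold selY; split_ifs <;> positivity

lemma selY_of_not_squarefree {z r : ℕ} (h : ¬ Squarefree r) : selY z r = 0 := by
  simp [selY, h]

lemma totient_mul_selY_mul_selY (z r : ℕ) :
    (r.totient : ℝ) * (selY z r * selY z r) = selY z r := by
  unfold selY
  split_ifs with h
  · have : 0 < r.totient := Nat.totient_pos.mpr (Nat.pos_of_ne_zero h.1.ne_zero)
    field_simp
  · simp

lemma one_le_selG {z R : ℕ} (hR : 1 ≤ R) : 1 ≤ selG z R := by
  have h1 : selY z 1 = 1 := by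
    have : ∀ p, p.Prime → p ∣ 1 → z < p := fun p hp h => absurd h hp.not_dvd_one
    rw [selY, if_pos ⟨squarefree_one, this⟩]; simp
  calc 1 = selY z 1 := h1.symm
    _ ≤ _ := single_le_sum (f := selY z) (fun r _ => selY_nonneg z r) (by simp [hR])

lemma sieveWeight_one (R : ℕ) (y : ℕ → ℝ) : sieveWeight R y 1 = ∑ r ∈ Icc 1 R, y r := by
  simp [sieveWeight]

lemma sieveSum_of_prime {R p : ℕ} (y : ℕ → ℝ) (hR : 1 ≤ R) (hp : p.Prime) (hpR : R < p) :
    sieveSum R y p = ∑ r ∈ Icc 1 R, y r := by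
  rw [sieveSum, ← sieveWeight_one R y, sum_eq_single 1]
  · simp
  · intro d hd hd1
    rw [mem_Icc] at hd
    rw [if_neg]
    intro h
    rcases (Nat.dvd_prime hp).mp h with h | h <;> omega
  · intro h; simp [hR] at h

lemma sieveForm_comm (R q : ℕ) (y y' : ℕ → ℝ) : sieveForm R q y y' = sieveForm R q y' y := by
  rw [sieveForm, sum_comm]
  refine sum_congr rfl fun d₁ _ => sum_congr rfl fun d₂ _ => ?_
  rw [Nat.lcm_comm, mul_comm]

lemma sieveWeight_add (R : ℕ) (y y' : ℕ → ℝ) (d : ℕ) :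
    sieveWeight R (fun r => y r + y' r) d = sieveWeight R y d + sieveWeight R y' d := by
  rw [sieveWeight, sieveWeight, sieveWeight, ← mul_add, ← sum_add_distrib]
  congr 1
  refine sum_congr rfl fun r _ => ?_
  split_ifs <;> simp

lemma sieveForm_add_left (R q : ℕ) (y y' u : ℕ → ℝ) :
    sieveForm R q (fun r => y r + y' r) u = sieveForm R q y u + sieveForm R q y' u := by
  simp only [sieveForm, sieveWeight_add, ← sum_add_distrib]
  refine sum_congr rfl fun d₁ _ => sum_congr rfl fun d₂ _ => ?_
  split_ifs <;> ring

lemma sieveForm_add_right (R q : ℕ) (y y' u : ℕ → ℝ) :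
    sieveForm R q u (fun r => y r + y' r) = sieveForm R q u y + sieveForm R q u y' := by
  rw [sieveForm_comm, sieveForm_add_left, sieveForm_comm R q y, sieveForm_comm R q y']

lemma sum_multiples {p R : ℕ} (hp : 0 < p) (f : ℕ → ℝ) :
    ∑ r ∈ Icc 1 R, (if p ∣ r then f r else 0) =
      ∑ s ∈ Icc 1 R, if p * s ≤ R then f (p * s) else 0 := by
  rw [← sum_filter, ← sum_filter]
  symm
  refine sum_nbij (fun s => p * s) ?_ ?_ ?_ (fun _ _ => rfl)
  · intro s hs
    simp only [mem_filter, mem_Icc] at hs ⊢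
    exact ⟨⟨Nat.mul_pos hp hs.1.1, hs.2⟩, dvd_mul_right _ _⟩
  · intro a _ b _ h
    exact Nat.eq_of_mul_eq_mul_left hp h
  · intro r hr
    simp only [coe_filter, mem_Icc, Set.mem_ofPred_eq] at hr
    obtain ⟨⟨h1, h2⟩, s, rfl⟩ := hr
    refine ⟨s, ?_, rfl⟩
    simp only [coe_filter, mem_Icc, Set.mem_ofPred_eq]
    have h3 : 0 < s := Nat.pos_of_mul_pos_left h1
    exact ⟨⟨h3, (Nat.le_mul_of_pos_left s hp).trans h2⟩, h2⟩

lemma selY_prime_mul_of_dvd {z p s : ℕ} (hp : p.Prime) (h : p ∣ s) : selY z (p * s) = 0 := by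
  refine selY_of_not_squarefree fun hsq => ?_
  have := Nat.coprime_of_squarefree_mul hsq
  exact hp.one_lt.ne' (Nat.Coprime.eq_one_of_dvd this h)

lemma selY_prime_mul_le {z p s : ℕ} (hz : 0 < z) (hp : p.Prime) :
    selY z (p * s) ≤ selY z s / z := by
  by_cases h : Squarefree (p * s) ∧ ∀ p', p'.Prime → p' ∣ p * s → z < p'
  · have h1 : Squarefree s := h.1.squarefree_of_dvd (dvd_mul_left _ _)
    have h2 : ∀ p', p'.Prime → p' ∣ s → z < p' := fun p' hp' hd => h.2 p' hp' (hd.mul_left p)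
    have h3 : z < p := h.2 p hp (dvd_mul_right _ _)
    rw [selY, selY, if_pos h, if_pos ⟨h1, h2⟩,
      Nat.totient_mul (Nat.coprime_of_squarefree_mul h.1), Nat.totient_prime hp]
    have h4 : 0 < s.totient := Nat.totient_pos.mpr (Nat.pos_of_ne_zero h1.ne_zero)
    rw [div_eq_mul_inv, ← mul_inv]
    have h5 : (z : ℝ) ≤ (p - 1 : ℕ) := by exact_mod_cast Nat.le_sub_one_of_lt h3
    have h6 : (0 : ℝ) < z := by exact_mod_cast hz
    have h7 : (0 : ℝ) < s.totient := by exact_mod_cast h4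
    push_cast
    refine inv_anti₀ (by positivity) ?_
    rw [mul_comm]
    gcongr
  · rw [selY, if_neg h]
    have := selY_nonneg z s
    positivity

/-- The part of `y` supported on the multiples of `p`, rescaled by `p`. -/
def rescale (R p : ℕ) (y : ℕ → ℝ) (s : ℕ) : ℝ := if p * s ≤ R then y (p * s) else 0

open ArithmeticFunction in
lemma sieveWeight_prime_mul {R z p d : ℕ} (hp : p.Prime) :
    sieveWeight R (fun r => if p ∣ r then selY z r else 0) (p * d) =
      -(p * sieveWeight R (rescale R p (selY z)) d) := by
  have h1 : ∑ r ∈ Icc 1 R, (if p * d ∣ r then (if p ∣ r then selY z r else 0) else 0) =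
      ∑ s ∈ Icc 1 R, if d ∣ s then rescale R p (selY z) s else 0 := by
    have h2 : ∀ r, (if p * d ∣ r then (if p ∣ r then selY z r else 0) else 0) =
        if p ∣ r then (if p * d ∣ r then selY z r else 0) else 0 := fun r => by
      split_ifs <;> rfl
    simp_rw [h2]
    rw [sum_multiples hp.pos]
    refine sum_congr rfl fun s _ => ?_
    simp only [Nat.mul_dvd_mul_iff_left hp.pos, rescale]
    split_ifs <;> rfl
  rw [sieveWeight, sieveWeight, h1]
  by_cases hpd : p ∣ d
  · have h3 : ∑ s ∈ Icc 1 R, (if d ∣ s then rescale R p (selY z) s else 0) = 0 := by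
      refine sum_eq_zero fun s _ => ?_
      split_ifs with h
      · rw [rescale, selY_prime_mul_of_dvd hp (hpd.trans h), ite_self]
      · rfl
    rw [h3]; simp
  · have h4 : moebius (p * d) = - moebius d := by
      rw [isMultiplicative_moebius.map_mul_of_coprime ((Nat.Prime.coprime_iff_not_dvd hp).mpr hpd),
        moebius_apply_prime hp]; ring
    rw [h4]; push_cast; ring

lemma sieveWeight_eq_zero {R d : ℕ} {y : ℕ → ℝ} (h : ∀ r ∈ Icc 1 R, d ∣ r → y r = 0) :
    sieveWeight R y d = 0 := by
  rw [sieveWeight, sum_eq_zero, mul_zero]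
  intro r hr
  split_ifs with hd
  · exact h r hr hd
  · rfl

lemma sieveForm_cross {R z p q : ℕ} (hp : p.Prime) :
    sieveForm R (p * q) (fun r => if p ∣ r then 0 else selY z r)
      (fun r => if p ∣ r then selY z r else 0) =
    -sieveForm R q (fun r => if p ∣ r then 0 else selY z r) (rescale R p (selY z)) := by
  rw [sieveForm, sieveForm, ← sum_neg_distrib]
  refine sum_congr rfl fun d₁ hd₁ => ?_
  set y₀ : ℕ → ℝ := fun r => if p ∣ r then 0 else selY z r with hy₀
  set y₁ : ℕ → ℝ := fun r => if p ∣ r then selY z r else 0 with hy₁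
  by_cases hpd : p ∣ d₁
  · have : sieveWeight R y₀ d₁ = 0 :=
      sieveWeight_eq_zero fun r _ h => by simp [hy₀, hpd.trans h]
    simp [this]
  have hcop : p.Coprime d₁ := (Nat.Prime.coprime_iff_not_dvd hp).mpr hpd
  have hlcm : ∀ d, Nat.lcm d₁ (p * d) = p * Nat.lcm d₁ d := by
    intro d
    rw [Nat.lcm, Nat.lcm, Nat.Coprime.gcd_mul_left_cancel_right d hcop.symm.symm, mul_left_comm,
      Nat.mul_div_assoc _ ((Nat.gcd_dvd_left _ _).mul_right _)]
  have h1 : ∀ d₂ ∈ Icc 1 R, (if p * q ∣ Nat.lcm d₁ d₂ then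
      sieveWeight R y₀ d₁ * sieveWeight R y₁ d₂ / (Nat.lcm d₁ d₂ : ℕ) else 0) =
      if p ∣ d₂ then (if p * q ∣ Nat.lcm d₁ d₂ then
      sieveWeight R y₀ d₁ * sieveWeight R y₁ d₂ / (Nat.lcm d₁ d₂ : ℕ) else 0) else 0 := by
    intro d₂ _
    by_cases h : p ∣ d₂
    · rw [if_pos h]
    · rw [if_neg h, if_neg]
      intro h'
      have h2 : p ∣ d₁ * d₂ := ((dvd_mul_right p q).trans h').trans (Nat.lcm_dvd_mul d₁ d₂)
      rcases (Nat.Prime.dvd_mul hp).mp h2 with h2 | h2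
      exacts [hpd h2, h h2]
  rw [sum_congr rfl h1, sum_multiples hp.pos, ← sum_neg_distrib]
  refine sum_congr rfl fun d hd => ?_
  rw [mem_Icc] at hd hd₁
  have hl : ((Nat.lcm d₁ d : ℕ) : ℝ) ≠ 0 := by
    exact_mod_cast (Nat.lcm_pos hd₁.1 hd.1).ne'
  have hp0 : (p : ℝ) ≠ 0 := by exact_mod_cast hp.ne_zero
  have hiff : p * q ∣ p * Nat.lcm d₁ d ↔ q ∣ Nat.lcm d₁ d := Nat.mul_dvd_mul_iff_left hp.pos
  rw [hlcm, sieveWeight_prime_mul hp]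
  simp only [hiff]
  by_cases h : p * d ≤ R
  · rw [if_pos h]
    split_ifs
    · push_cast; field_simp
    · simp
  · have : sieveWeight R (rescale R p (selY z)) d = 0 := by
      refine sieveWeight_eq_zero fun r hr hdr => ?_
      rw [rescale, if_neg]
      intro h'
      rw [mem_Icc] at hr
      exact h ((Nat.mul_le_mul_left p (Nat.le_of_dvd hr.1 hdr)).trans h')
    rw [this, if_neg h]; simp

/-- The Fourier coefficients of Selberg's majorant at non-integral frequencies are small. -/
lemma abs_sieveForm_selY_le {R z q : ℕ} (hz : 0 < z) (hq : 1 < q) :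
    |sieveForm R q (selY z) (selY z)| ≤ 3 * selG z R / z := by
  obtain ⟨p, hp, q', rfl⟩ := Nat.exists_prime_and_dvd hq.ne'
  have hq' : 0 < q' := by
    rcases Nat.eq_zero_or_pos q' with h | h
    · simp [h] at hq
    · exact h
  set y₀ : ℕ → ℝ := fun r => if p ∣ r then 0 else selY z r with hy₀
  set y₁ : ℕ → ℝ := fun r => if p ∣ r then selY z r else 0 with hy₁
  set k := rescale R p (selY z) with hk
  have hz' : (0 : ℝ) < z := by exact_mod_cast hz
  have hG : 0 ≤ selG z R := sum_nonneg fun r _ => selY_nonneg z r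
  have hk0 : ∀ s, 0 ≤ k s := fun s => by
    rw [hk, rescale]; split_ifs
    · exact selY_nonneg _ _
    · exact le_rfl
  have hkY : ∀ s, k s ≤ selY z s / z := fun s => by
    rw [hk, rescale]; split_ifs
    · exact selY_prime_mul_le hz hp
    · have := selY_nonneg z s; positivity
  have hY : selY z = fun r => y₀ r + y₁ r := by
    ext r; simp only [hy₀, hy₁]; split_ifs <;> simp
  have sq0 : ∀ r, ¬ Squarefree r → y₀ r = 0 := fun r h => by
    simp [hy₀, selY_of_not_squarefree h]
  have sq1 : ∀ r, ¬ Squarefree r → y₁ r = 0 := fun r h => by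
    simp [hy₁, selY_of_not_squarefree h]
  have sqk : ∀ r, ¬ Squarefree r → k r = 0 := fun r h => by
    have : ¬ Squarefree (p * r) := fun h' => h (h'.squarefree_of_dvd (dvd_mul_left _ _))
    simp [hk, rescale, selY_of_not_squarefree this]
  have h00 : sieveForm R (p * q') y₀ y₀ = 0 := by
    refine sum_eq_zero fun d₁ _ => sum_eq_zero fun d₂ _ => ?_
    split_ifs with h
    · have h2 : p ∣ d₁ * d₂ := ((dvd_mul_right p q').trans h).trans (Nat.lcm_dvd_mul d₁ d₂)
      have h3 : ∀ d, p ∣ d → sieveWeight R y₀ d = 0 := fun d hd =>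
        sieveWeight_eq_zero fun r _ h => by simp [hy₀, hd.trans h]
      rcases (Nat.Prime.dvd_mul hp).mp h2 with h2 | h2 <;> simp [h3 _ h2]
    · rfl
  have hkG : ∑ s ∈ Icc 1 R, k s ≤ selG z R / z := by
    rw [selG, sum_div]
    exact sum_le_sum fun s _ => hkY s
  have h11' : sieveForm R 1 y₁ y₁ ≤ selG z R / z := by
    rw [sieveForm_one sq1 sq1]
    refine le_trans (le_of_eq ?_) hkG
    have : ∀ r, (r.totient : ℝ) * (y₁ r * y₁ r) = if p ∣ r then selY z r else 0 := fun r => by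
      simp only [hy₁]
      split_ifs
      · exact totient_mul_selY_mul_selY z r
      · simp
    simp_rw [this]
    rw [sum_multiples hp.pos]
    rfl
  have h11p : 0 ≤ sieveForm R 1 y₁ y₁ := by
    rw [sieveForm_one sq1 sq1]
    exact sum_nonneg fun r _ => mul_nonneg (Nat.cast_nonneg _) (mul_self_nonneg _)
  have h11 : |sieveForm R (p * q') y₁ y₁| ≤ selG z R / z := by
    refine (abs_le_of_sq_le_sq ?_ h11p).trans h11'
    rw [sq (sieveForm R 1 y₁ y₁)]
    exact abs_sieveForm_le (by omega) _ _
  have h0 : sieveForm R 1 y₀ y₀ ≤ selG z R := by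
    rw [sieveForm_one sq0 sq0]
    refine sum_le_sum fun r _ => ?_
    simp only [hy₀]
    split_ifs
    · simpa using selY_nonneg z r
    · exact (totient_mul_selY_mul_selY z r).le
  have hkk : sieveForm R 1 k k ≤ selG z R / z ^ 2 := by
    rw [sieveForm_one sqk sqk, selG, sum_div]
    refine sum_le_sum fun r _ => ?_
    calc (r.totient : ℝ) * (k r * k r) ≤ r.totient * ((selY z r / z) * (selY z r / z)) := by
          have h1 := hkY r; have h2 := hk0 r; have h3 := h2.trans h1; gcongr
      _ = r.totient * (selY z r * selY z r) / z ^ 2 := by ring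
      _ = _ := by rw [totient_mul_selY_mul_selY]
  have hkk0 : 0 ≤ sieveForm R 1 k k := by
    rw [sieveForm_one sqk sqk]
    exact sum_nonneg fun r _ => mul_nonneg (Nat.cast_nonneg _) (mul_self_nonneg _)
  have h01 : |sieveForm R (p * q') y₀ y₁| ≤ selG z R / z := by
    rw [sieveForm_cross hp, abs_neg]
    refine abs_le_of_sq_le_sq ?_ (by positivity)
    calc _ ≤ sieveForm R 1 y₀ y₀ * sieveForm R 1 k k := abs_sieveForm_le hq' _ _
      _ ≤ selG z R * (selG z R / z ^ 2) := by gcongr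
      _ = _ := by ring
  rw [hY, sieveForm_add_left, sieveForm_add_right, sieveForm_add_right, h00,
    sieveForm_comm R _ y₁ y₀]
  calc _ ≤ |sieveForm R (p * q') y₀ y₁| + |sieveForm R (p * q') y₀ y₁| +
        |sieveForm R (p * q') y₁ y₁| := by
        rw [zero_add, ← add_assoc]
        exact (abs_add_le _ _).trans (by gcongr; exact abs_add_le _ _)
    _ ≤ selG z R / z + selG z R / z + selG z R / z := by gcongr
    _ = _ := by ring

lemma sieveForm_selY_one (z R : ℕ) : sieveForm R 1 (selY z) (selY z) = selG z R := by
  rw [sieveForm_one (fun _ => selY_of_not_squarefree) (fun _ => selY_of_not_squarefree), selG]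
  exact sum_congr rfl fun r _ => totient_mul_selY_mul_selY z r

/-- The product of `(1 - 1 / p)⁻¹` over the primes up to `z`. -/
noncomputable def mertensProd (z : ℕ) : ℝ := ∏ p ∈ range (z + 1) with p.Prime, (1 - (p : ℝ)⁻¹)⁻¹

lemma hasSum_inv_factoredNumbers (s : Finset ℕ) :
    HasSum (Set.indicator (Nat.factoredNumbers s) fun m : ℕ => (m : ℝ)⁻¹)
      (∏ p ∈ s with p.Prime, (1 - (p : ℝ)⁻¹)⁻¹) := by
  rw [← hasSum_subtype_iff_indicator]
  let f : ℕ →*₀ ℝ :=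
    { toFun := fun n => (n : ℝ)⁻¹, map_zero' := by simp, map_one' := by simp,
      map_mul' := fun a b => by simp [mul_comm] }
  have h := (EulerProduct.summable_and_hasSum_factoredNumbers_prod_filter_prime_geometric
    (f := f.toMonoidHom) (fun {p} hp => ?_) s).2
  · exact h
  · change ‖(p : ℝ)⁻¹‖ < 1
    rw [norm_inv, Real.norm_natCast]
    exact inv_lt_one_of_one_lt₀ (by exact_mod_cast hp.one_lt)

lemma mertensProd_pos (z : ℕ) : 0 < mertensProd z := by
  refine prod_pos fun p hp => inv_pos.mpr (sub_pos.mpr ?_)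
  exact inv_lt_one_of_one_lt₀ (by exact_mod_cast (mem_filter.mp hp).2.one_lt)

lemma inv_totient_eq (r : ℕ) :
    (r.totient : ℝ)⁻¹ = (r : ℝ)⁻¹ * ∏ p ∈ r.primeFactors, (1 - (p : ℝ)⁻¹)⁻¹ := by
  have h : (r.totient : ℝ) = r * ∏ p ∈ r.primeFactors, (1 - (p : ℝ)⁻¹) := by
    have := Nat.totient_eq_mul_prod_factors r
    have h2 := congrArg (Rat.cast : ℚ → ℝ) this
    push_cast at h2
    exact h2
  rw [h, mul_inv, prod_inv_distrib]

/-- The product of the prime factors of `n` larger than `z`. -/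
def roughRad (z n : ℕ) : ℕ := ∏ p ∈ n.primeFactors with z < p, p

lemma prime_dvd_roughRad {z n p : ℕ} (hp : p.Prime) :
    p ∣ roughRad z n ↔ p ∈ n.primeFactors ∧ z < p := by
  rw [roughRad, Prime.dvd_finsetProd_iff hp.prime]
  constructor
  · rintro ⟨q, hq, hpq⟩
    rw [mem_filter] at hq
    rwa [(Nat.prime_dvd_prime_iff_eq hp (Nat.prime_of_mem_primeFactors hq.1)).mp hpq]
  · intro h
    exact ⟨p, by rwa [mem_filter], dvd_rfl⟩

lemma roughRad_dvd (z n : ℕ) : roughRad z n ∣ n :=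
  (prod_dvd_prod_of_subset _ _ _ (filter_subset _ _)).trans (Nat.prod_primeFactors_dvd n)

lemma squarefree_roughRad (z n : ℕ) : Squarefree (roughRad z n) := by
  rw [roughRad]
  refine Finset.squarefree_prod_of_pairwise_isCoprime ?_ ?_
  · intro p hp q hq hpq
    simp only [coe_filter, Set.mem_ofPred_eq] at hp hq
    exact Nat.coprime_iff_isRelPrime.mp ((Nat.coprime_primes (Nat.prime_of_mem_primeFactors hp.1)
      (Nat.prime_of_mem_primeFactors hq.1)).mpr hpq)
  · intro p hp
    exact (Nat.prime_of_mem_primeFactors (mem_filter.mp hp).1).prime.squarefree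

lemma sum_inv_fiber_le {z R r : ℕ} (hr : 0 < r) :
    ∑ n ∈ Icc 1 R with roughRad z n = r, (n : ℝ)⁻¹ ≤ mertensProd z * selY z r := by
  by_cases hne : ({n ∈ Icc 1 R | roughRad z n = r}).Nonempty
  swap
  · rw [not_nonempty_iff_eq_empty] at hne
    rw [hne, sum_empty]
    exact mul_nonneg (mertensProd_pos z).le (selY_nonneg z r)
  have hsel : Squarefree r ∧ ∀ p, p.Prime → p ∣ r → z < p := by
    obtain ⟨n, hn⟩ := hne
    rw [mem_filter] at hn
    refine ⟨hn.2 ▸ squarefree_roughRad z n, fun p hp hd => ?_⟩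
    rw [← hn.2] at hd
    exact ((prime_dvd_roughRad hp).mp hd).2
  rw [selY, if_pos hsel, inv_totient_eq r]
  set s := range (z + 1) ∪ r.primeFactors with hs
  have hprod : ∏ p ∈ s with p.Prime, (1 - (p : ℝ)⁻¹)⁻¹ =
      mertensProd z * ∏ p ∈ r.primeFactors, (1 - (p : ℝ)⁻¹)⁻¹ := by
    have h1 : r.primeFactors.filter (fun p => p.Prime) = r.primeFactors :=
      filter_true_of_mem fun p hp => Nat.prime_of_mem_primeFactors hp
    rw [hs, filter_union, h1, prod_union, mertensProd]
    rw [disjoint_left]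
    intro p hp hp'
    rw [mem_filter, mem_range] at hp
    have := hsel.2 p hp.2 (Nat.dvd_of_mem_primeFactors hp')
    omega
  have hle : ∑ n ∈ Icc 1 R with roughRad z n = r, ((n / r : ℕ) : ℝ)⁻¹ ≤
      ∏ p ∈ s with p.Prime, (1 - (p : ℝ)⁻¹)⁻¹ := by
    have hinj : Set.InjOn (fun n => n / r) ({n ∈ Icc 1 R | roughRad z n = r} : Finset ℕ) := by
      intro a ha b hb hab
      simp only [coe_filter, Set.mem_ofPred_eq] at ha hb hab
      have h1 : r ∣ a := ha.2 ▸ roughRad_dvd z a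
      have h2 : r ∣ b := hb.2 ▸ roughRad_dvd z b
      rw [← Nat.div_mul_cancel h1, ← Nat.div_mul_cancel h2, hab]
    rw [← sum_image (f := fun k : ℕ => (k : ℝ)⁻¹) hinj]
    refine le_trans (le_of_eq ?_) (sum_le_hasSum
      (((Icc 1 R).filter (fun n => roughRad z n = r)).image (fun n => n / r)) (fun i _ => ?_)
      (hasSum_inv_factoredNumbers s))
    · refine sum_congr rfl fun k hk => ?_
      rw [Set.indicator_of_mem]
      obtain ⟨n, hn, rfl⟩ := mem_image.mp hk
      rw [mem_filter, mem_Icc] at hn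
      have h1 : r ∣ n := hn.2 ▸ roughRad_dvd z n
      have h2 : n / r ≠ 0 := (Nat.div_pos (Nat.le_of_dvd hn.1.1 h1) hr).ne'
      rw [Nat.mem_factoredNumbers]
      refine ⟨h2, fun p hp => ?_⟩
      rw [Nat.mem_primeFactorsList h2] at hp
      have h3 : p ∣ n := hp.2.trans (Nat.div_dvd_of_dvd h1)
      rw [hs, mem_union, mem_range]
      by_cases hz : p ≤ z
      · left; omega
      · right
        rw [Nat.mem_primeFactors]
        refine ⟨hp.1, ?_, hr.ne'⟩
        rw [← hn.2, prime_dvd_roughRad hp.1]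
        exact ⟨Nat.mem_primeFactors.mpr ⟨hp.1, h3, by omega⟩, by omega⟩
    · exact Set.indicator_nonneg (fun _ _ => by positivity) _
  calc _ = (r : ℝ)⁻¹ * ∑ n ∈ Icc 1 R with roughRad z n = r, ((n / r : ℕ) : ℝ)⁻¹ := by
        rw [mul_sum]
        refine sum_congr rfl fun n hn => ?_
        rw [mem_filter] at hn
        have h1 : r ∣ n := hn.2 ▸ roughRad_dvd z n
        rw [← mul_inv, ← Nat.cast_mul, Nat.mul_div_cancel' h1]
    _ ≤ (r : ℝ)⁻¹ * ∏ p ∈ s with p.Prime, (1 - (p : ℝ)⁻¹)⁻¹ := by gcongr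
    _ = _ := by rw [hprod]; ring

lemma log_le_mertensProd_mul_selG (z R : ℕ) : Real.log R ≤ mertensProd z * selG z R := by
  rcases Nat.eq_zero_or_pos R with rfl | hR
  · simp [selG]
  calc Real.log R ≤ Real.log (R + 1 : ℕ) := by
        refine Real.log_le_log (by exact_mod_cast hR) (by push_cast; linarith)
    _ ≤ harmonic R := log_add_one_le_harmonic R
    _ = ∑ n ∈ Icc 1 R, (n : ℝ)⁻¹ := by
        rw [harmonic_eq_sum_Icc]; push_cast; rfl
    _ = ∑ r ∈ Icc 1 R, ∑ n ∈ Icc 1 R with roughRad z n = r, (n : ℝ)⁻¹ := by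
        refine (sum_fiberwise_of_maps_to (fun n hn => ?_) _).symm
        rw [mem_Icc] at hn ⊢
        exact ⟨Nat.pos_of_dvd_of_pos (roughRad_dvd z n) hn.1,
          (Nat.le_of_dvd hn.1 (roughRad_dvd z n)).trans hn.2⟩
    _ ≤ ∑ r ∈ Icc 1 R, mertensProd z * selY z r :=
        sum_le_sum fun r hr => sum_inv_fiber_le (mem_Icc.mp hr).1
    _ = _ := by rw [selG, mul_sum]

lemma mertensProd_le_succ (n : ℕ) : mertensProd n ≤ mertensProd (n + 1) := by
  rw [mertensProd, mertensProd, range_add_one (n := n + 1), filter_insert]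
  split_ifs with h
  · rw [prod_insert (by simp)]
    refine le_mul_of_one_le_left (mertensProd_pos n).le ((one_le_inv₀ (sub_pos.mpr ?_)).mpr ?_)
    · exact inv_lt_one_of_one_lt₀ (by exact_mod_cast h.one_lt)
    · rw [sub_le_self_iff]; positivity
  · exact le_rfl

lemma mertensProd_two_mul_sq_le (m : ℕ) : mertensProd (2 * m + 2) ^ 2 ≤ 4 * (2 * m + 1 : ℝ) := by
  have hsucc : ∀ n, ¬ (n + 1).Prime → mertensProd (n + 1) = mertensProd n := fun n h => by
    rw [mertensProd, range_add_one, filter_insert, if_neg h, mertensProd]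
  induction m with
  | zero =>
    have : mertensProd 2 = 2 := by
      have : (range 3).filter (fun p => p.Prime) = {2} := by decide
      rw [mertensProd, this]; norm_num
    norm_num [this]
  | succ m ih =>
    have h4 : ¬ (2 * m + 3 + 1).Prime := fun h => by
      have := h.eq_one_or_self_of_dvd 2 ⟨m + 2, by ring⟩
      omega
    have h0 := mertensProd_pos (2 * m + 2)
    have h3 : mertensProd (2 * m + 3) ≤ mertensProd (2 * m + 2) * ((2 * m + 3) / (2 * m + 2)) := by
      by_cases h : (2 * m + 2 + 1).Prime
      · rw [mertensProd, range_add_one, filter_insert, if_pos h,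
          prod_insert (by simp), mul_comm, ← mertensProd]
        refine le_of_eq ?_
        congr 1
        push_cast
        have : (2 * m + 2 : ℝ) ≠ 0 := by positivity
        have h' : (2 * m + 3 : ℝ) ≠ 0 := by positivity
        rw [show (1 - (2 * m + 3 : ℝ)⁻¹) = (2 * m + 2) / (2 * m + 3) by field_simp; ring, inv_div]
      · rw [hsucc _ h]
        refine le_mul_of_one_le_right h0.le ?_
        rw [one_le_div (by positivity)]; linarith
    rw [show 2 * (m + 1) + 2 = 2 * m + 3 + 1 by ring, hsucc _ h4]
    calc mertensProd (2 * m + 3) ^ 2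
        ≤ (mertensProd (2 * m + 2) * ((2 * m + 3) / (2 * m + 2))) ^ 2 := by
          have := mertensProd_pos (2 * m + 3); gcongr
      _ = mertensProd (2 * m + 2) ^ 2 * ((2 * m + 3) / (2 * m + 2)) ^ 2 := by ring
      _ ≤ 4 * (2 * m + 1 : ℝ) * ((2 * m + 3) / (2 * m + 2)) ^ 2 := by gcongr
      _ ≤ 4 * (2 * (m + 1 : ℕ) + 1 : ℝ) := by
          rw [div_pow, ← mul_div_assoc, div_le_iff₀ (by positivity)]
          push_cast
          have : (0 : ℝ) ≤ m := Nat.cast_nonneg m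
          nlinarith [sq_nonneg (m : ℝ), mul_nonneg this this]

lemma mertensProd_le {z : ℕ} (hz : 1 ≤ z) : mertensProd z ≤ 2 * √z := by
  have hz' : (1 : ℝ) ≤ z := by exact_mod_cast hz
  refine le_trans ?_ (le_of_eq (Real.sqrt_sq (by positivity)))
  refine Real.le_sqrt_of_sq_le ?_
  rw [mul_pow, Real.sq_sqrt (by positivity)]
  obtain ⟨m, hm⟩ : ∃ m, z = 2 * m + 1 ∨ z = 2 * m + 2 :=
    ⟨(z - 1) / 2, by omega⟩
  have h1 : mertensProd z ≤ mertensProd (2 * m + 2) := by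
    rcases hm with rfl | rfl
    · exact mertensProd_le_succ _
    · exact le_rfl
  have h2 := mertensProd_two_mul_sq_le m
  have h3 : (2 * m + 1 : ℝ) ≤ z := by
    have : 2 * m + 1 ≤ z := by omega
    exact_mod_cast this
  have := mertensProd_pos z
  calc mertensProd z ^ 2 ≤ mertensProd (2 * m + 2) ^ 2 := by gcongr
    _ ≤ 4 * (2 * m + 1 : ℝ) := h2
    _ ≤ 2 ^ 2 * z := by linarith

lemma totient_primorial_mul_mertensProd (w : ℕ) :
    ((primorial w).totient : ℝ) * mertensProd w = primorial w := by
  have h0 : 0 < primorial w := primorial_pos w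
  have h := inv_totient_eq (primorial w)
  have h1 : (primorial w).primeFactors = {p ∈ range (w + 1) | p.Prime} := by
    rw [primeFactors_primorial]
    ext p
    simp [Nat.mem_primesLE]
  have h2 : (0 : ℝ) < (primorial w).totient := by exact_mod_cast Nat.totient_pos.mpr h0
  have h3 : (0 : ℝ) < primorial w := by exact_mod_cast h0
  rw [h1, ← mertensProd] at h
  field_simp at h
  linarith

lemma exists_card_divisors_le {δ : ℝ} (hδ : 0 < δ) :
    ∃ C : ℝ, 1 ≤ C ∧ ∀ n : ℕ, 0 < n → (#n.divisors : ℝ) ≤ C * (n : ℝ) ^ δ := by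
  set c : ℝ := max 1 (δ * Real.log 2)⁻¹ with hc
  have hc1 : 1 ≤ c := le_max_left _ _
  have hl2 : 0 < Real.log 2 := Real.log_pos one_lt_two
  set B : ℕ := ⌈Real.exp δ⁻¹⌉₊ with hB
  refine ⟨c ^ B, one_le_pow₀ hc1, fun n hn => ?_⟩
  have hloc : ∀ p ∈ n.primeFactors, ((n.factorization p + 1 : ℕ) : ℝ) ≤
      (if p < B then c else 1) * ((p : ℝ) ^ δ) ^ n.factorization p := by
    intro p hp
    have hp2 : 2 ≤ p := (Nat.prime_of_mem_primeFactors hp).two_le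
    have hp2' : (2 : ℝ) ≤ p := by exact_mod_cast hp2
    set k := n.factorization p
    have hk : (0 : ℝ) ≤ k := Nat.cast_nonneg k
    have hpow : ((p : ℝ) ^ δ) ^ k = Real.exp (k * (δ * Real.log p)) := by
      rw [Real.rpow_def_of_pos (by linarith), ← Real.exp_nat_mul]
      ring_nf
    have hexp := Real.add_one_le_exp (k * (δ * Real.log p))
    rw [hpow]
    push_cast
    split_ifs with h
    · have h1 : (δ * Real.log 2)⁻¹ ≤ c := le_max_right _ _
      have h2 : 1 ≤ c * (δ * Real.log 2) := by
        rwa [inv_le_iff_one_le_mul₀ (by positivity)] at h1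
      have h3 : δ * Real.log 2 ≤ δ * Real.log p := by gcongr
      have h4 : 1 ≤ c * (δ * Real.log p) := h2.trans (by gcongr)
      calc (k : ℝ) + 1 ≤ c * (k * (δ * Real.log p) + 1) := by nlinarith
        _ ≤ _ := by gcongr
    · rw [one_mul]
      have h1 : Real.exp δ⁻¹ ≤ p := (Nat.le_ceil _).trans (by exact_mod_cast not_lt.mp h)
      have h2 : δ⁻¹ ≤ Real.log p := by
        rw [Real.le_log_iff_exp_le (by linarith)]; exact h1
      have h3 : 1 ≤ δ * Real.log p := by
        rw [inv_le_iff_one_le_mul₀ hδ] at h2; linarith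
      nlinarith
  rw [Nat.card_divisors hn.ne', Nat.cast_prod]
  calc _ ≤ ∏ p ∈ n.primeFactors, (if p < B then c else 1) * ((p : ℝ) ^ δ) ^ n.factorization p :=
        prod_le_prod (fun _ _ => Nat.cast_nonneg _) hloc
    _ = (∏ p ∈ n.primeFactors, if p < B then c else 1) * (n : ℝ) ^ δ := by
        rw [prod_mul_distrib]
        congr 1
        have h1 : (n : ℝ) = ∏ p ∈ n.primeFactors, (p : ℝ) ^ n.factorization p := by
          conv_lhs => rw [← Nat.prod_factorization_pow_eq_self hn.ne']
          rw [Finsupp.prod, Nat.support_factorization]; push_cast; rfl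
        rw [h1, ← Real.finsetProd_rpow _ _ (fun _ _ => by positivity)]
        refine prod_congr rfl fun p _ => ?_
        rw [← Real.rpow_natCast, ← Real.rpow_natCast, ← Real.rpow_mul (by positivity),
          ← Real.rpow_mul (by positivity), mul_comm]
    _ ≤ c ^ B * (n : ℝ) ^ δ := by
        gcongr
        rw [← prod_filter, prod_const]
        refine pow_le_pow_right₀ hc1 ?_
        calc _ ≤ #(range B) := card_le_card fun p hp => by
              rw [mem_filter] at hp; exact mem_range.mpr hp.2
          _ = B := card_range B

lemma le_card_divisors_mul_totient (r : ℕ) : r ≤ #r.divisors * r.totient := by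
  rcases Nat.eq_zero_or_pos r with rfl | hr
  · simp
  conv_lhs => rw [← Nat.sum_totient r]
  rw [← smul_eq_mul]
  refine sum_le_card_nsmul _ _ _ fun d hd => ?_
  exact Nat.le_of_dvd (Nat.totient_pos.mpr hr)
    (Nat.totient_dvd_of_dvd (Nat.dvd_of_mem_divisors hd))

open ArithmeticFunction in
lemma exists_abs_sieveWeight_le {δ : ℝ} (hδ : 0 < δ) :
    ∃ C : ℝ, 1 ≤ C ∧ ∀ z R d : ℕ, 0 < d → |sieveWeight R (selY z) d| ≤ C * (R : ℝ) ^ δ := by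
  obtain ⟨C, hC1, hC⟩ := exists_card_divisors_le (half_pos hδ)
  obtain ⟨C', hC'1, hC'⟩ : ∃ C' : ℝ, 1 ≤ C' ∧ ∀ R : ℕ, 0 < R →
      1 + Real.log R ≤ C' * (R : ℝ) ^ (δ / 2) := by
    refine ⟨1 + (δ / 2)⁻¹, by linarith [inv_pos.mpr (half_pos hδ)], fun R hR => ?_⟩
    have hR' : (1 : ℝ) ≤ R := by exact_mod_cast hR
    have h1 := Real.log_le_rpow_div (x := (R : ℝ)) (by positivity) (half_pos hδ)
    have h2 : 1 ≤ (R : ℝ) ^ (δ / 2) := Real.one_le_rpow hR' (by positivity)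
    rw [div_eq_mul_inv] at h1
    linarith
  refine ⟨C * C', by nlinarith, fun z R d hd => ?_⟩
  rcases Nat.eq_zero_or_pos R with rfl | hR
  · rw [sieveWeight]; simp; positivity
  have hY : ∀ r ∈ Icc 1 R, selY z r ≤ C * (R : ℝ) ^ (δ / 2) * (r : ℝ)⁻¹ := by
    intro r hr
    rw [mem_Icc] at hr
    have hr0 : (0 : ℝ) < r := by exact_mod_cast hr.1
    have hφ : (0 : ℝ) < r.totient := by exact_mod_cast Nat.totient_pos.mpr hr.1
    rw [selY]
    split_ifs
    · rw [inv_le_iff_one_le_mul₀ hφ]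
      have h1 : (r : ℝ) ≤ #r.divisors * r.totient := by
        exact_mod_cast le_card_divisors_mul_totient r
      have h2 : (#r.divisors : ℝ) ≤ C * (R : ℝ) ^ (δ / 2) :=
        (hC r hr.1).trans (by gcongr; exact_mod_cast hr.2)
      calc (1 : ℝ) = r * (r : ℝ)⁻¹ := by field_simp
        _ ≤ (C * (R : ℝ) ^ (δ / 2) * r.totient) * (r : ℝ)⁻¹ := by
            gcongr; exact h1.trans (by gcongr)
        _ = _ := by ring
    · positivity
  have hd0 : (0 : ℝ) < d := by exact_mod_cast hd
  have h1 : |sieveWeight R (selY z) d| ≤ d * ∑ r ∈ Icc 1 R, if d ∣ r then selY z r else 0 := by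
    rw [sieveWeight, abs_mul, abs_mul, Nat.abs_cast]
    have h2 : |(moebius d : ℝ)| ≤ 1 := by exact_mod_cast abs_moebius_le_one
    have h3 : 0 ≤ ∑ r ∈ Icc 1 R, if d ∣ r then selY z r else 0 :=
      sum_nonneg fun r _ => by split_ifs; exacts [selY_nonneg z r, le_rfl]
    rw [abs_of_nonneg h3]
    gcongr
    nlinarith
  refine h1.trans ?_
  rw [sum_multiples hd, mul_sum]
  calc _ ≤ ∑ s ∈ Icc 1 R, C * (R : ℝ) ^ (δ / 2) * (s : ℝ)⁻¹ := by
        refine sum_le_sum fun s hs => ?_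
        have hs0 : (0 : ℝ) < s := by exact_mod_cast (mem_Icc.mp hs).1
        split_ifs with h
        · have h4 := hY (d * s) (mem_Icc.mpr ⟨Nat.mul_pos hd (mem_Icc.mp hs).1, h⟩)
          calc (d : ℝ) * selY z (d * s) ≤ d * (C * (R : ℝ) ^ (δ / 2) * ((d * s : ℕ) : ℝ)⁻¹) := by
                gcongr
            _ = _ := by push_cast; field_simp
        · rw [mul_zero]; positivity
    _ = C * (R : ℝ) ^ (δ / 2) * harmonic R := by
        rw [← mul_sum, harmonic_eq_sum_Icc]; push_cast; rfl
    _ ≤ C * (R : ℝ) ^ (δ / 2) * (C' * (R : ℝ) ^ (δ / 2)) := by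
        gcongr
        exact (harmonic_le_one_add_log R).trans (hC' R hR)
    _ = C * C' * (R : ℝ) ^ δ := by
        have : (R : ℝ) ^ δ = (R : ℝ) ^ (δ / 2) * (R : ℝ) ^ (δ / 2) := by
          rw [← Real.rpow_add (by exact_mod_cast hR)]; ring_nf
        rw [this]; ring

lemma card_lcm_fiber_le {R D : ℕ} (hD : 0 < D) :
    #{x ∈ Icc 1 R ×ˢ Icc 1 R | Nat.lcm x.1 x.2 = D} ≤ #D.divisors ^ 2 := by
  rw [sq, ← card_product]
  refine card_le_card fun x hx => ?_
  rw [mem_filter] at hx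
  rw [mem_product, Nat.mem_divisors, Nat.mem_divisors, ← hx.2]
  exact ⟨⟨Nat.dvd_lcm_left _ _, hx.2 ▸ hD.ne'⟩, ⟨Nat.dvd_lcm_right _ _, hx.2 ▸ hD.ne'⟩⟩

lemma norm_e_sub_one (x : ℝ) : ‖e x - 1‖ = 2 * |Real.sin (Real.pi * x)| := by
  have h := Complex.norm_exp_I_mul_ofReal_sub_one (2 * Real.pi * x)
  rw [e, show (2 * Real.pi * x * Complex.I : ℂ) = Complex.I * ((2 * Real.pi * x : ℝ) : ℂ) by
    push_cast; ring, h, norm_mul, Real.norm_eq_abs, Real.norm_eq_abs, abs_two]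
  congr 3; ring

lemma norm_e_sub_e_le (x y : ℝ) : ‖e x - e y‖ ≤ 2 * Real.pi * |x - y| := by
  have h : e x - e y = e y * (e (x - y) - 1) := by
    rw [mul_sub, ← e_add, mul_one]; ring_nf
  rw [h, norm_mul, norm_e, one_mul, norm_e_sub_one, mul_assoc]
  have := Real.abs_sin_le_abs (x := Real.pi * (x - y))
  rw [abs_mul, abs_of_pos Real.pi_pos] at this
  gcongr

lemma e_intCast (n : ℤ) : e n = 1 := by
  rw [e, Complex.exp_eq_one_iff]
  exact ⟨n, by push_cast; ring⟩

lemma four_mul_abs_sub_round_le (x : ℝ) : 4 * |x - round x| ≤ ‖e x - 1‖ := by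
  have h1 : e x = e (x - round x) := by
    have h2 : e x = e ((x - round x) + (round x : ℤ)) := by rw [sub_add_cancel]
    rw [h2, e_add, e_intCast, mul_one]
  rw [h1, norm_e_sub_one]
  set y := x - round x with hy
  have hy2 : |y| ≤ 1 / 2 := abs_sub_round x
  have h3 := Real.mul_abs_le_abs_sin (x := Real.pi * y) (by
    rw [abs_mul, abs_of_pos Real.pi_pos]; nlinarith [Real.pi_pos])
  rw [abs_mul, abs_of_pos Real.pi_pos] at h3
  have h4 : 2 / Real.pi * (Real.pi * |y|) = 2 * |y| := by
    have := Real.pi_ne_zero; field_simp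
  linarith

lemma norm_sum_e_mul_le (K : ℕ) (u x : ℝ) :
    ‖∑ j ∈ range K, e (u + j * x)‖ * (2 * |x - round x|) ≤ 1 := by
  have h1 : ∑ j ∈ range K, e (u + j * x) = e u * ∑ j ∈ range K, e x ^ j := by
    rw [mul_sum]
    exact sum_congr rfl fun j _ => by rw [e_add, e_nat_mul]
  rw [h1, norm_mul, norm_e, one_mul]
  have h2 : (∑ j ∈ range K, e x ^ j) * (e x - 1) = e x ^ K - 1 := geom_sum_mul _ _
  have h3 : ‖e x ^ K - 1‖ ≤ 2 := by
    refine (norm_sub_le _ _).trans ?_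
    rw [norm_pow, norm_e]; norm_num
  have h4 := four_mul_abs_sub_round_le x
  have h5 := congrArg norm h2
  rw [norm_mul] at h5
  have h6 := norm_nonneg (∑ j ∈ range K, e x ^ j)
  nlinarith [mul_le_mul_of_nonneg_left h4 h6]

lemma exists_sum_dvd_eq {W b D : ℕ} (hD : 0 < D) (hDW : D.Coprime W) (N : ℕ) :
    ∃ c K : ℕ, c < D ∧ D ∣ W * c + b ∧ D * K ≤ N + D ∧ N ≤ D * K + D ∧
      ∀ f : ℕ → ℂ, ∑ m ∈ range N, (if D ∣ W * m + b then f m else 0) =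
        ∑ j ∈ range K, f (c + D * j) := by
  obtain ⟨c, hcD, hc⟩ : ∃ c, c < D ∧ D ∣ W * c + b := by
    obtain ⟨c, hcD, hc⟩ := Nat.exists_mul_mod_eq_of_coprime (D * b - b) hDW.symm hD.ne'
    refine ⟨c, hcD, Nat.modEq_zero_iff_dvd.mp ?_⟩
    have h1 : W * c + b ≡ D * b - b + b [MOD D] := Nat.ModEq.add_right b hc
    rw [Nat.sub_add_cancel (Nat.le_mul_of_pos_left b hD)] at h1
    exact h1.trans (Nat.modEq_zero_iff_dvd.mpr (dvd_mul_right D b))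
  have hiff : ∀ m, D ∣ W * m + b ↔ m ≡ c [MOD D] := by
    intro m
    have h0 : W * c + b ≡ 0 [MOD D] := (Nat.modEq_zero_iff_dvd).mpr hc
    rw [← Nat.modEq_zero_iff_dvd]
    constructor
    · intro h
      exact Nat.ModEq.cancel_left_of_coprime hDW (Nat.ModEq.add_right_cancel' b (h.trans h0.symm))
    · intro h
      exact ((h.mul_left W).add_right b).trans h0
  refine ⟨c, (N + D - 1 - c) / D, hcD, hc, ?_, ?_, fun f => ?_⟩
  · have := Nat.mul_div_le (N + D - 1 - c) D; omega
  · have := Nat.lt_mul_div_succ (N + D - 1 - c) hD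
    rw [mul_add, mul_one] at this
    omega
  · symm
    have hlt : ∀ j, j < (N + D - 1 - c) / D ↔ c + D * j < N := by
      intro j
      rw [← Nat.add_one_le_iff, Nat.le_div_iff_mul_le hD, add_mul, one_mul, mul_comm j]
      omega
    refine sum_of_injOn (fun j => c + D * j) ?_ ?_ ?_ ?_
    · intro a _ b _ h
      simpa [hD.ne'] using h
    · intro j hj
      simp only [coe_range, Set.mem_Iio] at hj ⊢
      exact (hlt j).mp hj
    · intro m hm hm'
      rw [if_neg]
      intro h
      rw [hiff] at h
      rw [mem_range] at hm
      have h1 : m % D = c := by rw [h, Nat.mod_eq_of_lt hcD]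
      have h2 := Nat.div_add_mod m D
      refine hm' ⟨m / D, ?_, by simp only; omega⟩
      simp only [coe_range, Set.mem_Iio]
      rw [hlt]; omega
    · intro j _
      have : D ∣ W * (c + D * j) + b := by
        rw [hiff]; simp [Nat.ModEq]
      rw [if_pos this]

lemma norm_sum_progression_sub_le {c D K N : ℕ} (hc : c < D) (h1 : D * K ≤ N + D)
    (h2 : N ≤ D * K + D) (hDN : D ≤ N) (β : ℝ) :
    ‖∑ j ∈ range K, e ((c + D * j : ℕ) * β) - (D : ℂ)⁻¹ * ∑ m ∈ range N, e (m * β)‖ ≤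
      1 + 13 * (N * |β|) := by
  have hD : 0 < D := by omega
  have hD' : (0 : ℝ) < D := by exact_mod_cast hD
  have hDc : (D : ℂ) ≠ 0 := by exact_mod_cast hD.ne'
  have hblock : ∑ m ∈ range (D * K), e (m * β) =
      ∑ j ∈ range K, ∑ t ∈ range D, e ((t + D * j : ℕ) * β) := by
    clear h1 h2
    induction K with
    | zero => simp
    | succ K ih =>
      rw [mul_add, mul_one, sum_range_add, ih, sum_range_succ]
      congr 1
      exact sum_congr rfl fun t _ => by rw [add_comm]
  have hA : ‖∑ j ∈ range K, e ((c + D * j : ℕ) * β) -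
      (D : ℂ)⁻¹ * ∑ m ∈ range (D * K), e (m * β)‖ ≤ 2 * Real.pi * (2 * N * |β|) := by
    have h3 : ∑ j ∈ range K, e ((c + D * j : ℕ) * β) - (D : ℂ)⁻¹ * ∑ m ∈ range (D * K), e (m * β)
        = (D : ℂ)⁻¹ * ∑ j ∈ range K, ∑ t ∈ range D,
          (e ((c + D * j : ℕ) * β) - e ((t + D * j : ℕ) * β)) := by
      simp_rw [sum_sub_distrib, sum_const, card_range, nsmul_eq_mul]
      rw [hblock, ← mul_sum, mul_sub, inv_mul_cancel_left₀ hDc]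
    rw [h3, norm_mul, norm_inv, Complex.norm_natCast]
    have h4 : ‖∑ j ∈ range K, ∑ t ∈ range D,
        (e ((c + D * j : ℕ) * β) - e ((t + D * j : ℕ) * β))‖ ≤
        ∑ j ∈ range K, ∑ t ∈ range D, 2 * Real.pi * (D * |β|) := by
      refine (norm_sum_le _ _).trans (sum_le_sum fun j _ => (norm_sum_le _ _).trans
        (sum_le_sum fun t ht => (norm_e_sub_e_le _ _).trans ?_))
      rw [← sub_mul, abs_mul]
      have : |((c + D * j : ℕ) : ℝ) - (t + D * j : ℕ)| ≤ D := by
        rw [mem_range] at ht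
        have h5 : (c : ℝ) < D := by exact_mod_cast hc
        have h6 : (t : ℝ) < D := by exact_mod_cast ht
        push_cast
        rw [abs_le]
        constructor <;> linarith [Nat.cast_nonneg (α := ℝ) c, Nat.cast_nonneg (α := ℝ) t]
      have := Real.pi_pos
      gcongr
    have h7 : (D * K : ℝ) ≤ 2 * N := by
      have : D * K ≤ 2 * N := by omega
      exact_mod_cast this
    have hpi := Real.pi_pos
    calc (D : ℝ)⁻¹ * _ ≤ (D : ℝ)⁻¹ * ∑ j ∈ range K, ∑ t ∈ range D, 2 * Real.pi * (D * |β|) := by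
          gcongr
      _ = 2 * Real.pi * ((D * K) * |β|) := by
          simp only [sum_const, card_range, nsmul_eq_mul]
          field_simp
      _ ≤ _ := by gcongr
  have hB : ‖(D : ℂ)⁻¹ * ∑ m ∈ range (D * K), e (m * β) -
      (D : ℂ)⁻¹ * ∑ m ∈ range N, e (m * β)‖ ≤ 1 := by
    rw [← mul_sub, norm_mul, norm_inv, Complex.norm_natCast]
    have h3 : ∀ A B : ℕ, A ≤ B → B ≤ A + D →
        ‖∑ m ∈ range B, e (m * β) - ∑ m ∈ range A, e (m * β)‖ ≤ D := by
      intro A B hAB hBA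
      rw [← sum_Ico_eq_sub _ hAB]
      refine (norm_sum_le _ _).trans ?_
      simp only [norm_e, sum_const, Nat.card_Ico, nsmul_eq_mul, mul_one]
      exact_mod_cast (by omega : B - A ≤ D)
    have h4 : ‖∑ m ∈ range (D * K), e (m * β) - ∑ m ∈ range N, e (m * β)‖ ≤ D := by
      rcases le_total N (D * K) with h | h
      · exact h3 N (D * K) h h1
      · rw [norm_sub_rev]; exact h3 (D * K) N h h2
    rw [inv_mul_le_iff₀ hD', mul_one]
    exact h4
  have hpi : Real.pi ≤ 3.15 := Real.pi_lt_d2.le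
  have hβ : 0 ≤ N * |β| := by positivity
  calc _ ≤ 2 * Real.pi * (2 * N * |β|) + 1 := by
        refine le_trans ?_ (add_le_add hA hB)
        refine le_trans (le_of_eq ?_) (norm_add_le _ _)
        congr 1; ring
    _ ≤ _ := by nlinarith

lemma inv_abs_sub_round_le {m q : ℕ} (hq : 0 < q) (hm : ¬ q ∣ m) :
    |(m : ℝ) / q - round ((m : ℝ) / q)|⁻¹ ≤
      (q : ℝ) / (m % q : ℕ) + (q : ℝ) / (q - m % q : ℕ) ∧
    1 / (q : ℝ) ≤ |(m : ℝ) / q - round ((m : ℝ) / q)| := by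
  set s := m % q with hs
  have hs0 : 0 < s := Nat.pos_of_ne_zero fun h => hm (Nat.dvd_of_mod_eq_zero h)
  have hsq : s < q := Nat.mod_lt _ hq
  have hq' : (0 : ℝ) < q := by exact_mod_cast hq
  have hs' : (0 : ℝ) < s := by exact_mod_cast hs0
  have hqs' : (0 : ℝ) < (q - s : ℕ) := by exact_mod_cast Nat.sub_pos_of_lt hsq
  have hm' : (m : ℝ) / q = (m / q : ℕ) + s / q := by
    have h1 : ((q * (m / q) + s : ℕ) : ℝ) = m := by exact_mod_cast Nat.div_add_mod m q
    push_cast at h1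
    field_simp
    linarith
  set t := round ((m : ℝ) / q)
  have hcases : (s : ℝ) / q ≤ |(m : ℝ) / q - t| ∨ ((q - s : ℕ) : ℝ) / q ≤ |(m : ℝ) / q - t| := by
    rcases le_or_gt t ((m / q : ℕ) : ℤ) with h | h
    · left
      have h1 : ((t : ℤ) : ℝ) ≤ (((m / q : ℕ) : ℤ) : ℝ) := by exact_mod_cast h
      rw [Int.cast_natCast] at h1
      refine le_trans ?_ (le_abs_self _)
      rw [hm']; linarith
    · right
      have h1 : (((m / q : ℕ) : ℤ) : ℝ) + 1 ≤ ((t : ℤ) : ℝ) := by exact_mod_cast h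
      rw [Int.cast_natCast] at h1
      refine le_trans ?_ (neg_le_abs _)
      rw [Nat.cast_sub hsq.le, sub_div, div_self hq'.ne', hm']; linarith
  have hone : (1 : ℝ) ≤ s := by exact_mod_cast hs0
  have hone' : (1 : ℝ) ≤ (q - s : ℕ) := by exact_mod_cast Nat.sub_pos_of_lt hsq
  constructor
  · rcases hcases with h | h
    · have h1 : |(m : ℝ) / q - t|⁻¹ ≤ (q : ℝ) / s := by
        exact (inv_anti₀ (by positivity) h).trans_eq (inv_div _ _)
      have : 0 ≤ (q : ℝ) / (q - s : ℕ) := by positivity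
      linarith
    · have h1 : |(m : ℝ) / q - t|⁻¹ ≤ (q : ℝ) / (q - s : ℕ) := by
        exact (inv_anti₀ (by positivity) h).trans_eq (inv_div _ _)
      have : 0 ≤ (q : ℝ) / s := by positivity
      linarith
  · rcases hcases with h | h
    · exact le_trans (by gcongr) h
    · exact le_trans (by gcongr) h

lemma sum_range_mul_mod (g : ℕ → ℝ) (q K : ℕ) :
    ∑ n ∈ range (q * K), g (n % q) = K * ∑ n ∈ range q, g n := by
  induction K with
  | zero => simp
  | succ K ih =>
    rw [mul_add, mul_one, sum_range_add, ih]
    have : ∀ x ∈ range q, g ((q * K + x) % q) = g x := fun x hx => by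
      rw [Nat.mul_add_mod, Nat.mod_eq_of_lt (mem_range.mp hx)]
    rw [sum_congr rfl this]; push_cast; ring

lemma sum_inv_abs_sub_round_le {a q : ℕ} (hq : 0 < q) (haq : a.Coprime q) (X : ℕ) :
    ∑ D ∈ Icc 1 X, (if q ∣ D then 0 else
      |((D * a : ℕ) : ℝ) / q - round (((D * a : ℕ) : ℝ) / q)|⁻¹) ≤
      (X + q) * (2 * (1 + Real.log q)) := by
  set g : ℕ → ℝ := fun s => (q : ℝ) / s + (q : ℝ) / (q - s : ℕ) with hg
  have hq' : (0 : ℝ) < q := by exact_mod_cast hq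
  have hg0 : ∀ s, 0 ≤ g s := fun s => by positivity
  have hdvd : ∀ D, ¬ q ∣ D → ¬ q ∣ D * a := fun D h h' => h (haq.symm.dvd_of_dvd_mul_right h')
  set h : ℕ → ℝ := fun r => if r = 0 then 0 else g (r * a % q) with hh
  have hh0 : ∀ r, 0 ≤ h r := fun r => by simp only [hh]; split_ifs; exacts [le_rfl, hg0 _]
  have h1 : ∀ D ∈ Icc 1 X, (if q ∣ D then 0 else
      |((D * a : ℕ) : ℝ) / q - round (((D * a : ℕ) : ℝ) / q)|⁻¹) ≤ h (D % q) := by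
    intro D _
    simp only [hh, ← Nat.dvd_iff_mod_eq_zero]
    split_ifs with hd
    · exact le_rfl
    · rw [Nat.mod_mul_mod]
      exact (inv_abs_sub_round_le hq (hdvd D hd)).1
  have hbij : ∑ r ∈ range q, h r = ∑ s ∈ range q, if s = 0 then 0 else g s := by
    refine sum_nbij (fun r => r * a % q) ?_ ?_ ?_ ?_
    · intro r _; exact mem_range.mpr (Nat.mod_lt _ hq)
    · intro r hr r' hr' h
      simp only [coe_range, Set.mem_Iio] at hr hr'
      have h2 : r ≡ r' [MOD q] := Nat.ModEq.cancel_right_of_coprime haq.symm h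
      rwa [Nat.ModEq, Nat.mod_eq_of_lt hr, Nat.mod_eq_of_lt hr'] at h2
    · intro s hs
      simp only [coe_range, Set.mem_Iio] at hs
      obtain ⟨r, hr, hrs⟩ := Nat.exists_mul_mod_eq_of_coprime s haq hq.ne'
      refine ⟨r, by simpa using hr, ?_⟩
      simp only
      rw [mul_comm, hrs, Nat.mod_eq_of_lt hs]
    · intro r hr
      rw [mem_range] at hr
      have : r = 0 ↔ r * a % q = 0 := by
        constructor
        · rintro rfl; simp
        · intro h
          by_contra h0
          exact hdvd r (fun hd => absurd (Nat.le_of_dvd (Nat.pos_of_ne_zero h0) hd) (by omega))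
            (Nat.dvd_of_mod_eq_zero h)
      simp only [hh, this]
  have hsum : ∑ s ∈ range q, (if s = 0 then 0 else g s) ≤ q * (2 * (1 + Real.log q)) := by
    have hH : ∑ s ∈ range q, ((s + 1 : ℕ) : ℝ)⁻¹ ≤ 1 + Real.log q := by
      refine le_trans (le_of_eq ?_) (harmonic_le_one_add_log q)
      rw [harmonic]; push_cast; rfl
    have h2 : ∑ s ∈ range q, ((q - s : ℕ) : ℝ)⁻¹ ≤ 1 + Real.log q := by
      refine le_trans (le_of_eq ?_) hH
      rw [← sum_range_reflect]
      refine sum_congr rfl fun s hs => ?_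
      rw [mem_range] at hs
      congr 2; omega
    have h3 : ∑ s ∈ range q, (s : ℝ)⁻¹ ≤ 1 + Real.log q := by
      refine le_trans ?_ hH
      have h4 := sum_range_succ' (fun s : ℕ => (s : ℝ)⁻¹) q
      rw [sum_range_succ, Nat.cast_zero, inv_zero, add_zero] at h4
      rw [← h4]
      exact le_add_of_nonneg_right (by positivity)
    calc _ ≤ ∑ s ∈ range q, g s := sum_le_sum fun s _ => by split_ifs; exacts [hg0 s, le_rfl]
      _ = q * (∑ s ∈ range q, (s : ℝ)⁻¹ + ∑ s ∈ range q, ((q - s : ℕ) : ℝ)⁻¹) := by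
          rw [← sum_add_distrib, mul_sum]
          exact sum_congr rfl fun s _ => by simp only [hg]; ring
      _ ≤ _ := by gcongr; linarith
  calc _ ≤ ∑ D ∈ Icc 1 X, h (D % q) := sum_le_sum h1
    _ ≤ ∑ D ∈ range (q * (X / q + 1)), h (D % q) := by
        refine sum_le_sum_of_subset_of_nonneg (fun D hD => ?_) fun _ _ _ => hh0 _
        rw [mem_Icc] at hD
        have := Nat.lt_mul_div_succ X hq
        exact mem_range.mpr (by omega)
    _ = ((X / q + 1 : ℕ) : ℝ) * ∑ s ∈ range q, (if s = 0 then 0 else g s) := by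
        rw [sum_range_mul_mod, hbij]
    _ ≤ ((X / q + 1 : ℕ) : ℝ) * (q * (2 * (1 + Real.log q))) := by gcongr
    _ = (((X / q + 1) * q : ℕ) : ℝ) * (2 * (1 + Real.log q)) := by push_cast; ring
    _ ≤ _ := by
        have := Real.log_natCast_nonneg q
        gcongr
        have : (X / q + 1) * q ≤ X + q := by
          have := Nat.div_mul_le_self X q
          rw [add_mul, one_mul]; omega
        exact_mod_cast this

lemma coprime_of_sieveWeight_ne_zero {z R d W : ℕ} (hWz : ∀ p, p.Prime → p ∣ W → p ≤ z)
    (h : sieveWeight R (selY z) d ≠ 0) : d.Coprime W := by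
  rw [Nat.coprime_iff_isRelPrime]
  by_contra hcop
  rw [← Nat.coprime_iff_isRelPrime, Nat.Prime.not_coprime_iff_dvd] at hcop
  obtain ⟨p, hp, hpd, hpW⟩ := hcop
  refine h (sieveWeight_eq_zero fun r _ hdr => ?_)
  rw [selY, if_neg]
  rintro ⟨-, h'⟩
  exact absurd (h' p hp (hpd.trans hdr)) (not_lt.mpr (hWz p hp hpW))

lemma exists_nat_approx {α : ℝ} (hα : 0 ≤ α) {Q : ℕ} (hQ : 0 < Q) :
    ∃ a q : ℕ, 0 < q ∧ q ≤ Q ∧ a.Coprime q ∧ |α - (a : ℝ) / q| ≤ 1 / ((Q : ℝ) * q) := by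
  obtain ⟨r, hr, hrQ⟩ := Real.exists_rat_abs_sub_le_and_den_le α hQ
  have hd : (0 : ℝ) < r.den := by exact_mod_cast r.pos
  have hQ' : (0 : ℝ) < Q := by exact_mod_cast hQ
  have hr0 : 0 ≤ r.num := by
    by_contra hneg
    have h1 : (r.num : ℝ) ≤ -1 := by exact_mod_cast (by omega : r.num ≤ -1)
    have h2 : (r : ℝ) = r.num / r.den := by exact_mod_cast (Rat.num_div_den r).symm
    have h3 : (r : ℝ) ≤ -(1 / r.den) := by
      rw [h2, div_le_iff₀ hd, neg_mul, one_div, inv_mul_cancel₀ hd.ne']; exact h1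
    have h4 := (le_abs_self _).trans hr
    have h5 : 1 / ((Q + 1 : ℝ) * r.den) < 1 / r.den := by
      apply one_div_lt_one_div_of_lt hd; nlinarith
    linarith
  refine ⟨r.num.natAbs, r.den, r.pos, hrQ, r.reduced, ?_⟩
  have h2 : (r : ℝ) = (r.num.natAbs : ℝ) / r.den := by
    rw [Nat.cast_natAbs, abs_of_nonneg hr0]
    exact_mod_cast (Rat.num_div_den r).symm
  rw [← h2]
  refine hr.trans ?_
  gcongr
  linarith

lemma half_inv_le_abs_sub_round {α : ℝ} {a q D Q : ℕ} (hq : 0 < q) (hQ : 0 < Q)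
    (hα : |α - (a : ℝ) / q| ≤ 1 / ((Q : ℝ) * q)) (hDQ : 2 * D ≤ Q) (hqD : ¬ q ∣ D * a) :
    |((D * a : ℕ) : ℝ) / q - round (((D * a : ℕ) : ℝ) / q)| / 2 ≤ |D * α - round (D * α)| := by
  have h1 := (inv_abs_sub_round_le hq hqD).2
  have h2 := round_le (((D * a : ℕ) : ℝ) / q) (round (D * α))
  have hq' : (0 : ℝ) < q := by exact_mod_cast hq
  have hQ' : (0 : ℝ) < Q := by exact_mod_cast hQ
  have h3 : |((D * a : ℕ) : ℝ) / q - D * α| ≤ 1 / (q : ℝ) / 2 := by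
    have h4 : ((D * a : ℕ) : ℝ) / q - D * α = D * -(α - (a : ℝ) / q) := by push_cast; ring
    rw [h4, abs_mul, abs_neg, Nat.abs_cast]
    have h5 : (2 * D : ℝ) ≤ Q := by exact_mod_cast hDQ
    calc (D : ℝ) * |α - (a : ℝ) / q| ≤ (Q / 2) * (1 / ((Q : ℝ) * q)) := by gcongr; linarith
      _ = _ := by field_simp
  have h6 := abs_sub_le (((D * a : ℕ) : ℝ) / q) (D * α) (round (D * α))
  linarith

section
variable {W b z R N : ℕ}

lemma norm_sum_dvd_of_dvd {α : ℝ} {a q D : ℕ} (hq : 0 < q) (hD : 0 < D) (hDW : D.Coprime W)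
    (hDN : D ≤ N) (hqD : q ∣ D) {c₀ : ℕ} (hc₀ : q ∣ W * c₀ + b) :
    ‖∑ m ∈ range N, (if D ∣ W * m + b then e (m * α) else 0) -
      e ((c₀ * a : ℕ) / q) * ((D : ℂ)⁻¹ * ∑ m ∈ range N, e (m * (α - (a : ℝ) / q)))‖ ≤
      1 + 13 * (N * |α - (a : ℝ) / q|) := by
  obtain ⟨c, K, hcD, hc, h1, h2, hf⟩ := exists_sum_dvd_eq (b := b) hD hDW N
  have hq' : (q : ℝ) ≠ 0 := by exact_mod_cast hq.ne'
  set β := α - (a : ℝ) / q with hβ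
  have hcc : c ≡ c₀ [MOD q] := by
    have h3 : W * c + b ≡ W * c₀ + b [MOD q] :=
      (Nat.modEq_zero_iff_dvd.mpr (hqD.trans hc)).trans (Nat.modEq_zero_iff_dvd.mpr hc₀).symm
    exact Nat.ModEq.cancel_left_of_coprime (Nat.Coprime.coprime_dvd_left hqD hDW)
      (Nat.ModEq.add_right_cancel' b h3)
  have hper : ∀ x y : ℕ, x ≡ y [MOD q] → e ((x : ℝ) / q) = e ((y : ℝ) / q) := by
    have haux : ∀ x : ℕ, e ((x : ℝ) / q) = e (((x % q : ℕ) : ℝ) / q) := by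
      intro x
      have h4 : (x : ℝ) / q = (x / q : ℕ) + ((x % q : ℕ) : ℝ) / q := by
        have h1 : ((q * (x / q) + x % q : ℕ) : ℝ) = x := by exact_mod_cast Nat.div_add_mod x q
        push_cast at h1
        field_simp
        linarith
      rw [h4, e_add, e_natCast, one_mul]
    intro x y h
    rw [haux x, haux y, h]
  have hterm : ∀ j, e ((c + D * j : ℕ) * α) =
      e ((c₀ * a : ℕ) / q) * e ((c + D * j : ℕ) * β) := by
    intro j
    have h5 : ((c + D * j : ℕ) : ℝ) * α =
        (((c + D * j) * a : ℕ) : ℝ) / q + (c + D * j : ℕ) * β := by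
      rw [hβ]; push_cast; ring
    rw [h5, e_add]
    congr 1
    refine hper _ _ (Nat.ModEq.mul_right a ?_)
    have : D * j ≡ 0 [MOD q] := Nat.modEq_zero_iff_dvd.mpr (hqD.mul_right j)
    simpa using hcc.add this
  rw [hf fun m => e (m * α), sum_congr rfl fun j _ => hterm j, ← mul_sum, ← mul_sub, norm_mul,
    norm_e, one_mul]
  exact norm_sum_progression_sub_le hcD h1 h2 hDN β

lemma norm_sum_dvd_le {α : ℝ} {D : ℕ} (hD : 0 < D) (hDW : D.Coprime W) :
    ‖∑ m ∈ range N, (if D ∣ W * m + b then e (m * α) else 0)‖ *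
      (2 * |D * α - round (D * α)|) ≤ 1 := by
  obtain ⟨c, K, -, -, -, -, hf⟩ := exists_sum_dvd_eq (b := b) hD hDW N
  rw [hf fun m => e (m * α)]
  have : ∀ j, e ((c + D * j : ℕ) * α) = e (c * α + j * (D * α)) := fun j => by
    congr 1; push_cast; ring
  rw [sum_congr rfl fun j _ => this j]
  exact norm_sum_e_mul_le K _ _

lemma norm_sum_e_le (N : ℕ) (α : ℝ) : ‖∑ m ∈ range N, e (m * α)‖ ≤ N := by
  refine (norm_sum_le _ _).trans ?_
  simp [norm_e]

/-- The Fourier transform of the square of Selberg's sieve sum along a progression. -/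
lemma norm_sum_sieveSum_sq_sub_le (hWz : ∀ p, p.Prime → p ∣ W → p ≤ z) (hz : 0 < z)
    {Q : ℕ} (hQ : 0 < Q) (hRQ : 2 * R ^ 2 ≤ Q) (hRN : R ^ 2 ≤ N) {Λ T : ℝ}
    (hΛ : ∀ d ∈ Icc 1 R, |sieveWeight R (selY z) d| ≤ Λ)
    (hT : ∀ D ∈ Icc 1 (R ^ 2), (#D.divisors : ℝ) ^ 2 ≤ T) {α : ℝ} (hα : 0 ≤ α) (hΛ0 : 0 ≤ Λ)
    (hT0 : 0 ≤ T) :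
    ‖∑ m ∈ range N, ((sieveSum R (selY z) (W * m + b) ^ 2 : ℝ) : ℂ) * e (m * α) -
      selG z R * ∑ m ∈ range N, e (m * α)‖ ≤
      3 * selG z R / z * N + selG z R * Q + (R : ℝ) ^ 2 * (Λ ^ 2 * (1 + 13 * (N / Q))) +
        Λ ^ 2 * (T * ((R ^ 2 + Q) * (2 * (1 + Real.log Q)))) := by
  obtain ⟨a, q, hq, hqQ, haq, hαq⟩ := exists_nat_approx hα hQ
  have hQ' : (0 : ℝ) < Q := by exact_mod_cast hQ
  have hq' : (0 : ℝ) < q := by exact_mod_cast hq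
  have hq1 : (1 : ℝ) ≤ q := by exact_mod_cast hq
  have hz' : (0 : ℝ) < z := by exact_mod_cast hz
  have hG : 0 ≤ selG z R := sum_nonneg fun r _ => selY_nonneg z r
  set β := α - (a : ℝ) / q with hβ
  set w := sieveWeight R (selY z) with hw
  set g : ℕ → ℝ := fun D => if q ∣ D then 0 else
    |((D * a : ℕ) : ℝ) / q - round (((D * a : ℕ) : ℝ) / q)|⁻¹ with hg
  have hg0 : ∀ D, 0 ≤ g D := fun D => by simp only [hg]; split_ifs <;> positivity
  set P : ℕ → ℂ := fun D => ∑ m ∈ range N, if D ∣ W * m + b then e (m * α) else 0 with hP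
  set V : ℂ := ∑ m ∈ range N, e (m * β) with hV
  obtain ⟨c₀, hc₀⟩ : ∃ c₀ : ℕ, (∃ c, q ∣ W * c + b) → q ∣ W * c₀ + b := by
    by_cases h : ∃ c, q ∣ W * c + b
    · obtain ⟨c, hc⟩ := h
      exact ⟨c, fun _ => hc⟩
    · exact ⟨0, fun h' => absurd h' h⟩
  set ζ : ℂ := e ((c₀ * a : ℕ) / q) with hζ
  have hβ1 : 13 * (N * |β|) ≤ 13 * ((N : ℝ) / Q) := by
    have : |β| ≤ 1 / Q := hαq.trans (by gcongr; nlinarith)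
    rw [div_eq_mul_one_div (N : ℝ)]
    gcongr
  have hpair : ∀ d₁ ∈ Icc 1 R, ∀ d₂ ∈ Icc 1 R,
      ‖((w d₁ * w d₂ : ℝ) : ℂ) * P (Nat.lcm d₁ d₂) - ζ * (((if q ∣ Nat.lcm d₁ d₂ then
        w d₁ * w d₂ / (Nat.lcm d₁ d₂ : ℕ) else 0 : ℝ) : ℂ) * V)‖ ≤
      Λ ^ 2 * (1 + 13 * (N / Q)) + Λ ^ 2 * g (Nat.lcm d₁ d₂) := by
    intro d₁ h₁ d₂ h₂
    have hrhs : 0 ≤ Λ ^ 2 * (1 + 13 * ((N : ℝ) / Q)) := by positivity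
    have hrhs' : 0 ≤ Λ ^ 2 * g (Nat.lcm d₁ d₂) := mul_nonneg (by positivity) (hg0 _)
    by_cases hw0 : w d₁ * w d₂ = 0
    · rw [hw0]; simp; linarith
    have hww : ‖((w d₁ * w d₂ : ℝ) : ℂ)‖ ≤ Λ ^ 2 := by
      rw [Complex.norm_real, Real.norm_eq_abs, abs_mul, sq]
      exact mul_le_mul (hΛ _ h₁) (hΛ _ h₂) (abs_nonneg _) hΛ0
    have hcop : (Nat.lcm d₁ d₂).Coprime W := by
      refine Nat.Coprime.coprime_dvd_left (Nat.lcm_dvd_mul d₁ d₂) (Nat.Coprime.mul_left ?_ ?_)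
      · exact coprime_of_sieveWeight_ne_zero hWz (left_ne_zero_of_mul hw0)
      · exact coprime_of_sieveWeight_ne_zero hWz (right_ne_zero_of_mul hw0)
    rw [mem_Icc] at h₁ h₂
    have hD : 0 < Nat.lcm d₁ d₂ := Nat.lcm_pos h₁.1 h₂.1
    have hDR : Nat.lcm d₁ d₂ ≤ R ^ 2 := by
      refine (Nat.le_of_dvd (Nat.mul_pos h₁.1 h₂.1) (Nat.lcm_dvd_mul d₁ d₂)).trans ?_
      rw [sq]; exact Nat.mul_le_mul h₁.2 h₂.2
    set D := Nat.lcm d₁ d₂ with hDdef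
    by_cases hqD : q ∣ D
    · have hex : q ∣ W * c₀ + b := by
        obtain ⟨c, -, -, hc, -⟩ := exists_sum_dvd_eq (b := b) hD hcop N
        exact hc₀ ⟨c, hqD.trans hc⟩
      have h1 := norm_sum_dvd_of_dvd (b := b) (α := α) (a := a) hq hD hcop (hDR.trans hRN) hqD hex
      rw [if_pos hqD]
      have h2 : ((w d₁ * w d₂ : ℝ) : ℂ) * P D - ζ * (((w d₁ * w d₂ / D : ℝ) : ℂ) * V) =
          ((w d₁ * w d₂ : ℝ) : ℂ) * (P D - ζ * ((D : ℂ)⁻¹ * V)) := by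
        push_cast; ring
      rw [h2, norm_mul]
      calc _ ≤ Λ ^ 2 * (1 + 13 * (N * |β|)) := by gcongr
        _ ≤ _ := by
          have : Λ ^ 2 * (1 + 13 * (N * |β|)) ≤ Λ ^ 2 * (1 + 13 * ((N : ℝ) / Q)) := by gcongr
          linarith
    · have hqDa : ¬ q ∣ D * a := fun h' => hqD (haq.symm.dvd_of_dvd_mul_right h')
      rw [if_neg hqD]
      have h1 := norm_sum_dvd_le (N := N) (b := b) (α := α) hD hcop
      have h2 := half_inv_le_abs_sub_round (D := D) hq hQ hαq (by omega) hqDa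
      have h3 : 0 < |((D * a : ℕ) : ℝ) / q - round (((D * a : ℕ) : ℝ) / q)| :=
        lt_of_lt_of_le (by positivity) (inv_abs_sub_round_le hq hqDa).2
      have h4 : ‖P D‖ ≤ g D := by
        simp only [hg, if_neg hqD]
        rw [← one_div, le_div_iff₀ h3]
        refine le_trans ?_ h1
        gcongr
        linarith
      simp only [Complex.ofReal_zero, zero_mul, mul_zero, sub_zero, norm_mul]
      have : ‖((w d₁ * w d₂ : ℝ) : ℂ)‖ * ‖P D‖ ≤ Λ ^ 2 * g D := by gcongr
      linarith
  have hexp : ∑ m ∈ range N, ((sieveSum R (selY z) (W * m + b) ^ 2 : ℝ) : ℂ) * e (m * α) =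
      ∑ d₁ ∈ Icc 1 R, ∑ d₂ ∈ Icc 1 R, ((w d₁ * w d₂ : ℝ) : ℂ) * P (Nat.lcm d₁ d₂) := by
    have h1 : ∀ m : ℕ, ((sieveSum R (selY z) (W * m + b) ^ 2 : ℝ) : ℂ) * e (m * α) =
        ∑ d₁ ∈ Icc 1 R, ∑ d₂ ∈ Icc 1 R, ((w d₁ * w d₂ : ℝ) : ℂ) *
          (if Nat.lcm d₁ d₂ ∣ W * m + b then e (m * α) else 0) := by
      intro m
      rw [sq, sieveSum, sum_mul_sum]
      push_cast
      simp_rw [sum_mul]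
      refine sum_congr rfl fun d₁ _ => sum_congr rfl fun d₂ _ => ?_
      simp only [Nat.lcm_dvd_iff]
      by_cases a1 : d₁ ∣ W * m + b <;> by_cases a2 : d₂ ∣ W * m + b <;> simp [a1, a2, hw]
    simp_rw [h1]
    rw [sum_comm]
    refine sum_congr rfl fun d₁ _ => ?_
    rw [sum_comm]
    refine sum_congr rfl fun d₂ _ => ?_
    rw [hP, mul_sum]
  have hmain : ∑ d₁ ∈ Icc 1 R, ∑ d₂ ∈ Icc 1 R, ζ * (((if q ∣ Nat.lcm d₁ d₂ then
        w d₁ * w d₂ / (Nat.lcm d₁ d₂ : ℕ) else 0 : ℝ) : ℂ) * V) =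
      ζ * (((sieveForm R q (selY z) (selY z) : ℝ) : ℂ) * V) := by
    rw [sieveForm]
    push_cast
    simp_rw [← mul_sum, ← sum_mul]
    rfl
  have hgsum : ∑ d₁ ∈ Icc 1 R, ∑ d₂ ∈ Icc 1 R, g (Nat.lcm d₁ d₂) ≤
      T * ((R ^ 2 + Q) * (2 * (1 + Real.log Q))) := by
    rw [← sum_product' (f := fun d₁ d₂ => g (Nat.lcm d₁ d₂))]
    rw [← sum_fiberwise_of_maps_to (t := Icc 1 (R ^ 2)) (g := fun x : ℕ × ℕ => Nat.lcm x.1 x.2)]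
    swap
    · rintro ⟨d₁, d₂⟩ h
      simp only [mem_product, mem_Icc] at h ⊢
      refine ⟨Nat.lcm_pos h.1.1 h.2.1, ?_⟩
      refine (Nat.le_of_dvd (Nat.mul_pos h.1.1 h.2.1) (Nat.lcm_dvd_mul d₁ d₂)).trans ?_
      rw [sq]; exact Nat.mul_le_mul h.1.2 h.2.2
    calc _ ≤ ∑ D ∈ Icc 1 (R ^ 2), T * g D := by
          refine sum_le_sum fun D hD => ?_
          have h1 : ∀ x ∈ ({x ∈ Icc 1 R ×ˢ Icc 1 R | Nat.lcm x.1 x.2 = D} : Finset (ℕ × ℕ)),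
              g (Nat.lcm x.1 x.2) = g D := fun x hx => by rw [(mem_filter.mp hx).2]
          rw [sum_congr rfl h1, sum_const, nsmul_eq_mul]
          refine mul_le_mul_of_nonneg_right (le_trans ?_ (hT D hD)) (hg0 D)
          exact_mod_cast card_lcm_fiber_le (mem_Icc.mp hD).1
      _ ≤ T * (((R ^ 2 : ℕ) + q) * (2 * (1 + Real.log q))) := by
          rw [← mul_sum]
          gcongr
          exact sum_inv_abs_sub_round_le hq haq _
      _ ≤ _ := by
          have h1 : (q : ℝ) ≤ Q := by exact_mod_cast hqQ
          have h2 := Real.log_natCast_nonneg q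
          push_cast
          gcongr
  have hfirst : ‖∑ d₁ ∈ Icc 1 R, ∑ d₂ ∈ Icc 1 R, ((w d₁ * w d₂ : ℝ) : ℂ) * P (Nat.lcm d₁ d₂) -
      ζ * (((sieveForm R q (selY z) (selY z) : ℝ) : ℂ) * V)‖ ≤
      (R : ℝ) ^ 2 * (Λ ^ 2 * (1 + 13 * (N / Q))) +
        Λ ^ 2 * (T * ((R ^ 2 + Q) * (2 * (1 + Real.log Q)))) := by
    rw [← hmain]
    simp_rw [← sum_sub_distrib]
    calc _ ≤ ∑ d₁ ∈ Icc 1 R, ∑ d₂ ∈ Icc 1 R,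
          (Λ ^ 2 * (1 + 13 * ((N : ℝ) / Q)) + Λ ^ 2 * g (Nat.lcm d₁ d₂)) :=
          (norm_sum_le _ _).trans (sum_le_sum fun d₁ h₁ => (norm_sum_le _ _).trans
            (sum_le_sum fun d₂ h₂ => hpair d₁ h₁ d₂ h₂))
      _ = (R : ℝ) ^ 2 * (Λ ^ 2 * (1 + 13 * ((N : ℝ) / Q))) +
          Λ ^ 2 * ∑ d₁ ∈ Icc 1 R, ∑ d₂ ∈ Icc 1 R, g (Nat.lcm d₁ d₂) := by
          simp_rw [sum_add_distrib, ← mul_sum]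
          simp only [sum_const, Nat.card_Icc, nsmul_eq_mul, Nat.add_sub_cancel]
          ring
      _ ≤ _ := by gcongr
  have hsecond : ‖ζ * (((sieveForm R q (selY z) (selY z) : ℝ) : ℂ) * V) -
      selG z R * ∑ m ∈ range N, e (m * α)‖ ≤ 3 * selG z R / z * N + selG z R * Q := by
    rcases Nat.lt_or_ge 1 q with hq2 | hq2
    · refine (norm_sub_le _ _).trans (add_le_add ?_ ?_)
      · rw [norm_mul, hζ, norm_e, one_mul, norm_mul, Complex.norm_real, Real.norm_eq_abs]
        exact mul_le_mul (abs_sieveForm_selY_le hz hq2) (norm_sum_e_le N β) (norm_nonneg _)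
          (by positivity)
      · rw [norm_mul, Complex.norm_real, Real.norm_eq_abs, abs_of_nonneg hG]
        refine mul_le_mul_of_nonneg_left ?_ hG
        by_cases hQ2 : Q < 2
        · omega
        have hqa : ¬ q ∣ 1 * a := fun h => by
          rw [one_mul] at h
          exact absurd (Nat.Coprime.eq_one_of_dvd haq.symm h) (by omega)
        have h1 := half_inv_le_abs_sub_round (D := 1) hq hQ hαq (by omega) hqa
        have h2 := (inv_abs_sub_round_le hq hqa).2
        rw [Nat.cast_one, one_mul α] at h1
        have h3 := norm_sum_e_mul_le N 0 α
        simp only [zero_add] at h3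
        have h4 : 1 / (q : ℝ) ≤ 2 * |α - round α| := by linarith
        have h5 : ‖∑ m ∈ range N, e (m * α)‖ * (1 / q) ≤ 1 :=
          (mul_le_mul_of_nonneg_left h4 (norm_nonneg _)).trans h3
        rw [mul_one_div, div_le_one hq'] at h5
        exact h5.trans (by exact_mod_cast hqQ)
    · obtain rfl : q = 1 := by omega
      have h1 : ζ = 1 := by rw [hζ, Nat.cast_one, div_one, e_natCast]
      have h2 : V = ∑ m ∈ range N, e (m * α) := by
        refine sum_congr rfl fun m _ => ?_
        have h3 : (m : ℝ) * α = (m * a : ℕ) + m * β := by rw [hβ]; push_cast; ring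
        rw [h3, e_add, e_natCast, one_mul]
      rw [h1, h2, sieveForm_selY_one, one_mul, sub_self, norm_zero]
      positivity
  rw [hexp]
  calc _ ≤ _ := norm_sub_le_norm_sub_add_norm_sub _
        (ζ * (((sieveForm R q (selY z) (selY z) : ℝ) : ℂ) * V)) _
    _ ≤ _ := add_le_add hfirst hsecond
    _ = _ := by ring

end

lemma error_terms_le {t C D : ℝ} {R Q N : ℝ} (ht : 1 ≤ t) (hC : 1 ≤ C) (hD : 1 ≤ D)
    (hR : R ^ 2 ≤ t ^ 360) (hQ : t ^ 380 ≤ Q) (hQ' : Q ≤ 2 * t ^ 380) (hN : N = t ^ 400)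
    (hlog : 1 + Real.log Q ≤ t) (hlog0 : 0 ≤ Real.log Q)
    (hbig : 2 + 14 * C ^ 2 + 6 * C ^ 2 * D ^ 2 ≤ t) :
    Q + (R ^ 2 * ((C * t) ^ 2 * (1 + 13 * (N / Q))) +
      (C * t) ^ 2 * ((D * t) ^ 2 * ((R ^ 2 + Q) * (2 * (1 + Real.log Q))))) ≤ t ^ 392 := by
  have ht0 : 0 < t := by linarith
  have hQ0 : 0 < Q := lt_of_lt_of_le (by positivity) hQ
  have hNQ : N / Q ≤ t ^ 20 := by
    rw [div_le_iff₀ hQ0, hN]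
    calc t ^ 400 = t ^ 20 * t ^ 380 := by ring
      _ ≤ _ := by gcongr
  have hN0 : 0 ≤ N / Q := by rw [hN]; positivity
  have h1 : (1 : ℝ) ≤ t ^ 20 := one_le_pow₀ ht
  have hp : ∀ a b : ℕ, a ≤ b → t ^ a ≤ t ^ b := fun a b h => pow_le_pow_right₀ ht h
  calc Q + (R ^ 2 * ((C * t) ^ 2 * (1 + 13 * (N / Q))) +
      (C * t) ^ 2 * ((D * t) ^ 2 * ((R ^ 2 + Q) * (2 * (1 + Real.log Q)))))
      ≤ 2 * t ^ 380 + (t ^ 360 * ((C * t) ^ 2 * (t ^ 20 + 13 * t ^ 20)) +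
      (C * t) ^ 2 * ((D * t) ^ 2 * ((t ^ 380 + 2 * t ^ 380) * (2 * t)))) := by
        have : R ^ 2 ≤ t ^ 380 := hR.trans (hp _ _ (by norm_num))
        gcongr
    _ = 2 * t ^ 380 + 14 * C ^ 2 * t ^ 382 + 6 * C ^ 2 * D ^ 2 * t ^ 385 := by ring
    _ ≤ 2 * t ^ 385 + 14 * C ^ 2 * t ^ 385 + 6 * C ^ 2 * D ^ 2 * t ^ 385 := by
        have h2 := hp 380 385 (by norm_num)
        have h3 := mul_le_mul_of_nonneg_left (hp 382 385 (by norm_num))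
          (by positivity : 0 ≤ 14 * C ^ 2)
        linarith
    _ = (2 + 14 * C ^ 2 + 6 * C ^ 2 * D ^ 2) * t ^ 385 := by ring
    _ ≤ t * t ^ 385 := by gcongr
    _ = t ^ 386 := by ring
    _ ≤ _ := hp _ _ (by norm_num)

lemma primeWeight_le_log {W b N m : ℕ} (hW : 0 < W) (hbW : b < W) (hm : m < N) (R : ℕ) :
    primeWeight W b R m ≤ (W.totient : ℝ) / W * Real.log (W * N) := by
  have hφ : (0 : ℝ) ≤ (W.totient : ℝ) / W := by positivity
  have hlt : W * m + b ≤ W * N := by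
    have : W * (m + 1) ≤ W * N := Nat.mul_le_mul_left _ hm
    lia
  have h1 : (1 : ℝ) ≤ W * N := by
    exact_mod_cast Nat.one_le_iff_ne_zero.mpr (Nat.mul_ne_zero hW.ne' (by lia))
  rw [primeWeight]
  split_ifs with h
  · have h0 : (0 : ℝ) < (W * m + b : ℕ) := by exact_mod_cast h.1.pos
    gcongr
    exact_mod_cast hlt
  · exact mul_nonneg hφ (Real.log_nonneg h1)

/-- A Selberg-type majorant for the primes in a residue class, whose Fourier transform is
uniformly close to that of the constant function. -/
theorem exists_majorant {W b : ℕ} (hW : 0 < W) (hbW : b < W) :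
    ∃ N₀ : ℕ, ∀ N ≥ N₀, ∃ R : ℕ, R ^ 2 ≤ N ∧ ∀ z : ℕ, 0 < z → z ^ 50 ≤ N →
      (∀ p, p.Prime → p ∣ W → p ≤ z) → ∃ ν : ℕ → ℝ, (∀ m, 0 ≤ ν m) ∧
      (∀ m < N, primeWeight W b R m ≤
        (9 / 4 * ((W.totient : ℝ) / W) * mertensProd z) * ν m) ∧
      ∀ α : ℝ, 0 ≤ α → ‖∑ m ∈ range N, (ν m : ℂ) * e (m * α) - ∑ m ∈ range N, e (m * α)‖ ≤
        4 / z * N := by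
  obtain ⟨C, hC1, hC⟩ := exists_abs_sieveWeight_le (δ := 1 / 400) (by norm_num)
  obtain ⟨D, hD1, hD⟩ := exists_card_divisors_le (δ := 1 / 400) (by norm_num)
  have htend : Filter.Tendsto (fun N : ℕ => (N : ℝ) ^ (1 / 400 : ℝ)) Filter.atTop Filter.atTop :=
    (tendsto_rpow_atTop (by norm_num)).comp tendsto_natCast_atTop_atTop
  have hlogt : Filter.Tendsto (fun N : ℕ => Real.log N) Filter.atTop Filter.atTop :=
    Real.tendsto_log_atTop.comp tendsto_natCast_atTop_atTop
  have hlo : ∀ᶠ N : ℕ in Filter.atTop, ‖Real.log N‖ ≤ 1 / 2 * ‖(N : ℝ) ^ (1 / 400 : ℝ)‖ :=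
    tendsto_natCast_atTop_atTop.eventually
      ((isLittleO_log_rpow_atTop (by norm_num)).bound (by norm_num : (0 : ℝ) < 1 / 2))
  obtain ⟨N₀, hN₀⟩ := Filter.eventually_atTop.mp (((htend.eventually_ge_atTop
    (2 + 14 * C ^ 2 + 6 * C ^ 2 * D ^ 2)).and hlo).and ((hlogt.eventually_ge_atTop
    (80 * (Real.log W + 9 / 4 * Real.log 2))).and (Filter.eventually_ge_atTop 1)))
  refine ⟨N₀, fun N hN => ?_⟩
  obtain ⟨⟨hbig, hlo⟩, hWN, hN1⟩ := hN₀ N hN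
  set t := (N : ℝ) ^ (1 / 400 : ℝ) with ht
  have hN0 : (0 : ℝ) < N := by exact_mod_cast hN1
  have ht2 : 2 ≤ t := by nlinarith [sq_nonneg C, sq_nonneg (C * D)]
  have ht0 : 0 < t := by linarith
  have hNt : (N : ℝ) = t ^ 400 := by
    rw [ht, ← Real.rpow_natCast, ← Real.rpow_mul hN0.le]; norm_num
  have hlogN : Real.log N = 400 * Real.log t := by rw [hNt, Real.log_pow]; norm_num
  have hp : ∀ a b : ℕ, a ≤ b → t ^ a ≤ t ^ b := fun a b h =>
    pow_le_pow_right₀ (by linarith) h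
  have hp1 : ∀ a : ℕ, 1 ≤ t ^ a := fun a => one_le_pow₀ (by linarith)
  set R := ⌊t ^ 180⌋₊ with hR
  set Q := ⌈t ^ 380⌉₊ with hQ
  have hRt : (R : ℝ) ≤ t ^ 180 := Nat.floor_le (by positivity)
  have hR1 : 1 ≤ R := Nat.le_floor (by exact_mod_cast hp1 180)
  have hRhalf : t ^ 180 ≤ 2 * R := by
    have h1 := Nat.lt_floor_add_one (t ^ 180)
    have h2 : (1 : ℝ) ≤ R := by exact_mod_cast hR1
    rw [← hR] at h1; linarith
  have hR2t : (R : ℝ) ^ 2 ≤ t ^ 360 := by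
    calc (R : ℝ) ^ 2 ≤ (t ^ 180) ^ 2 := by gcongr
      _ = _ := by ring
  have hQt : t ^ 380 ≤ Q := Nat.le_ceil _
  have hQt' : (Q : ℝ) ≤ 2 * t ^ 380 := by
    have h1 := Nat.ceil_lt_add_one (by positivity : 0 ≤ t ^ 380)
    have := hp1 380
    rw [← hQ] at h1; linarith
  have hR2N : R ^ 2 ≤ N := by
    have : (R : ℝ) ^ 2 ≤ N := by rw [hNt]; exact hR2t.trans (hp _ _ (by norm_num))
    exact_mod_cast this
  have hRQ : 2 * R ^ 2 ≤ Q := by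
    have : 2 * (R : ℝ) ^ 2 ≤ Q := by
      refine le_trans ?_ hQt
      calc 2 * (R : ℝ) ^ 2 ≤ t * t ^ 360 := by gcongr
        _ = t ^ 361 := by ring
        _ ≤ _ := hp _ _ (by norm_num)
    exact_mod_cast this
  have hQ1 : 1 ≤ Q := by nlinarith
  have hQN : (Q : ℝ) ≤ N := by
    rw [hNt]
    calc (Q : ℝ) ≤ t * t ^ 380 := hQt'.trans (by gcongr)
      _ = t ^ 381 := by ring
      _ ≤ _ := hp _ _ (by norm_num)
  have hlogQ0 : 0 ≤ Real.log Q := Real.log_nonneg (by exact_mod_cast hQ1)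
  have hlogQ : 1 + Real.log Q ≤ t := by
    have h1 : Real.log Q ≤ Real.log N := Real.log_le_log (by exact_mod_cast hQ1) hQN
    rw [Real.norm_eq_abs, Real.norm_of_nonneg ht0.le] at hlo
    have := (le_abs_self _).trans hlo
    linarith
  have hRδ : (R : ℝ) ^ (1 / 400 : ℝ) ≤ t :=
    Real.rpow_le_rpow (by positivity) (by
      rw [hNt]; exact hRt.trans (hp _ _ (by norm_num))) (by norm_num)
  refine ⟨R, hR2N, fun z hz hzN hWz => ?_⟩
  have hz0 : (0 : ℝ) < z := by exact_mod_cast hz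
  have hG := one_le_selG (z := z) hR1
  have hG0 : 0 < selG z R := by linarith
  refine ⟨fun m => sieveSum R (selY z) (W * m + b) ^ 2 / selG z R,
    fun m => by positivity, fun m hm => ?_, fun α hα => ?_⟩
  · by_cases hne : W * m + b > R ∧ (W * m + b).Prime
    · beta_reduce
      have hs : sieveSum R (selY z) (W * m + b) = selG z R := sieveSum_of_prime _ hR1 hne.2 hne.1
      rw [hs]
      have hlog : Real.log (W * N) ≤ 9 / 4 * Real.log R := by
        have h1 : Real.log (t ^ 180) ≤ Real.log (2 * R) :=
          Real.log_le_log (by positivity) hRhalf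
        rw [Real.log_pow, Real.log_mul (by norm_num) (by positivity)] at h1
        rw [Real.log_mul (by positivity) (by positivity)]
        push_cast at h1
        linarith
      calc primeWeight W b R m ≤ (W.totient : ℝ) / W * Real.log (W * N) :=
            primeWeight_le_log hW hbW hm R
        _ ≤ (W.totient : ℝ) / W * (9 / 4 * (mertensProd z * selG z R)) := by
            gcongr
            exact hlog.trans (by gcongr; exact log_le_mertensProd_mul_selG z R)
        _ = _ := by field_simp
    · have : primeWeight W b R m = 0 := by
        rw [primeWeight, if_neg (fun h => hne ⟨h.2, h.1⟩)]
      rw [this]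
      have := (mertensProd_pos z).le
      positivity
  · have hΛ : ∀ d ∈ Icc 1 R, |sieveWeight R (selY z) d| ≤ C * t := fun d hd =>
      (hC z R d (mem_Icc.mp hd).1).trans (by gcongr)
    have hT : ∀ d ∈ Icc 1 (R ^ 2), (#d.divisors : ℝ) ^ 2 ≤ (D * t) ^ 2 := fun d hd => by
      have hd := mem_Icc.mp hd
      refine pow_le_pow_left₀ (Nat.cast_nonneg _) ((hD d hd.1).trans ?_) 2
      refine mul_le_mul_of_nonneg_left ?_ (by positivity)
      exact Real.rpow_le_rpow (by positivity) (by exact_mod_cast hd.2.trans hR2N) (by norm_num)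
    have key := norm_sum_sieveSum_sq_sub_le (W := W) (b := b) hWz hz hQ1 hRQ hR2N hΛ hT hα
      (by positivity) (by positivity)
    have herr := error_terms_le (R := R) (Q := Q) (N := N) (t := t) (C := C) (D := D)
      (by linarith) hC1 hD1 hR2t hQt hQt' hNt hlogQ hlogQ0 hbig
    have hzt : (z : ℝ) ≤ t ^ 8 := by
      refine le_of_pow_le_pow_left₀ (n := 50) (by norm_num) (by positivity) ?_
      calc (z : ℝ) ^ 50 ≤ N := by exact_mod_cast hzN
        _ = _ := by rw [hNt]; ring
    have h392 : t ^ 392 ≤ 1 / z * N := by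
      rw [hNt, div_mul_eq_mul_div, one_mul, le_div_iff₀ hz0]
      calc t ^ 392 * z ≤ t ^ 392 * t ^ 8 := by gcongr
        _ = _ := by ring
    have heq : ∑ m ∈ range N, (((sieveSum R (selY z) (W * m + b) ^ 2 / selG z R : ℝ)) : ℂ) *
          e (m * α) - ∑ m ∈ range N, e (m * α) =
        ((selG z R : ℝ) : ℂ)⁻¹ * (∑ m ∈ range N, ((sieveSum R (selY z) (W * m + b) ^ 2 : ℝ) : ℂ) *
          e (m * α) - selG z R * ∑ m ∈ range N, e (m * α)) := by
      have : ((selG z R : ℝ) : ℂ) ≠ 0 := by exact_mod_cast hG0.ne'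
      rw [mul_sub, ← mul_assoc, inv_mul_cancel₀ this, one_mul, mul_sum]
      congr 1
      refine sum_congr rfl fun m _ => ?_
      push_cast
      field_simp
    rw [heq, norm_mul, norm_inv, Complex.norm_real, Real.norm_of_nonneg hG0.le, inv_mul_le_iff₀ hG0]
    refine key.trans ?_
    have hA : ∀ A B : ℝ, 0 ≤ B → A + B ≤ 1 / z * N → selG z R * A + B ≤ selG z R * (1 / z * N) :=
      fun A B hB h => by nlinarith
    have hB := hA Q _ (by positivity) (herr.trans h392)
    calc _ = 3 * selG z R / z * N +
          (selG z R * Q + ((R : ℝ) ^ 2 * ((C * t) ^ 2 * (1 + 13 * (N / Q))) +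
      (C * t) ^ 2 * ((D * t) ^ 2 * ((R ^ 2 + Q) * (2 * (1 + Real.log Q)))))) := by ring
      _ ≤ 3 * selG z R / z * N + selG z R * (1 / z * N) := by gcongr
      _ = _ := by ring

/-- The exponential sum `∑_{m < N} f(m) e(mθ)`. -/
noncomputable def expSum (f : ℕ → ℝ) (N : ℕ) (θ : ℝ) : ℂ := ∑ m ∈ range N, (f m : ℂ) * e (m * θ)

lemma conj_e (x : ℝ) : (starRingEnd ℂ) (e x) = e (-x) := by
  rw [e, e, ← Complex.exp_conj]
  congr 1
  simp [map_ofNat]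

lemma sum_e_div_eq_zero {M : ℕ} {n : ℤ} (hn : ¬ (M : ℤ) ∣ n) :
    ∑ m ∈ range M, e (m * ((n : ℝ) / M)) = 0 := by
  rcases Nat.eq_zero_or_pos M with rfl | hM
  · simp
  have hM0 : (M : ℝ) ≠ 0 := by positivity
  have h1 : e ((n : ℝ) / M) ≠ 1 := by
    intro h
    have := four_mul_abs_sub_round_le ((n : ℝ) / M)
    rw [h, sub_self, norm_zero] at this
    have h0 : (n : ℝ) / M = round ((n : ℝ) / M) := by
      have := abs_nonpos_iff.mp (by linarith : |(n : ℝ) / M - round ((n : ℝ) / M)| ≤ 0)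
      linarith
    rw [div_eq_iff hM0] at h0
    exact hn ⟨round ((n : ℝ) / M), by rw [mul_comm]; exact_mod_cast h0⟩
  have hMe : e ((n : ℝ) / M) ^ M = 1 := by
    rw [← e_nat_mul, mul_div_cancel₀ _ hM0]
    exact e_intCast n
  simp_rw [e_nat_mul]
  rw [geom_sum_eq h1, hMe, sub_self, zero_div]

lemma norm_sum_mul_e_sq (T : Finset ℕ) (c : ℕ → ℂ) {M : ℕ} (hM : 0 < M) (m : ℕ) :
    ((‖∑ k ∈ T, c k * e (m * ((k : ℝ) / M))‖ ^ 2 : ℝ) : ℂ) =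
      ∑ k ∈ T, ∑ l ∈ T, c k * (starRingEnd ℂ) (c l) * e (m * (((k : ℝ) + M - l) / M)) := by
  rw [Complex.ofReal_pow, ← Complex.mul_conj', map_sum, sum_mul_sum]
  refine sum_congr rfl fun k _ => sum_congr rfl fun l _ => ?_
  have hM0 : (M : ℝ) ≠ 0 := by positivity
  have h : (m : ℝ) * (((k : ℝ) + M - l) / M) = (m * (k / M)) + ((m : ℕ) + (-(m * (l / M)))) := by
    field_simp
    ring
  rw [h, e_add, e_add, e_natCast, one_mul, ← conj_e, map_mul]
  ring

lemma parseval {M : ℕ} (hM : 0 < M) {T : Finset ℕ} (hT : T ⊆ range M) (c : ℕ → ℂ) :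
    ∑ m ∈ range M, ‖∑ k ∈ T, c k * e (m * ((k : ℝ) / M))‖ ^ 2 = M * ∑ k ∈ T, ‖c k‖ ^ 2 := by
  have hM0 : (M : ℝ) ≠ 0 := by positivity
  apply Complex.ofReal_injective
  rw [Complex.ofReal_sum]
  simp_rw [norm_sum_mul_e_sq T c hM]
  rw [sum_comm, Complex.ofReal_mul, Complex.ofReal_sum, mul_sum]
  refine sum_congr rfl fun k hk => ?_
  rw [sum_comm, sum_eq_single_of_mem k hk]
  · rw [← mul_sum, Complex.mul_conj']
    have : ∀ m ∈ range M, e ((m : ℝ) * (((k : ℝ) + M - k) / M)) = 1 := fun m _ => by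
      rw [add_sub_cancel_left, div_self hM0, mul_one, e_natCast]
    rw [sum_congr rfl this]
    simp [mul_comm]
  · intro l hl hlk
    rw [← mul_sum]
    have := sum_e_div_eq_zero (M := M) (n := (k : ℤ) + M - l) (by
      have hk' := mem_range.mp (hT hk)
      have hl' := mem_range.mp (hT hl)
      rintro ⟨q, hq⟩
      have : (M : ℤ) * (q - 1) = k - l := by linarith
      have h1 : (M : ℤ) ∣ (k : ℤ) - l := ⟨_, this.symm⟩
      have h2 := Int.eq_zero_of_abs_lt_dvd h1 (by rw [abs_lt]; constructor <;> lia)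
      exact hlk (by lia))
    push_cast at this
    rw [this, mul_zero]

/-- A large-sieve type inequality for a weight with Fourier transform close to that of `1`. -/
lemma sum_mul_norm_sq_le {M N : ℕ} (hM : 0 < M) (hNM : N ≤ M) {T : Finset ℕ} (hT : T ⊆ range M)
    (c : ℕ → ℂ) {ν : ℕ → ℝ} {D : ℝ}
    (hν : ∀ α : ℝ, 0 ≤ α → ‖expSum ν N α - ∑ m ∈ range N, e (m * α)‖ ≤ D) :
    ∑ m ∈ range N, ν m * ‖∑ k ∈ T, c k * e (m * ((k : ℝ) / M))‖ ^ 2 ≤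
      M * ∑ k ∈ T, ‖c k‖ ^ 2 + D * (∑ k ∈ T, ‖c k‖) ^ 2 := by
  set H : ℕ → ℂ := fun m => ∑ k ∈ T, c k * e (m * ((k : ℝ) / M)) with hH
  have h1 : ∑ m ∈ range N, ‖H m‖ ^ 2 ≤ M * ∑ k ∈ T, ‖c k‖ ^ 2 := by
    rw [← parseval hM hT c]
    exact sum_le_sum_of_subset_of_nonneg (range_subset_range.mpr hNM) fun _ _ _ => by positivity
  have h2 : ((∑ m ∈ range N, (ν m - 1) * ‖H m‖ ^ 2 : ℝ) : ℂ) =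
      ∑ k ∈ T, ∑ l ∈ T, c k * (starRingEnd ℂ) (c l) * (expSum ν N (((k : ℝ) + M - l) / M) -
        ∑ m ∈ range N, e (m * (((k : ℝ) + M - l) / M))) := by
    rw [Complex.ofReal_sum]
    simp_rw [Complex.ofReal_mul, hH, norm_sum_mul_e_sq T c hM, expSum, ← sum_sub_distrib, mul_sum]
    rw [sum_comm]
    refine sum_congr rfl fun k _ => ?_
    rw [sum_comm]
    refine sum_congr rfl fun l _ => sum_congr rfl fun m _ => ?_
    push_cast
    ring
  have h3 : ∑ m ∈ range N, (ν m - 1) * ‖H m‖ ^ 2 ≤ D * (∑ k ∈ T, ‖c k‖) ^ 2 := by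
    refine (le_abs_self _).trans ?_
    rw [← Real.norm_eq_abs, ← Complex.norm_real, h2, sq, sum_mul_sum, mul_sum]
    refine norm_sum_le_of_le _ fun k hk => ?_
    rw [mul_sum]
    refine norm_sum_le_of_le _ fun l hl => ?_
    rw [norm_mul, norm_mul, RCLike.norm_conj, mul_comm]
    have hl' : (l : ℝ) ≤ M := by exact_mod_cast (mem_range.mp (hT hl)).le
    gcongr
    exact hν _ (div_nonneg (by have : (0 : ℝ) ≤ k := Nat.cast_nonneg k
                               linarith) (by positivity))
  calc ∑ m ∈ range N, ν m * ‖H m‖ ^ 2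
      = ∑ m ∈ range N, ‖H m‖ ^ 2 + ∑ m ∈ range N, (ν m - 1) * ‖H m‖ ^ 2 := by
        rw [← sum_add_distrib]; exact sum_congr rfl fun _ _ => by ring
    _ ≤ _ := add_le_add h1 h3

section
variable {M N : ℕ} {T : Finset ℕ} {f ν : ℕ → ℝ}

lemma expSum_sub (f g : ℕ → ℝ) (N : ℕ) (θ : ℝ) :
    expSum (fun m => f m - g m) N θ = expSum f N θ - expSum g N θ := by
  simp [expSum, sub_mul, sum_sub_distrib]

lemma norm_expSum_le (hf : ∀ m, 0 ≤ f m) (N : ℕ) (θ : ℝ) :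
    ‖expSum f N θ‖ ≤ ∑ m ∈ range N, f m := by
  refine norm_sum_le_of_le _ fun m _ => ?_
  rw [norm_mul, norm_e, mul_one, Complex.norm_real, Real.norm_of_nonneg (hf m)]

lemma sum_le_of_norm_expSum_sub_le {D : ℝ}
    (hν : ∀ α : ℝ, 0 ≤ α → ‖expSum ν N α - ∑ m ∈ range N, e (m * α)‖ ≤ D) :
    ∑ m ∈ range N, ν m ≤ N + D := by
  have h := hν 0 le_rfl
  simp only [expSum, mul_zero, e_zero, mul_one, sum_const, card_range, nsmul_eq_mul] at h
  have h2 : ((∑ m ∈ range N, ν m - N : ℝ) : ℂ) = ∑ m ∈ range N, (ν m : ℂ) - N := by push_cast; rfl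
  rw [← h2, Complex.norm_real] at h
  have := (le_abs_self _).trans h
  linarith

/-- Duality: exponential sums of functions controlled by a pseudorandom weight satisfy an
`ℓ²` restriction estimate. -/
lemma norm_sum_mul_expSum_sq_le (hM : 0 < M) (hNM : N ≤ M) (hT : T ⊆ range M) (c : ℕ → ℂ)
    {D : ℝ} (hν : ∀ α : ℝ, 0 ≤ α → ‖expSum ν N α - ∑ m ∈ range N, e (m * α)‖ ≤ D)
    (hν0 : ∀ m, 0 ≤ ν m) {g A : ℕ → ℝ} (hA : ∀ m ∈ range N, 0 ≤ A m)
    (hg : ∀ m ∈ range N, g m ^ 2 ≤ A m * ν m) :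
    ‖∑ k ∈ T, c k * expSum g N ((k : ℝ) / M)‖ ^ 2 ≤
      (∑ m ∈ range N, A m) * (M * ∑ k ∈ T, ‖c k‖ ^ 2 + D * (∑ k ∈ T, ‖c k‖) ^ 2) := by
  set H : ℕ → ℂ := fun m => ∑ k ∈ T, c k * e (m * ((k : ℝ) / M)) with hH
  have h1 : ∑ k ∈ T, c k * expSum g N ((k : ℝ) / M) = ∑ m ∈ range N, (g m : ℂ) * H m := by
    simp_rw [expSum, hH, mul_sum]
    rw [sum_comm]
    exact sum_congr rfl fun m _ => sum_congr rfl fun k _ => by ring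
  have h2 : ‖∑ m ∈ range N, (g m : ℂ) * H m‖ ≤ ∑ m ∈ range N, |g m| * ‖H m‖ :=
    norm_sum_le_of_le _ fun m _ => by rw [norm_mul, Complex.norm_real, Real.norm_eq_abs]
  have h3 : (∑ m ∈ range N, |g m| * ‖H m‖) ^ 2 ≤
      (∑ m ∈ range N, A m) * ∑ m ∈ range N, ν m * ‖H m‖ ^ 2 := by
    refine sum_sq_le_sum_mul_sum_of_sq_le_mul _ hA (fun m _ => ?_) fun m hm => ?_
    · have := hν0 m; positivity
    · rw [mul_pow, sq_abs, ← mul_assoc]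
      exact mul_le_mul_of_nonneg_right (hg m hm) (by positivity)
  rw [h1]
  refine (pow_le_pow_left₀ (norm_nonneg _) h2 2).trans (h3.trans ?_)
  exact mul_le_mul_of_nonneg_left (sum_mul_norm_sq_le hM hNM hT c hν) (sum_nonneg hA)

lemma sum_norm_le_div {F : ℕ → ℂ} {t : ℝ} (ht : 0 < t) (hF : ∀ k ∈ T, t ≤ ‖F k‖) :
    ∑ k ∈ T, ‖F k‖ ≤ (∑ k ∈ T, ‖F k‖ ^ 2) / t := by
  rw [sum_div]
  refine sum_le_sum fun k hk => ?_
  rw [le_div_iff₀ ht, sq]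
  exact mul_le_mul_of_nonneg_left (hF k hk) (norm_nonneg _)

lemma sum_conj_mul_self (F : ℕ → ℂ) :
    ∑ k ∈ T, (starRingEnd ℂ) (F k) * F k = ((∑ k ∈ T, ‖F k‖ ^ 2 : ℝ) : ℂ) := by
  push_cast
  exact sum_congr rfl fun k _ => by rw [Complex.conj_mul']

/-- Large values of the Fourier transform of a function below a multiple of a pseudorandom weight:
crude form. -/
lemma sum_norm_expSum_sq_le (hM : 0 < M) (hN : 0 < N) (hNM : N ≤ M) (hT : T ⊆ range M)
    {C ε τ : ℝ} (hC : 0 ≤ C) (hτ : 0 < τ) (hε : 0 ≤ ε) (hCε : 4 * C * ε ≤ τ ^ 2)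
    (hf0 : ∀ m, 0 ≤ f m) (hfN : ∑ m ∈ range N, f m ≤ 2 * N) (hν0 : ∀ m, 0 ≤ ν m)
    (hfν : ∀ m < N, f m ≤ C * ν m)
    (hν : ∀ α : ℝ, 0 ≤ α → ‖expSum ν N α - ∑ m ∈ range N, e (m * α)‖ ≤ ε * N)
    (hF : ∀ k ∈ T, τ * N ≤ ‖expSum f N ((k : ℝ) / M)‖) :
    ∑ k ∈ T, ‖expSum f N ((k : ℝ) / M)‖ ^ 2 ≤ 4 * C * N * M := by
  have hN0 : (0 : ℝ) < N := by exact_mod_cast hN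
  have hM0 : (0 : ℝ) < M := by exact_mod_cast hM
  set F : ℕ → ℂ := fun k => expSum f N ((k : ℝ) / M)
  set E := ∑ k ∈ T, ‖F k‖ ^ 2 with hE
  have hE0 : 0 ≤ E := sum_nonneg fun _ _ => by positivity
  have h := norm_sum_mul_expSum_sq_le hM hNM hT (fun k => (starRingEnd ℂ) (F k)) hν hν0
    (g := f) (A := fun m => C * f m) (fun m _ => mul_nonneg hC (hf0 m)) (fun m hm => by
      have := mul_le_mul_of_nonneg_left (hfν m (mem_range.mp hm)) (hf0 m)
      nlinarith)
  rw [sum_conj_mul_self F, Complex.norm_real, Real.norm_of_nonneg hE0, ← mul_sum] at h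
  simp only [RCLike.norm_conj] at h
  have hS := sum_norm_le_div (T := T) (mul_pos hτ hN0) hF
  have hS0 : 0 ≤ ∑ k ∈ T, ‖F k‖ := sum_nonneg fun _ _ => norm_nonneg _
  have h4 : E ^ 2 ≤ (C * (2 * N)) * (M * E + ε * N * (E / (τ * N)) ^ 2) := by
    refine h.trans ?_
    gcongr
  have h5 : (C * (2 * N)) * (M * E + ε * N * (E / (τ * N)) ^ 2) =
      2 * C * N * M * E + 4 * C * ε / τ ^ 2 * (E ^ 2 / 2) := by
    field_simp
    ring
  have h6 : 4 * C * ε / τ ^ 2 ≤ 1 := (div_le_one (by positivity)).mpr hCε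
  have h7 : 4 * C * ε / τ ^ 2 * (E ^ 2 / 2) ≤ 1 * (E ^ 2 / 2) := by gcongr
  have h8 : E * E ≤ (4 * C * N * M) * E := by nlinarith
  rcases hE0.eq_or_lt with h0 | h0
  · rw [← h0]; positivity
  · exact le_of_mul_le_mul_right h8 h0

lemma sub_sq_le {x y : ℝ} (hx : 0 ≤ x) (h : x ≤ 9 / 4 * y) :
    (x - y) ^ 2 ≤ (1 / 4 * x + y) * y := by
  nlinarith

lemma sum_quarter_add_le {ε : ℝ} (hfN : ∑ m ∈ range N, f m ≤ (1 + ε) * N)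
    (hν : ∀ α : ℝ, 0 ≤ α → ‖expSum ν N α - ∑ m ∈ range N, e (m * α)‖ ≤ ε * N) :
    ∑ m ∈ range N, (1 / 4 * f m + ν m) ≤ 5 / 4 * (1 + ε) * N := by
  have := sum_le_of_norm_expSum_sub_le hν
  rw [sum_add_distrib, ← mul_sum]
  linarith

/-- Large values of the Fourier transform of a function below a multiple of a pseudorandom weight:
sharp form, at frequencies where the transform of the weight is small. -/
lemma sum_norm_expSum_sq_le_sharp (hM : 0 < M) (hN : 0 < N) (hNM : N ≤ M) (hT : T ⊆ range M)
    {ε ε' τ : ℝ} (hτ : 0 < τ) (hτ1 : τ ≤ 1) (hε : 0 ≤ ε) (hετ : ε ≤ τ ^ 2 / 100)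
    (hετ' : ε' ≤ τ / 100)
    (hf0 : ∀ m, 0 ≤ f m) (hfN : ∑ m ∈ range N, f m ≤ (1 + ε) * N) (hν0 : ∀ m, 0 ≤ ν m)
    (hfν : ∀ m < N, f m ≤ 9 / 4 * ν m)
    (hν : ∀ α : ℝ, 0 ≤ α → ‖expSum ν N α - ∑ m ∈ range N, e (m * α)‖ ≤ ε * N)
    (hνT : ∀ k ∈ T, ‖expSum ν N ((k : ℝ) / M)‖ ≤ ε' * N)
    (hF : ∀ k ∈ T, τ * N ≤ ‖expSum f N ((k : ℝ) / M)‖) :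
    ∑ k ∈ T, ‖expSum f N ((k : ℝ) / M)‖ ^ 2 ≤ 3 / 2 * N * M := by
  have hN0 : (0 : ℝ) < N := by exact_mod_cast hN
  have hM0 : (0 : ℝ) < M := by exact_mod_cast hM
  set F : ℕ → ℂ := fun k => expSum f N ((k : ℝ) / M)
  set E := ∑ k ∈ T, ‖F k‖ ^ 2 with hE
  have hE0 : 0 ≤ E := sum_nonneg fun _ _ => by positivity
  have h := norm_sum_mul_expSum_sq_le hM hNM hT (fun k => (starRingEnd ℂ) (F k)) hν hν0
    (g := fun m => f m - ν m) (A := fun m => 1 / 4 * f m + ν m)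
    (fun m _ => by have := hf0 m; have := hν0 m; positivity)
    (fun m hm => sub_sq_le (hf0 m) (hfν m (mem_range.mp hm)))
  simp only [RCLike.norm_conj, expSum_sub, mul_sub, sum_sub_distrib] at h
  rw [sum_conj_mul_self F] at h
  have hS := sum_norm_le_div (T := T) (mul_pos hτ hN0) hF
  have hS0 : 0 ≤ ∑ k ∈ T, ‖F k‖ := sum_nonneg fun _ _ => norm_nonneg _
  set X := ∑ k ∈ T, (starRingEnd ℂ) (F k) * expSum ν N ((k : ℝ) / M) with hX
  have hXle : ‖X‖ ≤ 1 / 100 * E := by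
    calc ‖X‖ ≤ ∑ k ∈ T, ‖F k‖ * (τ / 100 * N) := norm_sum_le_of_le _ fun k hk => by
          rw [norm_mul, RCLike.norm_conj]
          gcongr
          exact (hνT k hk).trans (by gcongr)
      _ ≤ E / (τ * N) * (τ / 100 * N) := by rw [← sum_mul]; gcongr
      _ = _ := by field_simp
  have h2 : 99 / 100 * E ≤ ‖(E : ℂ) - X‖ := by
    have := norm_sub_norm_le (E : ℂ) X
    rw [Complex.norm_real, Real.norm_of_nonneg hE0] at this
    linarith
  have h3 : (99 / 100 * E) ^ 2 ≤ (5 / 4 * (1 + τ ^ 2 / 100) * N) *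
      (M * E + τ ^ 2 / 100 * N * (E / (τ * N)) ^ 2) := by
    refine (pow_le_pow_left₀ (by positivity) h2 2).trans (h.trans ?_)
    have hA := sum_quarter_add_le hfN hν
    gcongr
    exact hA.trans (by gcongr)
  have h4 : (5 / 4 * (1 + τ ^ 2 / 100) * N) * (M * E + τ ^ 2 / 100 * N * (E / (τ * N)) ^ 2) =
      (1 + τ ^ 2 / 100) * (5 / 4 * N * M * E + E ^ 2 / 80) := by
    field_simp
    ring
  have h5 : (1 + τ ^ 2 / 100) * (5 / 4 * N * M * E + E ^ 2 / 80) ≤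
      (1 + 1 ^ 2 / 100) * (5 / 4 * N * M * E + E ^ 2 / 80) := by gcongr
  have h8 : E * E ≤ (3 / 2 * N * M) * E := by
    have : 0 ≤ N * M * E := by positivity
    nlinarith
  rcases hE0.eq_or_lt with h0 | h0
  · rw [← h0]; positivity
  · exact le_of_mul_le_mul_right h8 h0

lemma re_sq_of_norm_eq_one {z : ℂ} (hz : ‖z‖ = 1) : z.re ^ 2 = 1 / 2 + 1 / 2 * (z ^ 2).re := by
  have h : ‖z‖ ^ 2 = z.re ^ 2 + z.im ^ 2 := by
    rw [Complex.sq_norm, Complex.normSq_apply]; ring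
  rw [hz] at h
  rw [sq z, Complex.mul_re]
  linarith

/-- A function below `9/4` times a pseudorandom weight cannot have Fourier coefficients close to
its mean, at frequencies away from those where the weight has large transform. -/
lemma norm_expSum_le_of_majorant {ε : ℝ} (hε1 : ε ≤ 1 / 100)
    (hf0 : ∀ m, 0 ≤ f m) (hfN : ∑ m ∈ range N, f m ≤ (1 + ε) * N) (hν0 : ∀ m, 0 ≤ ν m)
    (hfν : ∀ m < N, f m ≤ 9 / 4 * ν m)
    (hν : ∀ α : ℝ, 0 ≤ α → ‖expSum ν N α - ∑ m ∈ range N, e (m * α)‖ ≤ ε * N) {θ : ℝ}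
    (h1 : ‖expSum ν N θ‖ ≤ 1 / 100 * N) (h2 : ‖expSum ν N (2 * θ)‖ ≤ 1 / 100 * N) :
    ‖expSum f N θ‖ ≤ 21 / 25 * N := by
  obtain ⟨ω, hω, hωF⟩ : ∃ ω : ℂ, ‖ω‖ = 1 ∧ ω * expSum f N θ = (‖expSum f N θ‖ : ℂ) := by
    rcases eq_or_ne (expSum f N θ) 0 with h0 | h0
    · exact ⟨1, by simp, by simp [h0]⟩
    · have hn : (‖expSum f N θ‖ : ℂ) ≠ 0 := by exact_mod_cast norm_ne_zero_iff.mpr h0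
      refine ⟨(starRingEnd ℂ) (expSum f N θ) / ‖expSum f N θ‖, ?_, ?_⟩
      · rw [norm_div, RCLike.norm_conj, Complex.norm_real, norm_norm, div_self]
        exact_mod_cast hn
      · rw [div_mul_eq_mul_div, Complex.conj_mul', sq, mul_div_assoc, div_self hn, mul_one]
  set c : ℕ → ℝ := fun m => (ω * e (m * θ)).re with hc
  have hre : ∀ g : ℕ → ℝ, (ω * expSum g N θ).re = ∑ m ∈ range N, g m * c m := fun g => by
    rw [expSum, mul_sum, Complex.re_sum]
    refine sum_congr rfl fun m _ => ?_
    rw [mul_left_comm, Complex.re_ofReal_mul]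
  have hmain : ‖expSum f N θ‖ = ∑ m ∈ range N, (f m - ν m) * c m + (ω * expSum ν N θ).re := by
    rw [hre ν, ← sum_add_distrib]
    simp only [sub_mul, sub_add_cancel]
    rw [← hre f, hωF, Complex.ofReal_re]
  have hνθ : (ω * expSum ν N θ).re ≤ 1 / 100 * N := by
    refine (Complex.re_le_norm _).trans ?_
    rwa [norm_mul, hω, one_mul]
  have hcos : ∑ m ∈ range N, ν m * c m ^ 2 ≤ 51 / 100 * N := by
    have h3 : ∑ m ∈ range N, ν m * c m ^ 2 =
        1 / 2 * ∑ m ∈ range N, ν m + 1 / 2 * (ω ^ 2 * expSum ν N (2 * θ)).re := by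
      rw [expSum, mul_sum _ _ (ω ^ 2), Complex.re_sum, mul_sum, mul_sum, ← sum_add_distrib]
      refine sum_congr rfl fun m _ => ?_
      have h2θ : (m : ℝ) * (2 * θ) = (2 : ℕ) * (m * θ) := by push_cast; ring
      rw [hc, re_sq_of_norm_eq_one (by rw [norm_mul, norm_e, hω, one_mul]), h2θ, e_nat_mul 2,
        mul_left_comm, Complex.re_ofReal_mul, mul_pow]
      ring
    have h4 : (ω ^ 2 * expSum ν N (2 * θ)).re ≤ 1 / 100 * N := by
      refine (Complex.re_le_norm _).trans ?_
      rwa [norm_mul, norm_pow, hω, one_pow, one_mul]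
    have h5 := sum_le_of_norm_expSum_sub_le hν
    have : ε * N ≤ 1 / 100 * N := by gcongr
    linarith
  have hA : ∑ m ∈ range N, (1 / 4 * f m + ν m) ≤ 5 / 4 * (1 + 1 / 100) * N :=
    (sum_quarter_add_le hfN hν).trans (by gcongr)
  have hCS : (∑ m ∈ range N, (f m - ν m) * c m) ^ 2 ≤
      (∑ m ∈ range N, (1 / 4 * f m + ν m)) * ∑ m ∈ range N, ν m * c m ^ 2 := by
    refine sum_sq_le_sum_mul_sum_of_sq_le_mul _ (fun m _ => ?_) (fun m _ => ?_) fun m hm => ?_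
    · have := hf0 m; have := hν0 m; positivity
    · have := hν0 m; positivity
    · rw [mul_pow, ← mul_assoc]
      exact mul_le_mul_of_nonneg_right (sub_sq_le (hf0 m) (hfν m (mem_range.mp hm)))
        (by positivity)
  have hc0 : 0 ≤ ∑ m ∈ range N, ν m * c m ^ 2 :=
    sum_nonneg fun m _ => by have := hν0 m; positivity
  have hN0 : (0 : ℝ) ≤ N := Nat.cast_nonneg N
  have hle : ∑ m ∈ range N, (f m - ν m) * c m ≤ 83 / 100 * N := by
    refine (Real.le_sqrt_of_sq_le hCS).trans ?_
    rw [Real.sqrt_le_left (by positivity)]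
    calc _ ≤ (5 / 4 * (1 + 1 / 100) * (N : ℝ)) * (51 / 100 * N) := by gcongr
      _ ≤ (83 / 100 * (N : ℝ)) ^ 2 := by nlinarith [sq_nonneg (N : ℝ)]
  rw [hmain]
  linarith

end

lemma cube_le_sum_layers {x n : ℝ} (hx : 0 ≤ x) (hn : 0 ≤ n) (h : x ≤ 2 * n) (J : ℕ) :
    x ^ 3 ≤ ∑ j ∈ range J, (if (1 / 2) ^ j * n ≤ x then 8 * (1 / 8) ^ j * n ^ 3 else 0) +
      8 * (1 / 8) ^ J * n ^ 3 := by
  induction J with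
  | zero =>
    calc x ^ 3 ≤ (2 * n) ^ 3 := by gcongr
      _ = _ := by simp; ring
  | succ J ih =>
    rw [sum_range_succ]
    have h8 : (0 : ℝ) ≤ 8 * (1 / 8) ^ (J + 1) * n ^ 3 := by positivity
    split_ifs with hJ
    · linarith
    · have hs : 0 ≤ ∑ j ∈ range J, (if (1 / 2) ^ j * n ≤ x then 8 * (1 / 8) ^ j * n ^ 3 else 0) :=
        sum_nonneg fun j _ => by split_ifs <;> positivity
      have : x ^ 3 ≤ ((1 / 2) ^ J * n) ^ 3 := by
        gcongr
        exact (not_le.mp hJ).le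
      have h2 : ((1 / 2 : ℝ) ^ J * n) ^ 3 = 8 * (1 / 8) ^ (J + 1) * n ^ 3 := by
        rw [mul_pow, ← pow_mul, mul_comm J 3, pow_mul, show (1 / 2 : ℝ) ^ 3 = 1 / 8 by norm_num]
        ring
      linarith

/-- Fifth moments from level set estimates. -/
lemma sum_norm_pow_five_le {ι : Type*} {s : Finset ι} {F : ι → ℂ} {n m a b : ℝ} {J : ℕ} (hn : 0 ≤ n)
    (hm : 0 ≤ m) (ha : 0 ≤ a) (hF : ∀ k ∈ s, ‖F k‖ ≤ 2 * n)
    (hlevel : ∀ j < J, ∑ k ∈ s with (1 / 2) ^ j * n ≤ ‖F k‖, ‖F k‖ ^ 2 ≤ a * 4 ^ j * n * m)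
    (htot : ∑ k ∈ s, ‖F k‖ ^ 2 ≤ b * n * m) (hb : b ≤ 8 ^ J) :
    ∑ k ∈ s, ‖F k‖ ^ 5 ≤ (16 * a + 8) * m * n ^ 4 := by
  calc ∑ k ∈ s, ‖F k‖ ^ 5 ≤ ∑ k ∈ s, (∑ j ∈ range J,
        (if (1 / 2) ^ j * n ≤ ‖F k‖ then 8 * (1 / 8) ^ j * n ^ 3 else 0) +
        8 * (1 / 8) ^ J * n ^ 3) * ‖F k‖ ^ 2 := by
        refine sum_le_sum fun k hk => ?_
        rw [show ‖F k‖ ^ 5 = ‖F k‖ ^ 3 * ‖F k‖ ^ 2 by ring]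
        gcongr
        exact cube_le_sum_layers (norm_nonneg _) hn (hF k hk) J
    _ = ∑ j ∈ range J, 8 * (1 / 8) ^ j * n ^ 3 *
          ∑ k ∈ s with (1 / 2) ^ j * n ≤ ‖F k‖, ‖F k‖ ^ 2 +
        8 * (1 / 8) ^ J * n ^ 3 * ∑ k ∈ s, ‖F k‖ ^ 2 := by
        simp_rw [add_mul, sum_add_distrib, ← mul_sum, sum_mul]
        rw [sum_comm]
        congr 1
        refine sum_congr rfl fun j _ => ?_
        rw [mul_sum, sum_filter]
        exact sum_congr rfl fun k _ => by split_ifs <;> simp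
    _ ≤ ∑ j ∈ range J, 8 * (1 / 8) ^ j * n ^ 3 * (a * 4 ^ j * n * m) +
        8 * (1 / 8) ^ J * n ^ 3 * (8 ^ J * n * m) := by
        have h1 : ∑ k ∈ s, ‖F k‖ ^ 2 ≤ 8 ^ J * n * m := htot.trans (by gcongr)
        refine add_le_add (sum_le_sum fun j hj => ?_) (by gcongr)
        exact mul_le_mul_of_nonneg_left (hlevel j (mem_range.mp hj)) (by positivity)
    _ = 8 * a * m * n ^ 4 * ∑ j ∈ range J, (1 / 2 : ℝ) ^ j + 8 * m * n ^ 4 := by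
        rw [mul_sum]
        congr 1
        · refine sum_congr rfl fun j _ => ?_
          have : (1 / 2 : ℝ) ^ j = (1 / 8) ^ j * 4 ^ j := by rw [← mul_pow]; norm_num
          rw [this]
          ring
        · have : (1 / 8 : ℝ) ^ J * 8 ^ J = 1 := by rw [← mul_pow]; norm_num
          linear_combination 8 * n ^ 4 * m * this
    _ ≤ 8 * a * m * n ^ 4 * 2 + 8 * m * n ^ 4 := by
        gcongr
        exact sum_geometric_two_le J
    _ = _ := by ring

lemma exists_layer_count (W : ℕ) : ∃ N₀ : ℕ, ∀ N ≥ N₀, ∃ J : ℕ,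
    2 * Real.log (W * N) ≤ 8 ^ J ∧ (5184 * 16 ^ J) ^ 50 ≤ N := by
  have hlog : Filter.Tendsto (fun N : ℕ => Real.log N) Filter.atTop Filter.atTop :=
    Real.tendsto_log_atTop.comp tendsto_natCast_atTop_atTop
  have ho : ∀ᶠ N : ℕ in Filter.atTop, ‖Real.log N ^ 200‖ ≤
      1 / (5184 * 16 * 4 ^ 4) ^ 50 * ‖(N : ℝ)‖ :=
    tendsto_natCast_atTop_atTop.eventually
      ((Real.isLittleO_pow_log_id_atTop (n := 200)).bound
        (by positivity : (0 : ℝ) < 1 / (5184 * 16 * 4 ^ 4) ^ 50))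
  obtain ⟨N₀, hN₀⟩ := Filter.eventually_atTop.mp ((ho.and (hlog.eventually_ge_atTop
    (max 1 (Real.log W)))).and (Filter.eventually_ge_atTop 1))
  refine ⟨N₀, fun N hN => ?_⟩
  obtain ⟨⟨ho, hl⟩, hN1⟩ := hN₀ N hN
  have hN0 : (0 : ℝ) < N := by exact_mod_cast hN1
  set l := Real.log N
  have hl1 : 1 ≤ l := (le_max_left _ _).trans hl
  have hWN : Real.log (W * N) ≤ 2 * l := by
    rcases Nat.eq_zero_or_pos W with rfl | hW
    · simp; linarith
    · rw [Real.log_mul (by positivity) hN0.ne']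
      have := (le_max_right _ _).trans hl
      linarith
  obtain ⟨J, hJ, hJ'⟩ := exists_nat_pow_near (x := 4 * l) (y := 2) (by linarith) (by norm_num)
  refine ⟨J + 1, ?_, ?_⟩
  · calc 2 * Real.log (W * N) ≤ 4 * l := by linarith
      _ ≤ 2 ^ (J + 1) := hJ'.le
      _ ≤ 8 ^ (J + 1) := by gcongr; norm_num
  · have h16 : (16 : ℝ) ^ (J + 1) ≤ 16 * 4 ^ 4 * l ^ 4 := by
      calc (16 : ℝ) ^ (J + 1) = 16 * (2 ^ J) ^ 4 := by
            rw [← pow_mul, mul_comm J 4, pow_mul, pow_succ]; norm_num; ring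
        _ ≤ 16 * (4 * l) ^ 4 := by gcongr
        _ = _ := by ring
    rw [Real.norm_of_nonneg (by positivity), Real.norm_of_nonneg hN0.le, div_mul_eq_mul_div,
      one_mul,
      le_div_iff₀ (by positivity)] at ho
    have : (5184 * (16 : ℝ) ^ (J + 1)) ^ 50 ≤ N := by
      calc (5184 * (16 : ℝ) ^ (J + 1)) ^ 50 ≤ (5184 * (16 * 4 ^ 4 * l ^ 4)) ^ 50 := by gcongr
        _ = l ^ 200 * (5184 * 16 * 4 ^ 4) ^ 50 := by
          rw [← mul_assoc, ← mul_assoc, mul_pow _ (l ^ 4), ← pow_mul, mul_comm]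
        _ ≤ N := ho
    exact_mod_cast this

lemma sum_norm_expSum_sq_range {M N : ℕ} (hM : 0 < M) (hNM : N ≤ M) (f : ℕ → ℝ) :
    ∑ k ∈ range M, ‖expSum f N ((k : ℝ) / M)‖ ^ 2 = M * ∑ m ∈ range N, f m ^ 2 := by
  have h := parseval hM (range_subset_range.mpr hNM) (fun m => (f m : ℂ))
  simp only [Complex.norm_real, Real.norm_eq_abs, sq_abs] at h
  rw [← h]
  refine sum_congr rfl fun k _ => ?_
  rw [expSum]
  congr 2
  refine sum_congr rfl fun m _ => ?_
  rw [mul_div_left_comm]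

lemma totient_primorial_div_mul_mertensProd (w : ℕ) :
    ((primorial w).totient : ℝ) / primorial w * mertensProd w = 1 := by
  have hW : (0 : ℝ) < primorial w := by exact_mod_cast primorial_pos w
  rw [div_mul_eq_mul_div, totient_primorial_mul_mertensProd, div_self hW.ne']

lemma totient_div_mul_mertensProd_le {w j : ℕ} (hw : 2 ≤ w) :
    9 / 4 * (((primorial w).totient : ℝ) / primorial w) * mertensProd (max w (5184 * 16 ^ j)) ≤
      324 * 4 ^ j := by
  have hW : (0 : ℝ) < primorial w := by exact_mod_cast primorial_pos w
  have h4 : (1 : ℝ) ≤ 4 ^ j := one_le_pow₀ (by norm_num)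
  rcases le_total w (5184 * 16 ^ j) with h | h
  · rw [max_eq_right h]
    have h1 : ((primorial w).totient : ℝ) / primorial w ≤ 1 := by
      rw [div_le_one hW]
      exact_mod_cast Nat.totient_le _
    have h2 := mertensProd_le (z := 5184 * 16 ^ j) (by lia)
    have h3 : √((5184 * 16 ^ j : ℕ) : ℝ) = 72 * 4 ^ j := by
      rw [Real.sqrt_eq_iff_mul_self_eq (by positivity) (by positivity)]
      push_cast
      rw [mul_mul_mul_comm, ← mul_pow]
      norm_num
    rw [h3] at h2
    have h5 := (mertensProd_pos (5184 * 16 ^ j)).le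
    calc _ ≤ (9 / 4 * 1 * (2 * (72 * 4 ^ j)) : ℝ) := by gcongr
      _ = _ := by ring
  · rw [max_eq_left h, mul_assoc, totient_primorial_div_mul_mertensProd]
    linarith

/-- `f` is equidistributed (also with respect to parity) on `[0, N)`, has a pseudorandom majorant
`9 / 4 * ν`, and its Fourier transform has fifth moment of the expected order of magnitude. -/
structure PrimeLike (f ν : ℕ → ℝ) (N : ℕ) (ε δ : ℝ) : Prop where
  nonneg : ∀ m, 0 ≤ f m
  abs_sum_sub_le : ∀ x ≤ N, |∑ m ∈ range x, f m - x| ≤ ε * N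
  abs_sum_alternating_le : ∀ x ≤ N, |∑ m ∈ range x, f m * (-1) ^ m| ≤ ε * N
  majorant_nonneg : ∀ m, 0 ≤ ν m
  le_majorant : ∀ m < N, f m ≤ 9 / 4 * ν m
  fourier : ∀ α : ℝ, 0 ≤ α → ‖expSum ν N α - ∑ m ∈ range N, e (m * α)‖ ≤ δ * N
  fifth_moment : ∀ M ≥ N,
    ∑ k ∈ range M, ‖expSum f N ((k : ℝ) / M)‖ ^ 5 ≤ 20744 * M * (N : ℝ) ^ 4

/-- The weighted primes `≡ b` modulo a primorial are `PrimeLike`. -/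
theorem exists_prime_weight {w b : ℕ} (hw : 2 ≤ w) (hbW : b < primorial w)
    (hb : b.Coprime (primorial w)) {ε : ℝ} (hε : 0 < ε) : ∃ N₀ : ℕ, ∀ N ≥ N₀, ∃ f ν : ℕ → ℝ,
      (∀ m, f m ≠ 0 → (primorial w * m + b).Prime) ∧ PrimeLike f ν N ε (4 / w) := by
  have hW := primorial_pos w
  have hWe : Even (primorial w) := by
    rw [even_iff_two_dvd]
    exact Nat.prime_two.dvd_primorial_iff.mpr hw
  set W := primorial w with hWdef
  have hWp : ∀ p, p.Prime → p ∣ W → p ≤ w := fun p hp hpW => hp.dvd_primorial_iff.mp hpW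
  obtain ⟨N₁, h₁⟩ := abs_sum_primeWeight_sub_le_eps hW hbW hb (lt_min hε one_pos)
  obtain ⟨N₂, h₂⟩ := abs_sum_primeWeight_mul_neg_one_pow_le hW hWe hbW hb hε
  obtain ⟨N₃, h₃⟩ := exists_majorant hW hbW
  obtain ⟨N₄, h₄⟩ := exists_layer_count W
  refine ⟨max (max N₁ N₂) (max (max N₃ N₄) (w ^ 50)), fun N hN => ?_⟩
  simp only [ge_iff_le, max_le_iff] at hN
  obtain ⟨⟨hN1, hN2⟩, ⟨hN3, hN4⟩, hNw⟩ := hN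
  have hNpos : 0 < N := lt_of_lt_of_le (by positivity) hNw
  obtain ⟨R, hRN, hmaj⟩ := h₃ N hN3
  obtain ⟨J, hJ1, hJ2⟩ := h₄ N hN4
  have hpnt := h₁ N hN1 R hRN
  obtain ⟨ν, hν0, hfν, hν⟩ := hmaj w (by lia) hNw hWp
  have hconst : 9 / 4 * ((W.totient : ℝ) / W) * mertensProd w = 9 / 4 := by
    rw [mul_assoc, totient_primorial_div_mul_mertensProd, mul_one]
  have hsum : ∑ m ∈ range N, primeWeight W b R m ≤ 2 * N := by
    have h5 := (le_abs_self _).trans (hpnt N le_rfl)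
    have h6 : min ε 1 * (N : ℝ) ≤ 1 * N := by gcongr; exact min_le_right _ _
    linarith
  refine ⟨primeWeight W b R, ν, fun m => prime_of_primeWeight_ne_zero,
    fun m => primeWeight_nonneg _ _ _ _, fun x hx => ?_, h₂ N hN2 R hRN, hν0, fun m hm => ?_, hν,
    fun M hM => ?_⟩
  · exact (hpnt x hx).trans (by gcongr; exact min_le_left _ _)
  · have := hfν m hm
    rwa [hconst] at this
  · have hM0 : 0 < M := lt_of_lt_of_le hNpos hM
    have hlev : ∀ j < J, ∑ k ∈ (range M).filter fun k : ℕ => (1 / 2) ^ j * (N : ℝ) ≤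
        ‖expSum (primeWeight W b R) N ((k : ℝ) / M)‖,
        ‖expSum (primeWeight W b R) N ((k : ℝ) / M)‖ ^ 2 ≤ 1296 * 4 ^ j * N * M := by
      intro j hj
      have hz : (max w (5184 * 16 ^ j)) ^ 50 ≤ N := by
        rcases max_cases w (5184 * 16 ^ j) with ⟨h, -⟩ | ⟨h, -⟩ <;> rw [h]
        · exact hNw
        · refine le_trans ?_ hJ2
          gcongr
          norm_num
      obtain ⟨μ, hμ0, hfμ, hμ⟩ := hmaj (max w (5184 * 16 ^ j)) (by positivity) hz
        fun p hp hpW => (hWp p hp hpW).trans (le_max_left _ _)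
      have hz5 : (5184 * 16 ^ j : ℝ) ≤ (max w (5184 * 16 ^ j) : ℕ) := by
        exact_mod_cast le_max_right w (5184 * 16 ^ j)
      have key := sum_norm_expSum_sq_le (M := M) (N := N) (f := primeWeight W b R) (ν := μ)
        (T := (range M).filter fun k : ℕ => (1 / 2) ^ j * (N : ℝ) ≤
          ‖expSum (primeWeight W b R) N ((k : ℝ) / M)‖) (C := 324 * 4 ^ j)
        (ε := 4 / (max w (5184 * 16 ^ j) : ℕ)) (τ := (1 / 2) ^ j) hM0 hNpos hM (filter_subset _ _)
        (by positivity) (by positivity) (by positivity) ?_ (fun m => primeWeight_nonneg _ _ _ _)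
        hsum hμ0 (fun m hm => (hfμ m hm).trans ?_) hμ (fun k hk => (mem_filter.mp hk).2)
      · refine key.trans (le_of_eq ?_)
        ring
      · calc 4 * (324 * 4 ^ j) * (4 / ((max w (5184 * 16 ^ j) : ℕ) : ℝ))
            ≤ 4 * (324 * 4 ^ j) * (4 / (5184 * 16 ^ j : ℝ)) := by gcongr
          _ = ((1 / 2) ^ j) ^ 2 := by
            rw [← pow_mul, mul_comm j 2, pow_mul, show (16 : ℝ) ^ j = 4 ^ j * 4 ^ j by
              rw [← mul_pow]; norm_num, show ((1 / 2 : ℝ) ^ 2) ^ j = 1 / 4 ^ j by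
              rw [← one_div_pow]; norm_num]
            field_simp
            norm_num
      · exact mul_le_mul_of_nonneg_right (totient_div_mul_mertensProd_le hw) (hμ0 m)
    have htot : ∑ k ∈ range M, ‖expSum (primeWeight W b R) N ((k : ℝ) / M)‖ ^ 2 ≤
        (2 * Real.log (W * N)) * N * M := by
      rw [sum_norm_expSum_sq_range hM0 hM]
      have hlog0 : 0 ≤ Real.log ((W : ℝ) * N) :=
        Real.log_nonneg (by exact_mod_cast Nat.mul_pos hW hNpos)
      have : ∑ m ∈ range N, primeWeight W b R m ^ 2 ≤
          Real.log (W * N) * ∑ m ∈ range N, primeWeight W b R m := by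
        rw [mul_sum]
        refine sum_le_sum fun m hm => ?_
        rw [sq]
        refine mul_le_mul_of_nonneg_right ?_ (primeWeight_nonneg _ _ _ _)
        refine (primeWeight_le_log hW hbW (mem_range.mp hm) R).trans ?_
        refine mul_le_of_le_one_left hlog0 ?_
        rw [div_le_one (by exact_mod_cast hW)]
        exact_mod_cast Nat.totient_le _
      calc _ ≤ (M : ℝ) * (Real.log (W * N) * (2 * N)) := by
            gcongr
            exact this.trans (by gcongr)
        _ = _ := by ring
    have := sum_norm_pow_five_le (s := range M) (n := N) (m := M) (a := 1296) (by positivity)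
      (by positivity) (by norm_num)
      (fun k _ => (norm_expSum_le (fun m => primeWeight_nonneg _ _ _ _) N _).trans hsum)
      hlev htot hJ1
    refine this.trans (le_of_eq ?_)
    norm_num

lemma sum_mul_e_by_parts (a : ℕ → ℝ) (β : ℝ) (N : ℕ) :
    expSum a N β = ((∑ m ∈ range N, a m : ℝ) : ℂ) * e (N * β) -
      ∑ m ∈ range N, ((∑ l ∈ range (m + 1), a l : ℝ) : ℂ) *
        (e ((m + 1 : ℕ) * β) - e (m * β)) := by
  rw [expSum]
  induction N with
  | zero => simp
  | succ N ih =>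
    rw [sum_range_succ, ih, sum_range_succ (fun m => ((∑ l ∈ range (m + 1), a l : ℝ) : ℂ) *
      (e ((m + 1 : ℕ) * β) - e (m * β))), sum_range_succ a N]
    push_cast
    ring

lemma norm_expSum_le_by_parts {a : ℕ → ℝ} {β D : ℝ} {N : ℕ}
    (h : ∀ x ≤ N, |∑ m ∈ range x, a m| ≤ D) :
    ‖expSum a N β‖ ≤ D * (1 + 2 * Real.pi * |β| * N) := by
  rw [sum_mul_e_by_parts]
  refine (norm_sub_le _ _).trans ?_
  have h1 : ‖((∑ m ∈ range N, a m : ℝ) : ℂ) * e (N * β)‖ ≤ D := by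
    rw [norm_mul, norm_e, mul_one, Complex.norm_real]
    exact h N le_rfl
  have h2 : ‖∑ m ∈ range N, ((∑ l ∈ range (m + 1), a l : ℝ) : ℂ) *
      (e ((m + 1 : ℕ) * β) - e (m * β))‖ ≤ ∑ m ∈ range N, D * (2 * Real.pi * |β|) := by
    refine norm_sum_le_of_le _ fun m hm => ?_
    rw [norm_mul, Complex.norm_real]
    have h3 := norm_e_sub_e_le ((m + 1 : ℕ) * β) (m * β)
    rw [← sub_mul, Nat.cast_succ, add_sub_cancel_left, one_mul] at h3
    have h4 := h (m + 1) (mem_range.mp hm)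
    have hD : 0 ≤ D := (abs_nonneg _).trans h4
    rw [Nat.cast_succ]
    exact mul_le_mul h4 h3 (norm_nonneg _) hD
  rw [sum_const, card_range, nsmul_eq_mul] at h2
  linarith

lemma norm_sum_e_mul_two_mul_le {M K : ℕ} (hM : 0 < M) {j : ℕ}
    (hj : ∀ n : ℤ, (K : ℤ) ≤ |(j : ℤ) - n * M|) (N : ℕ) :
    ‖∑ m ∈ range N, e (m * ((j : ℝ) / M))‖ * (2 * K) ≤ M := by
  have h := norm_sum_e_mul_le N 0 ((j : ℝ) / M)
  simp only [zero_add] at h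
  have hM0 : (0 : ℝ) < M := by exact_mod_cast hM
  have h2 : (K : ℝ) / M ≤ |(j : ℝ) / M - round ((j : ℝ) / M)| := by
    have h3 : (K : ℝ) ≤ |(j : ℝ) - round ((j : ℝ) / M) * M| := by
      exact_mod_cast hj (round ((j : ℝ) / M))
    rw [div_le_iff₀ hM0]
    calc (K : ℝ) ≤ |(j : ℝ) - round ((j : ℝ) / M) * M| := h3
      _ = |((j : ℝ) / M - round ((j : ℝ) / M)) * M| := by congr 1; field_simp
      _ = _ := by rw [abs_mul, abs_of_pos hM0]
  have h5 : ‖∑ m ∈ range N, e (m * ((j : ℝ) / M))‖ * (2 * (K / M)) ≤ 1 := by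
    refine le_trans ?_ h
    gcongr
  generalize ‖∑ m ∈ range N, e (m * ((j : ℝ) / M))‖ = A at h5 ⊢
  calc A * (2 * K) = A * (2 * (K / M)) * M := by field_simp
    _ ≤ 1 * M := by gcongr
    _ = M := one_mul _

lemma le_abs_sub_mul_of_minor {M K k : ℕ} (hk : K < k) (hkM : k + K < M) (n : ℤ) :
    (K : ℤ) ≤ |(k : ℤ) - n * M| := by
  rcases le_or_gt n 0 with h | h
  · rw [abs_of_nonneg] <;> nlinarith
  · rw [abs_of_nonpos] <;> nlinarith

lemma le_abs_two_mul_sub_mul_of_minor {M K k : ℕ} (hk : K < k) (hkM : k + K < M)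
    (h2 : (K : ℤ) < |2 * (k : ℤ) - M|) (n : ℤ) : (K : ℤ) ≤ |((2 * k : ℕ) : ℤ) - n * M| := by
  push_cast
  rcases le_or_gt n 0 with h | h
  · rw [abs_of_nonneg] <;> nlinarith
  · rcases (Int.add_one_le_iff.mpr h).eq_or_lt with h1 | h1
    · have : n = 1 := by lia
      subst this
      rw [one_mul]
      exact h2.le
    · rw [abs_of_nonpos] <;> nlinarith

lemma e_half_mul (m : ℕ) : e (m * (1 / 2)) = (-1) ^ m := by
  rw [e_nat_mul]
  congr 1
  rw [e, ← Complex.exp_pi_mul_I]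
  congr 1
  push_cast
  ring

namespace PrimeLike
variable {f ν : ℕ → ℝ} {N : ℕ} {ε δ : ℝ}

lemma sum_le (h : PrimeLike f ν N ε δ) : ∑ m ∈ range N, f m ≤ (1 + ε) * N := by
  have := (le_abs_self _).trans (h.abs_sum_sub_le N le_rfl)
  linarith

lemma norm_majorant_le (h : PrimeLike f ν N ε δ) {M K j : ℕ} (hM : 0 < M) (hK : 0 < K)
    (hj : ∀ n : ℤ, (K : ℤ) ≤ |(j : ℤ) - n * M|) :
    ‖expSum ν N ((j : ℝ) / M)‖ ≤ M / (2 * K) + δ * N := by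
  have h1 := norm_sum_e_mul_two_mul_le hM hj N
  rw [← le_div_iff₀ (by positivity)] at h1
  have h2 := h.fourier ((j : ℝ) / M) (by positivity)
  have h3 := norm_le_norm_add_norm_sub' (expSum ν N ((j : ℝ) / M))
    (∑ m ∈ range N, e (m * ((j : ℝ) / M)))
  linarith

/-- Upper bound on the minor arcs. -/
lemma norm_expSum_le_of_minor (h : PrimeLike f ν N ε δ) (hε0 : 0 ≤ ε) (hεδ : ε ≤ δ)
    (hδ : δ ≤ 1 / 200) {M K k : ℕ} (hM : 0 < M) (hNM : N ≤ M) (hK : 0 < K)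
    (hMK : 100 * M ≤ K * N) (hεK : ε * (1 + 4 * K) ≤ 21 / 25)
    (hk : K < k) (hkM : k + K < M) : ‖expSum f N ((k : ℝ) / M)‖ ≤ 21 / 25 * N := by
  have hM0 : (0 : ℝ) < M := by exact_mod_cast hM
  have hK0 : (0 : ℝ) < K := by exact_mod_cast hK
  rcases le_or_gt |2 * (k : ℤ) - M| (K : ℤ) with h2 | h2
  · set β : ℝ := (2 * k - M) / (2 * M) with hβ
    have h2' : |2 * (k : ℝ) - M| ≤ K := by exact_mod_cast h2
    have hβN : |β| * N ≤ K / 2 := by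
      rw [hβ, abs_div, abs_of_pos (by positivity : (0 : ℝ) < 2 * M), div_mul_eq_mul_div,
        div_le_iff₀ (by positivity)]
      have : (N : ℝ) ≤ M := by exact_mod_cast hNM
      calc |2 * (k : ℝ) - M| * N ≤ K * M := by gcongr
        _ = _ := by ring
    have heq : expSum f N ((k : ℝ) / M) = expSum (fun m => f m * (-1) ^ m) N β := by
      rw [expSum, expSum]
      refine sum_congr rfl fun m _ => ?_
      have : (m : ℝ) * (k / M) = m * (1 / 2) + m * β := by
        rw [hβ]; field_simp; ring
      rw [this, e_add, e_half_mul]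
      push_cast
      ring
    rw [heq]
    refine (norm_expSum_le_by_parts h.abs_sum_alternating_le).trans ?_
    have hpi := Real.pi_le_four
    calc ε * N * (1 + 2 * Real.pi * |β| * N) = ε * N * (1 + 2 * Real.pi * (|β| * N)) := by ring
      _ ≤ ε * N * (1 + 2 * 4 * (K / 2)) := by gcongr
      _ = ε * (1 + 4 * K) * N := by ring
      _ ≤ 21 / 25 * N := by gcongr
  · have hMK' : (M : ℝ) / (2 * K) ≤ 1 / 200 * N := by
      rw [div_le_iff₀ (by positivity)]
      have : 100 * (M : ℝ) ≤ K * N := by exact_mod_cast hMK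
      linarith
    have hδN : δ * N ≤ 1 / 200 * N := by gcongr
    have h3 := h.norm_majorant_le hM hK (le_abs_sub_mul_of_minor hk hkM)
    have h4 := h.norm_majorant_le hM hK (le_abs_two_mul_sub_mul_of_minor hk hkM h2)
    rw [Nat.cast_mul, mul_div_assoc, Nat.cast_two] at h4
    refine norm_expSum_le_of_majorant (ε := δ) (by linarith) h.nonneg (h.sum_le.trans (by gcongr))
      h.majorant_nonneg h.le_majorant h.fourier (by linarith) (by linarith)

lemma norm_expSum_sub_le (h : PrimeLike f ν N ε δ) (hε0 : 0 ≤ ε) {M K k : ℕ} (hM : 0 < M)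
    (hNM : N ≤ M) (hkM : k < M) (hk : ¬ (K < k ∧ k + K < M)) :
    ‖expSum f N ((k : ℝ) / M) - expSum (fun _ => 1) N ((k : ℝ) / M)‖ ≤ ε * (1 + 8 * K) * N := by
  have hM0 : (0 : ℝ) < M := by exact_mod_cast hM
  have hNM' : (N : ℝ) ≤ M := by exact_mod_cast hNM
  obtain ⟨β, hβ, heβ⟩ : ∃ β : ℝ, |β| * M ≤ K ∧ ∀ m : ℕ, e (m * ((k : ℝ) / M)) = e (m * β) := by
    rcases le_or_gt k K with hkK | hkK
    · refine ⟨(k : ℝ) / M, ?_, fun m => rfl⟩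
      rw [abs_of_nonneg (by positivity), div_mul_cancel₀ _ hM0.ne']
      exact_mod_cast hkK
    · refine ⟨((k : ℝ) - M) / M, ?_, fun m => ?_⟩
      · rw [abs_div, abs_of_pos hM0, div_mul_cancel₀ _ hM0.ne', abs_of_nonpos]
        · have : M ≤ k + K := by by_contra hc; exact hk ⟨hkK, by lia⟩
          have : (M : ℝ) ≤ k + K := by exact_mod_cast this
          linarith
        · have : (k : ℝ) < M := by exact_mod_cast hkM
          linarith
      · have : (m : ℝ) * (k / M) = m + m * (((k : ℝ) - M) / M) := by field_simp; ring
        rw [this, e_add, e_natCast, one_mul]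
  rw [← expSum_sub]
  have heq : expSum (fun m => f m - 1) N ((k : ℝ) / M) = expSum (fun m => f m - 1) N β := by
    rw [expSum, expSum]
    exact sum_congr rfl fun m _ => by rw [heβ]
  rw [heq]
  refine (norm_expSum_le_by_parts (D := ε * N) fun x hx => ?_).trans ?_
  · simpa [sum_sub_distrib] using h.abs_sum_sub_le x hx
  · have hβN : |β| * N ≤ K := (mul_le_mul_of_nonneg_left hNM' (abs_nonneg _)).trans hβ
    have hpi := Real.pi_le_four
    calc ε * N * (1 + 2 * Real.pi * |β| * N) = ε * N * (1 + 2 * Real.pi * (|β| * N)) := by ring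
      _ ≤ ε * N * (1 + 2 * 4 * K) := by gcongr
      _ = _ := by ring

end PrimeLike

lemma e_sum {ι : Type*} (s : Finset ι) (x : ι → ℝ) : e (∑ i ∈ s, x i) = ∏ i ∈ s, e (x i) := by
  classical
  induction s using Finset.induction_on with
  | empty => simp [e_zero]
  | insert i s hi ih => rw [sum_insert hi, prod_insert hi, e_add, ih]

section
variable {ι : Type*} [Fintype ι] [DecidableEq ι]

/-- The weighted number of representations of `t` as a sum of variables `m i ∈ [0, n i)`. -/
noncomputable def repSum (f : ι → ℕ → ℝ) (n : ι → ℕ) (t : ℕ) : ℝ :=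
  ∑ m ∈ Fintype.piFinset fun i => range (n i), if ∑ i, m i = t then ∏ i, f i (m i) else 0

lemma prod_expSum_eq (f : ι → ℕ → ℝ) (n : ι → ℕ) (θ : ℝ) :
    ∏ i, expSum (f i) (n i) θ = ∑ m ∈ Fintype.piFinset fun i => range (n i),
      ((∏ i, f i (m i) : ℝ) : ℂ) * e ((∑ i, m i : ℕ) * θ) := by
  simp_rw [expSum, prod_univ_sum, prod_mul_distrib]
  refine sum_congr rfl fun m _ => ?_
  rw [Nat.cast_sum, sum_mul, e_sum]
  push_cast
  rfl

lemma sum_prod_expSum_eq [Nonempty ι] (f : ι → ℕ → ℝ) (n : ι → ℕ) {M t : ℕ} (ht : t < M)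
    (hn : ∑ i, n i ≤ M + t) :
    ∑ k ∈ range M, (∏ i, expSum (f i) (n i) ((k : ℝ) / M)) * e (-(t * ((k : ℝ) / M))) =
      M * (repSum f n t : ℂ) := by
  simp_rw [prod_expSum_eq, sum_mul, repSum]
  rw [sum_comm, Complex.ofReal_sum, mul_sum]
  refine sum_congr rfl fun m hm => ?_
  have hM : 0 < M := by lia
  have hM0 : (M : ℝ) ≠ 0 := by positivity
  have hlt : ∑ i, m i < ∑ i, n i :=
    sum_lt_sum_of_nonempty univ_nonempty fun i _ => mem_range.mp (Fintype.mem_piFinset.mp hm i)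
  have h1 : ∀ k : ℕ, ((∏ i, f i (m i) : ℝ) : ℂ) * e ((∑ i, m i : ℕ) * ((k : ℝ) / M)) *
      e (-(t * ((k : ℝ) / M))) = ((∏ i, f i (m i) : ℝ) : ℂ) *
      e (k * ((((∑ i, m i : ℕ) - t : ℤ) : ℝ) / M)) := fun k => by
    rw [mul_assoc, ← e_add]
    congr 2
    push_cast
    field_simp
    ring
  simp_rw [h1, ← mul_sum]
  split_ifs with h
  · rw [h, sub_self]
    simp [e_zero, mul_comm]
  · rw [sum_e_div_eq_zero, mul_zero, Complex.ofReal_zero, mul_zero]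
    intro hdvd
    have := Int.eq_zero_of_abs_lt_dvd hdvd (by rw [abs_lt]; constructor <;> lia)
    exact h (by lia)

lemma exists_of_repSum_pos {f : ι → ℕ → ℝ} {n : ι → ℕ} {t : ℕ} (h : 0 < repSum f n t) :
    ∃ m : ι → ℕ, ∑ i, m i = t ∧ ∀ i, f i (m i) ≠ 0 := by
  obtain ⟨m, -, hm⟩ := exists_ne_zero_of_sum_ne_zero h.ne'
  split_ifs at hm with hs
  · exact ⟨m, hs, fun i => prod_ne_zero_iff.mp hm i (mem_univ i)⟩
  · exact absurd rfl hm

end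

lemma norm_prod_sub_prod_mul_le {ι : Type*} [DecidableEq ι] {B η : ℝ} (a b : ι → ℂ)
    (hB : 0 ≤ B) (hη : 0 ≤ η) (ha : ∀ i, ‖a i‖ ≤ B) (hb : ∀ i, ‖b i‖ ≤ B)
    (hab : ∀ i, ‖a i - b i‖ ≤ η) (s : Finset ι) :
    ‖∏ i ∈ s, a i - ∏ i ∈ s, b i‖ * B ≤ #s * η * B ^ #s := by
  induction s using Finset.induction_on with
  | empty => simp
  | insert i s hi ih =>
    rw [prod_insert hi, prod_insert hi, card_insert_of_notMem hi]
    have h1 : ‖∏ j ∈ s, b j‖ ≤ B ^ #s := by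
      rw [norm_prod]
      exact (prod_le_prod (fun j _ => norm_nonneg (b j)) fun j _ => hb j).trans_eq (prod_const _)
    calc ‖a i * ∏ j ∈ s, a j - b i * ∏ j ∈ s, b j‖ * B
        = ‖a i * (∏ j ∈ s, a j - ∏ j ∈ s, b j) + (a i - b i) * ∏ j ∈ s, b j‖ * B := by
          congr 2; ring
      _ ≤ (‖a i‖ * ‖∏ j ∈ s, a j - ∏ j ∈ s, b j‖ + ‖a i - b i‖ * ‖∏ j ∈ s, b j‖) * B := by
          gcongr
          exact (norm_add_le _ _).trans (by rw [norm_mul, norm_mul])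
      _ = ‖a i‖ * (‖∏ j ∈ s, a j - ∏ j ∈ s, b j‖ * B) +
          ‖a i - b i‖ * ‖∏ j ∈ s, b j‖ * B := by ring
      _ ≤ B * (#s * η * B ^ #s) + η * B ^ #s * B := by
          gcongr
          · exact ha i
          · exact hab i
      _ = _ := by push_cast; ring

lemma prod_le_mul_sum_pow_five {x : Fin 6 → ℝ} (hx : ∀ i, 0 ≤ x i) (i : Fin 6) :
    ∏ j, x j ≤ x i * ∑ j, x j ^ 5 := by
  obtain ⟨l, hl⟩ := Finite.exists_max x
  rw [← mul_prod_erase univ x (mem_univ i)]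
  refine mul_le_mul_of_nonneg_left ?_ (hx i)
  calc ∏ j ∈ univ.erase i, x j ≤ ∏ j ∈ univ.erase i, x l :=
        prod_le_prod (fun j _ => hx j) fun j _ => hl j
    _ = x l ^ 5 := by rw [prod_const, card_erase_of_mem (mem_univ i), card_univ, Fintype.card_fin]
    _ ≤ _ := single_le_sum (f := fun j => x j ^ 5) (fun j _ => pow_nonneg (hx j) 5) (mem_univ l)

lemma prod_le_of_le {x : Fin 6 → ℝ} (hx : ∀ i, 0 ≤ x i) {B : ℝ} (h0 : x 0 ≤ B) (h1 : x 1 ≤ B)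
    (h2 : x 2 ≤ B) (h3 : x 3 ≤ B) : ∏ j, x j ≤ B ^ 4 * (1 / 2 * (x 4 ^ 2 + x 5 ^ 2)) := by
  have hB : 0 ≤ B := (hx 0).trans h0
  have := hx 0; have := hx 1; have := hx 2; have := hx 3; have := hx 4; have := hx 5
  rw [Fin.prod_univ_six]
  calc x 0 * x 1 * x 2 * x 3 * x 4 * x 5 = x 0 * x 1 * x 2 * x 3 * (x 4 * x 5) := by ring
    _ ≤ B * B * B * B * (1 / 2 * (x 4 ^ 2 + x 5 ^ 2)) :=
      mul_le_mul (by gcongr) (by nlinarith [sq_nonneg (x 4 - x 5)]) (by positivity) (by positivity)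
    _ = _ := by ring

lemma prod_le_large_add_small {x : Fin 6 → ℝ} (hx : ∀ i, 0 ≤ x i) {B t : ℝ} (ht : 0 ≤ t)
    (h0 : x 0 ≤ B) (h1 : x 1 ≤ B) (h2 : x 2 ≤ B) (h3 : x 3 ≤ B) :
    ∏ j, x j ≤ B ^ 4 * (1 / 2 * ((if t ≤ x 4 then x 4 ^ 2 else 0) +
      if t ≤ x 5 then x 5 ^ 2 else 0)) + t * ∑ j, x j ^ 5 := by
  have hS : 0 ≤ ∑ j, x j ^ 5 := sum_nonneg fun j _ => pow_nonneg (hx j) 5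
  by_cases h : t ≤ x 4 ∧ t ≤ x 5
  · rw [if_pos h.1, if_pos h.2]
    have := prod_le_of_le hx h0 h1 h2 h3
    have := mul_nonneg ht hS
    linarith
  · have hnn : 0 ≤ B ^ 4 * (1 / 2 * ((if t ≤ x 4 then x 4 ^ 2 else 0) +
        if t ≤ x 5 then x 5 ^ 2 else 0)) := by positivity
    suffices ∏ j, x j ≤ t * ∑ j, x j ^ 5 by linarith
    rcases not_and_or.mp h with h | h
    · exact (prod_le_mul_sum_pow_five hx 4).trans (by gcongr; exact (not_le.mp h).le)
    · exact (prod_le_mul_sum_pow_five hx 5).trans (by gcongr; exact (not_le.mp h).le)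

lemma mul_sub_le_repSum_one {N L : ℕ} (hN : 0 < N) (hNL : 4 * N ≤ L) :
    (N : ℝ) ^ 4 * (L - 4 * N) ≤
      repSum (fun _ _ => 1) ![N, N, N, N, L, L] (L - 1) := by
  have hcard : #(Fintype.piFinset fun i : Fin 5 => range (![N, N, N, N, L - 4 * N] i)) =
      N ^ 4 * (L - 4 * N) := by
    rw [Fintype.card_piFinset]
    simp only [card_range, Fin.prod_univ_five]
    change N * N * N * N * (L - 4 * N) = _
    ring
  have hrep : repSum (fun _ _ => 1) ![N, N, N, N, L, L] (L - 1) =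
      #{m ∈ Fintype.piFinset fun i => range (![N, N, N, N, L, L] i) | ∑ i, m i = L - 1} := by
    simp [repSum]
  have hle : #(Fintype.piFinset fun i : Fin 5 => range (![N, N, N, N, L - 4 * N] i)) ≤
      #{m ∈ Fintype.piFinset fun i => range (![N, N, N, N, L, L] i) | ∑ i, m i = L - 1} := by
    refine card_le_card_of_injOn (fun m => Fin.snoc (α := fun _ => ℕ) m (L - 1 - ∑ i, m i)) ?_ ?_
    · intro m hm
      have hm := Fintype.mem_piFinset.mp (mem_coe.mp hm)
      have h0 := mem_range.mp (hm 0)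
      have h1 := mem_range.mp (hm 1)
      have h2 := mem_range.mp (hm 2)
      have h3 := mem_range.mp (hm 3)
      have h4 := mem_range.mp (hm 4)
      simp at h0 h1 h2 h3 h4
      beta_reduce
      rw [mem_coe, mem_filter, Fintype.mem_piFinset]
      have hs : ∑ i, m i = m 0 + m 1 + m 2 + m 3 + m 4 := Fin.sum_univ_five m
      constructor
      · intro i
        rw [mem_range]
        refine Fin.lastCases ?_ (fun i => ?_) i
        · rw [Fin.snoc_last]
          change _ < L
          lia
        · rw [Fin.snoc_castSucc]
          fin_cases i
          · exact h0
          · exact h1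
          · exact h2
          · exact h3
          · change m 4 < L
            lia
      · rw [Fin.sum_univ_castSucc]
        simp only [Fin.snoc_castSucc, Fin.snoc_last]
        lia
    · intro m _ m' _ hmm
      exact (Fin.snoc_inj.mp hmm).1
  rw [hrep]
  calc (N : ℝ) ^ 4 * (L - 4 * N) = ((N ^ 4 * (L - 4 * N) : ℕ) : ℝ) := by
        push_cast [Nat.cast_sub hNL]; ring
    _ ≤ _ := by rw [← hcard]; exact_mod_cast hle

lemma card_major_le (M K : ℕ) : #{k ∈ range M | ¬ (K < k ∧ k + K < M)} ≤ 2 * K + 1 := by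
  calc #{k ∈ range M | ¬ (K < k ∧ k + K < M)} ≤ #(range (K + 1) ∪ Ico (M - K) M) := by
        refine card_le_card fun k hk => ?_
        simp only [mem_filter, mem_range, mem_union, mem_Ico] at hk ⊢
        lia
    _ ≤ #(range (K + 1)) + #(Ico (M - K) M) := card_union_le _ _
    _ ≤ _ := by rw [card_range, Nat.card_Ico]; lia

section
variable {f ν : Fin 6 → ℕ → ℝ} {n : Fin 6 → ℕ} {N L M K : ℕ} {ε δ τ : ℝ}

lemma sum_large_sq_le {f ν : ℕ → ℝ} (h : PrimeLike f ν L ε δ) (hL : 0 < L) (hM : M = 2 * L)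
    (hτ : 0 < τ) (hτ1 : τ ≤ 1 / 200) (hτK : 200 ≤ τ * K) (hK : 0 < K) (hε0 : 0 ≤ ε) (hεδ : ε ≤ δ)
    (hδ : δ ≤ τ ^ 2 / 100) :
    ∑ k ∈ range M with K < k ∧ k + K < M, (if τ * L ≤ ‖expSum f L ((k : ℝ) / M)‖ then
      ‖expSum f L ((k : ℝ) / M)‖ ^ 2 else 0) ≤ 3 / 2 * L * M := by
  have hL0 : (0 : ℝ) < L := by exact_mod_cast hL
  have hK0 : (0 : ℝ) < K := by exact_mod_cast hK
  have hM' : (M : ℝ) = 2 * L := by rw [hM]; push_cast; ring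
  rw [← sum_filter]
  refine sum_norm_expSum_sq_le_sharp (by lia) hL (by lia)
    ((filter_subset _ _).trans (filter_subset _ _)) (ε := δ) (ε' := τ / 100) hτ (by linarith)
    (by linarith) hδ le_rfl h.nonneg (h.sum_le.trans (by gcongr)) h.majorant_nonneg h.le_majorant
    h.fourier ?_ fun k hk => (mem_filter.mp hk).2
  intro k hk
  have hk := (mem_filter.mp (mem_filter.mp hk).1).2
  refine (h.norm_majorant_le (by lia) hK (le_abs_sub_mul_of_minor hk.1 hk.2)).trans ?_
  have h1 : (M : ℝ) / (2 * K) ≤ τ / 200 * L := by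
    rw [div_le_iff₀ (by positivity), hM']
    nlinarith
  have h2 : δ * L ≤ τ / 200 * L := by
    gcongr
    nlinarith
  linarith

lemma sum_minor_le (h : ∀ i, PrimeLike (f i) (ν i) (n i) ε δ) (hn : n = ![N, N, N, N, L, L])
    (hN : 0 < N) (hNL : N ≤ L) (hLN : L ≤ 200 * N) (hM : M = 2 * L) (hτ : 0 < τ)
    (hτ1 : τ ≤ 1 / 200) (hτK : 200 ≤ τ * K) (hε0 : 0 ≤ ε) (hεδ : ε ≤ δ) (hδ : δ ≤ τ ^ 2 / 100)
    (hεK : ε * (1 + 4 * K) ≤ 21 / 25) :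
    ∑ k ∈ range M with K < k ∧ k + K < M, ‖∏ i, expSum (f i) (n i) ((k : ℝ) / M)‖ ≤
      (21 / 25 * N) ^ 4 * (3 / 2 * L * M) + τ * L * (124464 * M * (L : ℝ) ^ 4) := by
  have hL0 : (0 : ℝ) < L := by exact_mod_cast hN.trans_le hNL
  have hK : 40000 ≤ K := by
    have : (40000 : ℝ) ≤ K := by nlinarith
    exact_mod_cast this
  have hnL : ∀ i, n i ≤ L := fun i => by
    rw [hn]
    fin_cases i <;> first | exact hNL | exact le_rfl
  have h0 : ∀ i, n i = N → ∀ k ∈ ({k ∈ range M | K < k ∧ k + K < M} : Finset ℕ),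
      ‖expSum (f i) (n i) ((k : ℝ) / M)‖ ≤ 21 / 25 * N := fun i hi k hk => by
    obtain ⟨hk1, hk2⟩ := (mem_filter.mp hk).2
    have := (h i).norm_expSum_le_of_minor hε0 hεδ (by nlinarith) (M := M) (by lia)
      ((hnL i).trans (by lia)) (by lia) (by rw [hi]; nlinarith) hεK hk1 hk2
    rwa [hi] at this ⊢
  have hlarge : ∀ i, n i = L → ∑ k ∈ range M with K < k ∧ k + K < M,
      (if τ * L ≤ ‖expSum (f i) (n i) ((k : ℝ) / M)‖ then
        ‖expSum (f i) (n i) ((k : ℝ) / M)‖ ^ 2 else 0) ≤ 3 / 2 * L * M := fun i hi => by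
    have hi' := h i
    rw [hi] at hi' ⊢
    exact sum_large_sq_le hi' (by lia) hM hτ hτ1 hτK (by lia) hε0 hεδ hδ
  have hfive : ∑ k ∈ range M with K < k ∧ k + K < M,
      ∑ i, ‖expSum (f i) (n i) ((k : ℝ) / M)‖ ^ 5 ≤ 124464 * M * (L : ℝ) ^ 4 := by
    rw [sum_comm]
    calc _ ≤ ∑ i : Fin 6, (20744 * M * (L : ℝ) ^ 4) := by
          refine sum_le_sum fun i _ => ?_
          refine (sum_le_sum_of_subset_of_nonneg (filter_subset _ _)
            fun _ _ _ => by positivity).trans (((h i).fifth_moment M ?_).trans ?_)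
          · exact (hnL i).trans (by lia)
          · gcongr
            exact hnL i
      _ = _ := by rw [sum_const, card_univ, Fintype.card_fin, nsmul_eq_mul]; push_cast; ring
  calc _ ≤ ∑ k ∈ range M with K < k ∧ k + K < M, ((21 / 25 * N : ℝ) ^ 4 * (1 / 2 *
        ((if τ * L ≤ ‖expSum (f 4) (n 4) ((k : ℝ) / M)‖ then
          ‖expSum (f 4) (n 4) ((k : ℝ) / M)‖ ^ 2 else 0) +
        if τ * L ≤ ‖expSum (f 5) (n 5) ((k : ℝ) / M)‖ then
          ‖expSum (f 5) (n 5) ((k : ℝ) / M)‖ ^ 2 else 0)) +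
        τ * L * ∑ i, ‖expSum (f i) (n i) ((k : ℝ) / M)‖ ^ 5) := by
        refine sum_le_sum fun k hk => ?_
        rw [norm_prod]
        exact prod_le_large_add_small (x := fun i => ‖expSum (f i) (n i) ((k : ℝ) / M)‖)
          (fun _ => norm_nonneg _) (by positivity) (h0 0 (by rw [hn]; rfl) k hk)
          (h0 1 (by rw [hn]; rfl) k hk) (h0 2 (by rw [hn]; rfl) k hk) (h0 3 (by rw [hn]; rfl) k hk)
    _ ≤ (21 / 25 * N) ^ 4 * (1 / 2 * (3 / 2 * L * M + 3 / 2 * L * M)) +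
        τ * L * (124464 * M * (L : ℝ) ^ 4) := by
        rw [sum_add_distrib, ← mul_sum, ← mul_sum, ← mul_sum, sum_add_distrib]
        gcongr
        · exact hlarge 4 (by rw [hn]; rfl)
        · exact hlarge 5 (by rw [hn]; rfl)
    _ = _ := by ring

lemma norm_expSum_one_mul_le (hM : 0 < M) {k : ℕ} (hk : K < k ∧ k + K < M) (N : ℕ) :
    ‖expSum (fun _ => 1) N ((k : ℝ) / M)‖ * (2 * K) ≤ M := by
  have := norm_sum_e_mul_two_mul_le hM (le_abs_sub_mul_of_minor hk.1 hk.2) N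
  simpa [expSum] using this

lemma sum_minor_one_le (hn : n = ![N, N, N, N, L, L]) (hL : 0 < L) (hM : M = 2 * L) (hK : 0 < K) :
    ∑ k ∈ range M with K < k ∧ k + K < M, ‖∏ i, expSum (fun _ => 1) (n i) ((k : ℝ) / M)‖ ≤
      ((L : ℝ) / K) ^ 4 * (L * M) := by
  have hK0 : (0 : ℝ) < K := by exact_mod_cast hK
  have hM' : (M : ℝ) = 2 * L := by rw [hM]; push_cast; ring
  have h0 : ∀ i, ∀ k ∈ ({k ∈ range M | K < k ∧ k + K < M} : Finset ℕ),
      ‖expSum (fun _ => 1) (n i) ((k : ℝ) / M)‖ ≤ L / K := fun i k hk => by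
    have := norm_expSum_one_mul_le (by lia) (mem_filter.mp hk).2 (n i)
    rw [le_div_iff₀ hK0]
    linarith
  have hsq : ∀ i, n i = L → ∑ k ∈ range M with K < k ∧ k + K < M,
      ‖expSum (fun _ => 1) (n i) ((k : ℝ) / M)‖ ^ 2 ≤ L * M := fun i hi => by
    refine (sum_le_sum_of_subset_of_nonneg (filter_subset _ _) fun _ _ _ => by positivity).trans ?_
    rw [hi, sum_norm_expSum_sq_range (by lia) (by lia)]
    simp [mul_comm]
  calc _ ≤ ∑ k ∈ range M with K < k ∧ k + K < M, ((L : ℝ) / K) ^ 4 * (1 / 2 *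
        (‖expSum (fun _ => 1) (n 4) ((k : ℝ) / M)‖ ^ 2 +
          ‖expSum (fun _ => 1) (n 5) ((k : ℝ) / M)‖ ^ 2)) := by
        refine sum_le_sum fun k hk => ?_
        rw [norm_prod]
        exact prod_le_of_le (x := fun i => ‖expSum (fun _ => 1) (n i) ((k : ℝ) / M)‖)
          (fun _ => norm_nonneg _) (h0 0 k hk) (h0 1 k hk) (h0 2 k hk) (h0 3 k hk)
    _ ≤ ((L : ℝ) / K) ^ 4 * (1 / 2 * (L * M + L * M)) := by
        rw [← mul_sum, ← mul_sum, sum_add_distrib]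
        gcongr
        · exact hsq 4 (by rw [hn]; rfl)
        · exact hsq 5 (by rw [hn]; rfl)
    _ = _ := by ring

lemma sum_major_le (h : ∀ i, PrimeLike (f i) (ν i) (n i) ε δ) (hnL : ∀ i, n i ≤ L)
    (hL : 0 < L) (hM : M = 2 * L) (hε0 : 0 ≤ ε) (hε1 : ε ≤ 1) :
    ∑ k ∈ range M with ¬ (K < k ∧ k + K < M), ‖∏ i, expSum (f i) (n i) ((k : ℝ) / M) -
      ∏ i, expSum (fun _ => 1) (n i) ((k : ℝ) / M)‖ ≤
      (2 * K + 1) * (192 * (ε * (1 + 8 * K)) * (L : ℝ) ^ 6) := by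
  have hL0 : (0 : ℝ) < L := by exact_mod_cast hL
  have hnL' : ∀ i, (n i : ℝ) ≤ L := fun i => by exact_mod_cast hnL i
  calc _ ≤ ∑ k ∈ range M with ¬ (K < k ∧ k + K < M),
        192 * (ε * (1 + 8 * K)) * (L : ℝ) ^ 6 := by
        refine sum_le_sum fun k hk => ?_
        obtain ⟨hkM, hk⟩ := mem_filter.mp hk
        have := norm_prod_sub_prod_mul_le (B := 2 * L) (η := ε * (1 + 8 * K) * L)
          (fun i => expSum (f i) (n i) ((k : ℝ) / M))
          (fun i => expSum (fun _ => 1) (n i) ((k : ℝ) / M)) (by positivity) (by positivity)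
          (fun i => ?_) (fun i => ?_) (fun i => ?_) univ
        · rw [card_univ, Fintype.card_fin] at this
          refine le_of_mul_le_mul_right (this.trans_eq ?_) (by positivity : (0 : ℝ) < 2 * L)
          push_cast
          ring
        · refine (norm_expSum_le (h i).nonneg _ _).trans ((h i).sum_le.trans ?_)
          gcongr
          · linarith
          · exact hnL i
        · refine (norm_expSum_le (fun _ => zero_le_one) _ _).trans ?_
          rw [sum_const, card_range, nsmul_eq_mul, mul_one]
          linarith [hnL' i]
        · refine ((h i).norm_expSum_sub_le hε0 (by lia) ((hnL i).trans (by lia))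
            (mem_range.mp hkM) hk).trans ?_
          gcongr
          exact hnL i
    _ ≤ _ := by
        rw [sum_const, nsmul_eq_mul]
        gcongr
        exact_mod_cast card_major_le M K

/-- The circle method: six `PrimeLike` weights have a point with coordinate sum `L - 1`. -/
theorem exists_sum_eq_of_primeLike (h : ∀ i, PrimeLike (f i) (ν i) (n i) ε δ)
    (hn : n = ![N, N, N, N, L, L]) (hN : 0 < N) (hNL : 100 * N ≤ L) (hLN : L ≤ 200 * N)
    (hτ : 0 < τ) (hτ1 : 124464 * 200 ^ 4 * τ ≤ 1 / 100) (hτK : 200 ≤ τ * K) (hε0 : 0 ≤ ε)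
    (hεδ : ε ≤ δ) (hδ : δ ≤ τ ^ 2 / 100)
    (hεK : 96 * (2 * K + 1) * (1 + 8 * K) * 200 ^ 4 * ε ≤ 1 / 100) :
    ∃ m : Fin 6 → ℕ, ∑ i, m i = L - 1 ∧ ∀ i, f i (m i) ≠ 0 := by
  refine exists_of_repSum_pos (n := n) ?_
  have hN0 : (0 : ℝ) < N := by exact_mod_cast hN
  have hL0 : (0 : ℝ) < L := by exact_mod_cast (by lia : 0 < L)
  have hLN' : (L : ℝ) ≤ 200 * N := by exact_mod_cast hLN
  have hNL' : 100 * (N : ℝ) ≤ L := by exact_mod_cast hNL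
  obtain ⟨M, hM⟩ : ∃ M, M = 2 * L := ⟨_, rfl⟩
  have hM' : (M : ℝ) = 2 * L := by rw [hM]; push_cast; ring
  have hτ2 : τ ≤ 1 / 200 := by linarith
  have hK : (40000 : ℝ) ≤ K := by nlinarith
  have hK0 : 0 < K := by exact_mod_cast (by linarith : (0 : ℝ) < K)
  have hεK' : 0 ≤ ε * K := by positivity
  have hεKK : 0 ≤ ε * K * K := by positivity
  have hnL : ∀ i, n i ≤ L := fun i => by
    rw [hn]
    fin_cases i <;> first | exact le_rfl | exact (by lia : N ≤ L)
  have hsum : ∑ i, n i ≤ M + (L - 1) := by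
    rw [hn, Fin.sum_univ_six]
    change N + N + N + N + L + L ≤ _
    lia
  have hF := sum_prod_expSum_eq f n (M := M) (t := L - 1) (by lia) hsum
  have hG := sum_prod_expSum_eq (fun _ _ => 1) n (M := M) (t := L - 1) (by lia) hsum
  set X : ℝ := (N : ℝ) ^ 4 * L * M with hX
  have hX0 : 0 < X := by rw [hX, hM']; positivity
  have hmain : 96 / 100 * X ≤ M * repSum (fun _ _ => 1) n (L - 1) := by
    have := mul_sub_le_repSum_one hN (by lia : 4 * N ≤ L)
    rw [← hn] at this
    calc 96 / 100 * X = M * ((N : ℝ) ^ 4 * (96 / 100 * L)) := by rw [hX]; ring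
      _ ≤ M * ((N : ℝ) ^ 4 * (L - 4 * N)) := by gcongr; linarith
      _ ≤ _ := by gcongr
  have hdiff : M * repSum (fun _ _ => 1) n (L - 1) - M * repSum f n (L - 1) ≤
      ∑ k ∈ range M, ‖∏ i, expSum (f i) (n i) ((k : ℝ) / M) -
        ∏ i, expSum (fun _ => 1) (n i) ((k : ℝ) / M)‖ := by
    rw [← neg_sub]
    refine (neg_le_abs _).trans ?_
    rw [← Real.norm_eq_abs, ← Complex.norm_real]
    push_cast
    rw [← hF, ← hG, ← sum_sub_distrib]
    refine norm_sum_le_of_le _ fun k _ => ?_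
    rw [← sub_mul, norm_mul, norm_e, mul_one]
  rw [← sum_filter_add_sum_filter_not _ (fun k => K < k ∧ k + K < M)] at hdiff
  have hL4 : (L : ℝ) ^ 4 ≤ 200 ^ 4 * (N : ℝ) ^ 4 := by rw [← mul_pow]; gcongr
  have hmajor := sum_major_le (K := K) h hnL (by lia) hM hε0 (by nlinarith)
  have hmajor' : (2 * K + 1) * (192 * (ε * (1 + 8 * K)) * (L : ℝ) ^ 6) ≤ 1 / 100 * X :=
    calc (2 * K + 1) * (192 * (ε * (1 + 8 * K)) * (L : ℝ) ^ 6)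
        = 96 * (2 * K + 1) * (1 + 8 * K) * ε * (L : ℝ) ^ 4 * (L * M) := by rw [hM']; ring
      _ ≤ 96 * (2 * K + 1) * (1 + 8 * K) * ε * (200 ^ 4 * (N : ℝ) ^ 4) * (L * M) := by gcongr
      _ = 96 * (2 * K + 1) * (1 + 8 * K) * 200 ^ 4 * ε * X := by rw [hX]; ring
      _ ≤ _ := by gcongr
  have hminor := sum_minor_le h hn hN (by lia) hLN hM hτ hτ2 hτK hε0 hεδ hδ (by nlinarith)
  have hminor' : (21 / 25 * N) ^ 4 * (3 / 2 * L * M) + τ * L * (124464 * M * (L : ℝ) ^ 4) ≤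
      76 / 100 * X :=
    calc (21 / 25 * N) ^ 4 * (3 / 2 * L * M) + τ * L * (124464 * M * (L : ℝ) ^ 4)
        ≤ (21 / 25 * N) ^ 4 * (3 / 2 * L * M) +
          τ * L * (124464 * M * (200 ^ 4 * (N : ℝ) ^ 4)) := by gcongr
      _ = ((21 / 25) ^ 4 * (3 / 2) + 124464 * 200 ^ 4 * τ) * X := by rw [hX]; ring
      _ ≤ _ := by gcongr; linarith
  have hone := sum_minor_one_le hn (by lia : 0 < L) hM hK0
  have hone' : ((L : ℝ) / K) ^ 4 * (L * M) ≤ 1 / 100 * X :=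
    calc ((L : ℝ) / K) ^ 4 * (L * M) ≤ (200 * N / 40000) ^ 4 * (L * M) := by gcongr
      _ = (1 / 200) ^ 4 * X := by rw [hX]; ring
      _ ≤ _ := by gcongr; norm_num
  have htri : ∑ k ∈ range M with K < k ∧ k + K < M, ‖∏ i, expSum (f i) (n i) ((k : ℝ) / M) -
      ∏ i, expSum (fun _ => 1) (n i) ((k : ℝ) / M)‖ ≤ 77 / 100 * X := by
    refine (sum_le_sum fun k _ => norm_sub_le _ _).trans ?_
    rw [sum_add_distrib]
    linarith
  have : 0 < M * repSum f n (L - 1) := by linarith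
  exact pos_of_mul_pos_right this (by positivity)

end

lemma exists_lt_coprime_of_int {W : ℕ} (hW : 0 < W) {x : ℤ}
    (hx : ∀ p : ℕ, p.Prime → p ∣ W → ¬ (p : ℤ) ∣ x) :
    ∃ b < W, b.Coprime W ∧ (W : ℤ) ∣ b - x := by
  have hW' : (0 : ℤ) < W := by exact_mod_cast hW
  have hb : ((x % W).toNat : ℤ) = x % W := Int.toNat_of_nonneg (Int.emod_nonneg _ hW'.ne')
  have hdvd : (W : ℤ) ∣ (x % W).toNat - x := by
    rw [hb]
    exact (Int.mod_modEq x W).symm.dvd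
  refine ⟨(x % W).toNat, ?_, Nat.coprime_of_dvd fun p hp hpb hpW => hx p hp hpW ?_, hdvd⟩
  · have := Int.emod_lt_of_pos x hW'
    lia
  · rw [← dvd_sub_right (Int.natCast_dvd_natCast.mpr hpb)]
    exact (Int.natCast_dvd_natCast.mpr hpW).trans hdvd

/-- Every even residue modulo a squarefree number is a sum of two invertible residues. -/
lemma exists_coprime_add {W : ℕ} (hW : Squarefree W) {n : ℕ} (hn : 2 ∣ n) :
    ∃ b < W, ∃ c < W, b.Coprime W ∧ c.Coprime W ∧ (W : ℤ) ∣ b + c - n := by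
  have hW0 : 0 < W := Nat.pos_of_ne_zero hW.ne_zero
  obtain ⟨D, hD⟩ := Nat.gcd_dvd_right n W
  set A := n.gcd W with hA
  have hAD : ∀ p : ℕ, p.Prime → p ∣ A → ¬ (p : ℤ) ∣ D := fun p hp hpA hpD =>
    Nat.squarefree_iff_prime_squarefree.mp hW p hp
      (hD ▸ mul_dvd_mul hpA (Int.natCast_dvd_natCast.mp hpD))
  have hAn : ∀ p : ℕ, p ∣ A → (p : ℤ) ∣ n := fun p hp =>
    Int.natCast_dvd_natCast.mpr (hp.trans (Nat.gcd_dvd_left n W))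
  have hnA : ∀ p : ℕ, p ∣ W → (p : ℤ) ∣ n → p ∣ A := fun p hpW hpn =>
    Nat.dvd_gcd (Int.natCast_dvd_natCast.mp hpn) hpW
  have hWD : ∀ p : ℕ, p.Prime → p ∣ W → ¬ p ∣ A → (p : ℤ) ∣ D := fun p hp hpW hpA =>
    Int.natCast_dvd_natCast.mpr ((hp.dvd_mul.mp (hD ▸ hpW)).resolve_left hpA)
  obtain ⟨b, hbW, hb, hbd⟩ := exists_lt_coprime_of_int hW0 (x := D - n) fun p hp hpW h => by
    by_cases hpA : p ∣ A
    · exact hAD p hp hpA ((dvd_sub_left (hAn p hpA)).mp h)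
    · exact hpA (hnA p hpW ((dvd_sub_right (hWD p hp hpW hpA)).mp h))
  obtain ⟨c, hcW, hc, hcd⟩ := exists_lt_coprime_of_int hW0 (x := 2 * n - D) fun p hp hpW h => by
    by_cases hpA : p ∣ A
    · exact hAD p hp hpA ((dvd_sub_right ((hAn p hpA).mul_left 2)).mp h)
    · have h2 : (p : ℤ) ∣ 2 * n := (dvd_sub_left (hWD p hp hpW hpA)).mp h
      rcases (Nat.prime_iff_prime_int.mp hp).dvd_or_dvd h2 with h2 | h2
      · have hp2 : p ∣ 2 := by exact_mod_cast h2
        exact hpA (Nat.dvd_gcd (hp2.trans hn) hpW)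
      · exact hpA (hnA p hpW h2)
  refine ⟨b, hbW, c, hcW, hb, hc, ?_⟩
  have := dvd_add hbd hcd
  rwa [show (b : ℤ) - (D - n) + (c - (2 * n - D)) = b + c - n by ring] at this

/-- Every even `n ≥ 6 W` is `≡` to a sum of six invertible residues modulo `W`. -/
lemma exists_residues {W : ℕ} (hW : Squarefree W) (hW2 : 2 ∣ W) {n : ℕ} (hn : 2 ∣ n)
    (hnW : 6 * W ≤ n) : ∃ b : Fin 6 → ℕ, (∀ i, b i < W ∧ (b i).Coprime W) ∧
      ∃ t : ℕ, n = W * t + ∑ i, b i := by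
  have hW0 : 0 < W := Nat.pos_of_ne_zero hW.ne_zero
  have hW1 : 1 < W := Nat.le_of_dvd hW0 hW2
  obtain ⟨b, hbW, c, hcW, hb, hc, hbc⟩ := exists_coprime_add hW hn
  have hW3 : (W - 1).Coprime W := (Nat.coprime_self_sub_left hW1.le).mpr (Nat.coprime_one_left W)
  refine ⟨![b, c, 1, W - 1, 1, W - 1], fun i => ?_, ?_⟩
  · fin_cases i
    · exact ⟨hbW, hb⟩
    · exact ⟨hcW, hc⟩
    · exact ⟨hW1, Nat.coprime_one_left W⟩
    · exact ⟨by change W - 1 < W; lia, hW3⟩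
    · exact ⟨hW1, Nat.coprime_one_left W⟩
    · exact ⟨by change W - 1 < W; lia, hW3⟩
  · have hs : ∑ i, ![b, c, 1, W - 1, 1, W - 1] i = b + c + 2 * W := by
      rw [Fin.sum_univ_six]
      change b + c + 1 + (W - 1) + 1 + (W - 1) = _
      lia
    have hdvd : W ∣ n - (b + c + 2 * W) := by
      rw [← Int.natCast_dvd_natCast, Nat.cast_sub (by lia), ← dvd_neg]
      have := dvd_add hbc (Dvd.intro_left (2 : ℤ) rfl)
      push_cast
      convert this using 1
      ring
    obtain ⟨t, ht⟩ := hdvd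
    exact ⟨t, by rw [hs]; lia⟩

/-- Every large even number is a sum of six primes. -/
theorem exists_six_primes : ∃ N₀ : ℕ, ∀ n ≥ N₀, 2 ∣ n →
    ∃ p : Fin 6 → ℕ, (∀ i, (p i).Prime) ∧ ∑ i, p i = n := by
  obtain ⟨τ, hτ, hτ1⟩ : ∃ τ : ℝ, 0 < τ ∧ 124464 * 200 ^ 4 * τ ≤ 1 / 100 :=
    ⟨1 / 100 / (124464 * 200 ^ 4), by norm_num, by norm_num⟩
  obtain ⟨K, hK⟩ : ∃ K : ℕ, 200 ≤ τ * K := by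
    obtain ⟨K, hK⟩ := exists_nat_ge (200 / τ)
    exact ⟨K, by rwa [mul_comm, ← div_le_iff₀ hτ]⟩
  obtain ⟨w, hw, hwτ⟩ : ∃ w : ℕ, 2 ≤ w ∧ (4 / w : ℝ) ≤ τ ^ 2 / 100 := by
    obtain ⟨w, hw⟩ := exists_nat_ge (max 2 (4 / (τ ^ 2 / 100)))
    have hw2 : (2 : ℝ) ≤ w := (le_max_left _ _).trans hw
    refine ⟨w, by exact_mod_cast hw2, ?_⟩
    rw [div_le_iff₀ (by linarith), mul_comm, ← div_le_iff₀ (by positivity)]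
    exact (le_max_right _ _).trans hw
  have hw0 : (0 : ℝ) < w := by exact_mod_cast (by lia : 0 < w)
  obtain ⟨ε, hε, hεw, hεK⟩ : ∃ ε : ℝ, 0 < ε ∧ ε ≤ 4 / w ∧
      96 * (2 * K + 1) * (1 + 8 * K) * 200 ^ 4 * ε ≤ 1 / 100 := by
    set Q : ℝ := 96 * (2 * K + 1) * (1 + 8 * K) * 200 ^ 4 with hQ
    have hQ0 : 0 < Q := by positivity
    refine ⟨min (4 / w) (1 / 100 / Q), by positivity, min_le_left _ _, ?_⟩
    calc Q * min (4 / w : ℝ) (1 / 100 / Q) ≤ Q * (1 / 100 / Q) := by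
          gcongr
          exact min_le_right _ _
      _ = 1 / 100 := mul_div_cancel₀ _ hQ0.ne'
  have hW0 := primorial_pos w
  have hWsq := squarefree_primorial w
  have hW2 : 2 ∣ primorial w := Nat.prime_two.dvd_primorial_iff.mpr hw
  have hweight : ∀ b : ℕ, ∃ N₀ : ℕ, b < primorial w → b.Coprime (primorial w) → ∀ N ≥ N₀,
      ∃ f ν : ℕ → ℝ, (∀ m, f m ≠ 0 → (primorial w * m + b).Prime) ∧
        PrimeLike f ν N ε (4 / w) := fun b => by
    by_cases hb : b < primorial w ∧ b.Coprime (primorial w)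
    · obtain ⟨N₀, h⟩ := exists_prime_weight hw hb.1 hb.2 hε
      exact ⟨N₀, fun _ _ => h⟩
    · exact ⟨0, fun h1 h2 => absurd ⟨h1, h2⟩ hb⟩
  choose g hg using hweight
  set W := primorial w
  set N₁ := (range W).sup g
  refine ⟨W * (100 * N₁ + 200) + 6 * W, fun n hn hn2 => ?_⟩
  obtain ⟨b, hb, t, ht⟩ := exists_residues hWsq hW2 hn2 (by lia)
  have hbs : ∑ i, b i ≤ 6 * W := by
    refine (sum_le_card_nsmul univ b W fun i _ => (hb i).1.le).trans_eq ?_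
    rw [card_univ, Fintype.card_fin, smul_eq_mul]
  have htN : 100 * N₁ + 200 ≤ t := le_of_mul_le_mul_left (by lia) hW0
  obtain ⟨L, hL⟩ : ∃ L, L = t + 1 := ⟨_, rfl⟩
  obtain ⟨N, hN⟩ : ∃ N, N = L / 100 := ⟨_, rfl⟩
  have hnN : ∀ i, N₁ ≤ ![N, N, N, N, L, L] i := fun i => by
    fin_cases i <;> first | exact (by lia : N₁ ≤ N) | exact (by lia : N₁ ≤ L)
  have hf : ∀ i, ∃ f ν : ℕ → ℝ, (∀ m, f m ≠ 0 → (W * m + b i).Prime) ∧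
      PrimeLike f ν (![N, N, N, N, L, L] i) ε (4 / w) := fun i =>
    hg (b i) (hb i).1 (hb i).2 _ ((le_sup (mem_range.mpr (hb i).1)).trans (hnN i))
  choose f ν hprime hlike using hf
  obtain ⟨m, hm, hfm⟩ := exists_sum_eq_of_primeLike hlike rfl (by lia) (by lia) (by lia) hτ hτ1 hK
    hε.le hεw hwτ hεK
  refine ⟨fun i => W * m i + b i, fun i => hprime i _ (hfm i), ?_⟩
  rw [sum_add_distrib, ← mul_sum, hm, ht, hL, Nat.add_sub_cancel]

end

end SevenPrimes

theorem sum_of_at_most_seven_primes :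
    ∃ N₀ : ℕ, ∀ n : ℕ, N₀ ≤ n →
      ∃ s : ℕ, 1 ≤ s ∧ s ≤ 7 ∧
        ∃ p : Fin s → ℕ, (∀ i, (p i).Prime) ∧ ∑ i, p i = n := by
  obtain ⟨N₀, h⟩ := SevenPrimes.exists_six_primes
  refine ⟨N₀ + 3, fun n hn => ?_⟩
  rcases Nat.even_or_odd n with h2 | h2
  · obtain ⟨p, hp, hs⟩ := h n (by lia) h2.two_dvd
    exact ⟨6, by lia, by lia, p, hp, hs⟩
  · obtain ⟨p, hp, hs⟩ := h (n - 3) (by lia) (by obtain ⟨k, hk⟩ := h2; exact ⟨k - 1, by lia⟩)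
    refine ⟨7, by lia, by lia, Fin.cons 3 p, Fin.cases Nat.prime_three hp, ?_⟩
    rw [Fin.sum_cons, hs]
    lia
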